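/- arXiv:2404.11059 — 3 statements merged into one kernel-verified Lean document; each statement's English description precedes it below -/
import Mathlib

section
/- Let q = p^m be a prime power, let F be a finite field with q² elements, let ν be a generator of F^× and set ω = ν^{q−1} (an element of multiplicative order q+1). Let w ≥ 2, l, c be integers and s ≥ 0. If c·w ≡ l·(p^s − 1) (mod q+1), then X_{w,c}⁻¹ · A_{w,l}^{[p^s]} · X_{w,c} = ω^c · A_{w,l}. -/
/-- Unitary analogue: over a field with `q²` elements, with `ω = ν^{q−1}` of order `q+1`,
if `c·w ≡ l·(p^s − 1) (mod q+1)` then `X_{w,c}⁻¹ · A_{w,l}^{[p^s]} · X_{w,c} = ω^c · A_{w,l}`. -/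
theorem abelian_supplements_stmt_13
    (p m q : ℕ) (hp : p.Prime) (hm : 0 < m) (hq : q = p ^ m)
    (F : Type*) [Field F] [Fintype F] [CharP F p] (hcard : Fintype.card F = q ^ 2)
    (ν : Fˣ) (hν : Subgroup.zpowers ν = ⊤)
    (w : ℕ) (hw : 2 ≤ w) (l c : ℤ) (s : ℕ)
    (hcong : ((q : ℤ) + 1) ∣ c * w - l * ((p : ℤ) ^ s - 1)) :
    let ω : Fˣ := ν ^ (q - 1)
    let A : Matrix (Fin w) (Fin w) F := Matrix.of fun i j =>
      if (i : ℕ) = (j : ℕ) + 1 then 1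
      else if (i : ℕ) = 0 ∧ (j : ℕ) = w - 1 then (-1 : F) ^ (w - 1) * ((ω ^ l : Fˣ) : F)
      else 0
    let X : Matrix (Fin w) (Fin w) F :=
      Matrix.diagonal fun i => ((ω ^ (c * ((w - 1 - (i : ℕ) : ℕ) : ℤ)) : Fˣ) : F)
    X⁻¹ * (A.map fun x => x ^ p ^ s) * X = ((ω ^ c : Fˣ) : F) • A := by
  intro ω A X
  haveI := Fact.mk hp
  have hω : ω ^ ((q : ℤ) + 1) = 1 := by
    have h1 : ω ^ (q + 1) = 1 := by
      have h2 : (q - 1) * (q + 1) = Fintype.card F - 1 := by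
        rw [hcard]
        have := Nat.sq_sub_sq q 1
        rw [one_pow] at this
        rw [this, mul_comm]
      change (ν ^ (q - 1)) ^ (q + 1) = 1
      rw [← pow_mul, h2]
      ext
      push_cast
      exact FiniteField.pow_card_sub_one_eq_one _ ν.ne_zero
    exact_mod_cast h1
  have hkey : ω ^ (c * w) = ω ^ (l * ((p : ℤ) ^ s - 1)) := by
    obtain ⟨k, hk⟩ := hcong
    have h3 : c * w = ((q : ℤ) + 1) * k + l * ((p : ℤ) ^ s - 1) := by linarith
    rw [h3, zpow_add, zpow_mul, hω, one_zpow, one_mul]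
  have hneg : ((-1 : F)) ^ p ^ s = -1 := by
    have := map_neg (iterateFrobenius F p s) 1
    rwa [map_one, iterateFrobenius_def] at this
  have hdet : IsUnit X.det := by
    rw [Matrix.det_diagonal, isUnit_iff_ne_zero]
    exact Finset.prod_ne_zero_iff.mpr fun i _ => Units.ne_zero _
  have hmain : (A.map fun x => x ^ p ^ s) * X = X * (((ω ^ c : Fˣ) : F) • A) := by
    ext i j
    have hps : p ^ s ≠ 0 := pow_ne_zero _ hp.ne_zero
    rw [Matrix.mul_diagonal, Matrix.diagonal_mul, Matrix.map_apply, Matrix.smul_apply, smul_eq_mul]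
    simp only [A, Matrix.of_apply]
    split_ifs with h1 h2
    · rw [one_pow, one_mul, mul_one, ← Units.val_mul, ← zpow_add]
      have h4 : w - 1 - (j : ℕ) = (w - 1 - (i : ℕ)) + 1 := by omega
      rw [h4]
      push_cast
      ring_nf
    · have h5 : w - 1 - (j : ℕ) = 0 := by omega
      have h6 : ((w - 1 - (i : ℕ) : ℕ) : ℤ) = w - 1 := by omega
      rw [h5, h6, mul_pow, ← pow_mul, mul_comm (w - 1), pow_mul, hneg]
      have h7 : (ω ^ l) ^ p ^ s = ω ^ (c * ((w : ℤ) - 1)) * (ω ^ c * ω ^ l) := by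
        rw [← zpow_natCast, ← zpow_mul, ← zpow_add, ← zpow_add]
        have h8 : l * ((p ^ s : ℕ) : ℤ) = l * ((p : ℤ) ^ s - 1) + l := by push_cast; ring
        rw [h8, zpow_add, ← hkey, ← zpow_add]
        congr 1
        ring
      have h9 := congrArg (Units.val) h7
      rw [Units.val_pow_eq_pow_val, Units.val_mul, Units.val_mul] at h9
      rw [h9]
      simp only [Nat.cast_zero, mul_zero, zpow_zero, Units.val_one, mul_one]
      ring
    · rw [zero_pow hps]; ring
  rw [Matrix.mul_assoc, hmain, Matrix.nonsing_inv_mul_cancel_left _ _ hdet]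
end

section
/- Let n ≥ 2 and let q be a prime power. Let G be a finite almost simple group whose socle G₀ is isomorphic to PSU(n,q), assumed nonabelian simple. If the quotient group G/G₀ is abelian, then G contains an abelian subgroup A such that G = A·G₀. -/
set_option linter.all false

structure HF (F : Type*) [Field F] [Fintype F] [StarRing F] (p q : ℕ) : Prop where
  hp : p.Prime
  ex : ∃ m, 0 < m ∧ q = p ^ m
  hs : ∀ x : F, star x = x ^ q
  hc : Fintype.card F = q ^ 2

namespace HF
variable {F : Type*} [Field F] [Fintype F] [StarRing F] {p q : ℕ}

theorem two_le (H : HF F p q) : 2 ≤ q := by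
  obtain ⟨m, hm, rfl⟩ := H.ex
  exact le_trans H.hp.two_le (Nat.le_self_pow hm.ne' p)

theorem charP (H : HF F p q) : CharP F p := by
  obtain ⟨m, hm, hq⟩ := H.ex
  have := Fact.mk H.hp
  refine charP_of_card_eq_prime_pow (f := m * 2) ?_
  rw [H.hc, hq, ← pow_mul]

theorem gen (H : HF F p q) : ∃ g : Fˣ, (∀ x : Fˣ, ∃ k : ℕ, x = g ^ k) ∧ orderOf g = (q - 1) * (q + 1) := by
  classical
  obtain ⟨g, hg⟩ := IsCyclic.exists_generator (α := Fˣ)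
  refine ⟨g, fun x => ?_, ?_⟩
  · obtain ⟨k, hk⟩ := (mem_powers_iff_mem_zpowers.2 (hg x))
    exact ⟨k, hk.symm⟩
  · rw [orderOf_eq_card_of_forall_mem_zpowers hg, Nat.card_eq_fintype_card, Fintype.card_units, H.hc]
    have := H.two_le
    obtain ⟨a, rfl⟩ := Nat.exists_eq_add_of_le this
    have e : 2 + a - 1 = a + 1 := by omega
    rw [e]
    apply Nat.sub_eq_of_eq_add
    ring

/-- F3 -/
theorem norm_surj (H : HF F p q) {y : F} (hy : star y = y) : ∃ μ : F, μ * star μ = y := by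
  by_cases h0 : y = 0
  · exact ⟨0, by simp [h0]⟩
  obtain ⟨g, hg, ho⟩ := H.gen
  obtain ⟨k, hk⟩ := hg (Units.mk0 y h0)
  have h2 := H.two_le
  have h1 : (g ^ k) ^ (q - 1) = 1 := by
    rw [← hk]
    ext
    rw [H.hs] at hy
    have : y ^ (q - 1) * y = 1 * y := by
      rw [← pow_succ, Nat.sub_add_cancel (by omega), hy, one_mul]
    simpa using mul_right_cancel₀ h0 this
  rw [← pow_mul] at h1
  have h3 := orderOf_dvd_of_pow_eq_one h1
  rw [ho, mul_comm] at h3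
  obtain ⟨j, rfl⟩ := Nat.dvd_of_mul_dvd_mul_right (by omega) h3
  refine ⟨((g ^ j : Fˣ) : F), ?_⟩
  have : y = ((Units.mk0 y h0 : Fˣ) : F) := rfl
  rw [H.hs, this, hk]
  push_cast
  ring

/-- F4 -/
theorem hilbert90 (H : HF F p q) {d : F} (hd : d * star d = 1) : ∃ l : F, l ≠ 0 ∧ star l = d * l := by
  have h0 : d ≠ 0 := by rintro rfl; simp at hd
  obtain ⟨g, hg, ho⟩ := H.gen
  obtain ⟨k, hk⟩ := hg (Units.mk0 d h0)
  have h2 := H.two_le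
  have h1 : (g ^ k) ^ (q + 1) = 1 := by
    rw [← hk]
    ext
    rw [H.hs] at hd
    simpa [pow_succ, mul_comm] using hd
  rw [← pow_mul] at h1
  have h3 := orderOf_dvd_of_pow_eq_one h1
  rw [ho] at h3
  obtain ⟨j, rfl⟩ := Nat.dvd_of_mul_dvd_mul_right (by omega) h3
  refine ⟨((g ^ j : Fˣ) : F), Units.ne_zero _, ?_⟩
  have : d = ((Units.mk0 d h0 : Fˣ) : F) := rfl
  rw [H.hs, this, hk]
  push_cast
  rw [← pow_mul, ← pow_add]
  congr 1
  obtain ⟨a, rfl⟩ := Nat.exists_eq_add_of_le h2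
  have e : 2 + a - 1 = a + 1 := by omega
  rw [e]; ring

theorem exists_eps (H : HF F p q) : ∃ e : F, e ≠ 0 ∧ star e = -e := by
  obtain ⟨l, h, h'⟩ := H.hilbert90 (d := -1) (by simp)
  exact ⟨l, h, by rw [h']; ring⟩

theorem exists_star_ne (H : HF F p q) : ∃ y : F, star y ≠ y := by
  obtain ⟨g, hg, ho⟩ := H.gen
  refine ⟨g, fun h => ?_⟩
  have h2 := H.two_le
  rw [H.hs] at h
  have h1 : g ^ (q - 1) = 1 := by
    have : g ^ (q - 1) * g = 1 * g := by
      rw [← pow_succ, Nat.sub_add_cancel (by omega), one_mul]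
      ext; simpa using h
    exact mul_right_cancel this
  have := Nat.le_of_dvd (by omega) (orderOf_dvd_of_pow_eq_one h1)
  rw [ho] at this
  nlinarith [Nat.sub_add_cancel (show 1 ≤ q by omega)]

theorem trace_surj (H : HF F p q) {y : F} (hy : star y = y) : ∃ c : F, c + star c = y := by
  have : ∃ x : F, x + star x ≠ 0 := by
    by_contra! h
    obtain ⟨y, hy⟩ := H.exists_star_ne
    have h1 := h 1
    rw [star_one] at h1
    have h3 := h y
    apply hy
    have : star y - y = (y + star y) - (1 + 1) * y := by ring
    rw [h1, h3] at this
    simpa [sub_eq_zero] using this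
  obtain ⟨x, hx⟩ := this
  refine ⟨y * x / (x + star x), ?_⟩
  simp only [star_div₀, star_mul', star_add, star_star, hy]
  rw [add_comm (star x) x]
  field_simp

theorem exists_norm_one_ne (H : HF F p q) : ∃ c : F, c * star c = 1 ∧ c ≠ 1 := by
  obtain ⟨y, hy⟩ := H.exists_star_ne
  have h0 : y ≠ 0 := by rintro rfl; simp at hy
  have h1 : star y ≠ 0 := by simpa using h0
  refine ⟨y / star y, ?_, ?_⟩
  · simp only [star_div₀, star_star]; field_simp
  · intro h; rw [div_eq_one_iff_eq h1] at h; exact hy h.symm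

/-- the nonzero `p`-power torsion is trivial -/
theorem pow_p_eq_one (H : HF F p q) {x : F} {k : ℕ} (h : x ^ (p ^ k) = 1) : x = 1 := by
  have := H.charP
  have := Fact.mk H.hp
  have h2 : (x - 1) ^ (p ^ k) = 0 := by rw [sub_pow_char_pow, h]; simp
  exact sub_eq_zero.1 (pow_eq_zero_iff (pow_ne_zero _ H.hp.ne_zero) |>.1 h2)

end HF
set_option linter.all false

abbrev VV (F : Type*) (r : ℕ) := F × F × (Fin r → F)

namespace UV
variable {F : Type*} [Field F] [Fintype F] [StarRing F] {p q r : ℕ}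

def hw (w z : Fin r → F) : F := ∑ i, star (w i) * z i

theorem hw_add_left (a b z : Fin r → F) : hw (a + b) z = hw a z + hw b z := by
  simp [hw, add_mul, Finset.sum_add_distrib]
theorem hw_add_right (a b z : Fin r → F) : hw z (a + b) = hw z a + hw z b := by
  simp [hw, mul_add, Finset.sum_add_distrib]
theorem hw_smul_left (a : F) (b z : Fin r → F) : hw (a • b) z = star a * hw b z := by
  simp [hw, Finset.mul_sum, mul_assoc]
theorem hw_smul_right (a : F) (b z : Fin r → F) : hw z (a • b) = a * hw z b := by
  simp [hw, Finset.mul_sum, mul_left_comm]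
theorem hw_neg_left (b z : Fin r → F) : hw (-b) z = - hw b z := by
  simp [hw]
theorem hw_neg_right (b z : Fin r → F) : hw z (-b) = - hw z b := by
  simp [hw]
theorem hw_zero_left (z : Fin r → F) : hw 0 z = 0 := by simp [hw]
theorem hw_zero_right (z : Fin r → F) : hw z 0 = 0 := by simp [hw]
theorem star_hw (w z : Fin r → F) : star (hw w z) = hw z w := by
  simp [hw, mul_comm]
theorem hw_single_left (i : Fin r) (a : F) (z : Fin r → F) : hw (Pi.single i a) z = star a * z i := by
  rw [hw, Finset.sum_eq_single i]
  · simp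
  · intro j _ hj; simp [Pi.single_eq_of_ne hj]
  · simp
theorem hw_single_right (i : Fin r) (a : F) (z : Fin r → F) : hw z (Pi.single i a) = star (z i) * a := by
  rw [← star_hw, hw_single_left]; simp [mul_comm]

def hh (u v : VV F r) : F := star u.1 * v.2.1 + star u.2.1 * v.1 + hw u.2.2 v.2.2

theorem hh_add_left (a b z : VV F r) : hh (a + b) z = hh a z + hh b z := by
  simp [hh, hw_add_left]; ring
theorem hh_add_right (a b z : VV F r) : hh z (a + b) = hh z a + hh z b := by
  simp [hh, hw_add_right]; ring
theorem hh_smul_left (a : F) (b z : VV F r) : hh (a • b) z = star a * hh b z := by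
  simp [hh, hw_smul_left]; ring
theorem hh_smul_right (a : F) (b z : VV F r) : hh z (a • b) = a * hh z b := by
  simp [hh, hw_smul_right]; ring
theorem star_hh (w z : VV F r) : star (hh w z) = hh z w := by
  simp [hh, star_hw]; ring
theorem hh_zero_left (z : VV F r) : hh 0 z = 0 := by simp [hh, hw_zero_left]
theorem hh_zero_right (z : VV F r) : hh z 0 = 0 := by simp [hh, hw_zero_right]

def ee : VV F r := (1, 0, 0)
def ff : VV F r := (0, 1, 0)
def ww (z : Fin r → F) : VV F r := (0, 0, z)

theorem hh_ee (v : VV F r) : hh ee v = v.2.1 := by simp [hh, ee, hw_zero_left]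
theorem hh_ff (v : VV F r) : hh ff v = v.1 := by simp [hh, ff, hw_zero_left]
theorem hh_ww (w : Fin r → F) (v : VV F r) : hh (ww w) v = hw w v.2.2 := by simp [hh, ww]
theorem hh_ee' (v : VV F r) : hh v ee = star v.2.1 := by simp [hh, ee, hw_zero_right]
theorem hh_ff' (v : VV F r) : hh v ff = star v.1 := by simp [hh, ff, hw_zero_right]
theorem hh_ww' (w : Fin r → F) (v : VV F r) : hh v (ww w) = hw v.2.2 w := by simp [hh, ww]

theorem decomp (v : VV F r) : v = v.1 • ee + v.2.1 • ff + ww v.2.2 := by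
  obtain ⟨x, y, z⟩ := v
  ext <;> simp [ee, ff, ww]

theorem ee_ne : (ee : VV F r) ≠ 0 := by simp [ee, Prod.ext_iff]
theorem ff_ne : (ff : VV F r) ≠ 0 := by simp [ff, Prod.ext_iff]

theorem hw_nondeg (u : Fin r → F) (h : ∀ x, hw u x = 0) : u = 0 := by
  ext i
  have := h (Pi.single i 1)
  simpa [hw_single_right] using this

theorem hh_nondeg (u : VV F r) (h : ∀ x, hh u x = 0) : u = 0 := by
  have h1 := h ee
  have h2 := h ff
  have h3 : u.2.2 = 0 := hw_nondeg _ fun x => by rw [← hh_ww']; exact h _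
  rw [hh_ee', star_eq_zero] at h1
  rw [hh_ff', star_eq_zero] at h2
  exact Prod.ext h2 (Prod.ext h1 h3)

theorem ext_hh (u v : VV F r) (h : ∀ x, hh u x = hh v x) : u = v := by
  rw [← sub_eq_zero]
  apply hh_nondeg
  intro x
  rw [sub_eq_add_neg, hh_add_left, ← neg_one_smul F v, hh_smul_left, h]; simp

/-- linear automorphisms agree if they agree on `ee`, `ff`, `ww z` -/
theorem ext_lin {g h : VV F r ≃ₗ[F] VV F r} (he : g ee = h ee) (hf : g ff = h ff)
    (hw : ∀ z, g (ww z) = h (ww z)) : g = h := by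
  ext1 v
  rw [decomp v]
  simp only [map_add, map_smul, he, hf, hw]

abbrev GV (F : Type*) [Field F] (r : ℕ) := VV F r ≃ₗ[F] VV F r

theorem mul_app (g h : GV F r) (v : VV F r) : (g * h) v = g (h v) := rfl
theorem inv_app (g : GV F r) (v : VV F r) : g (g⁻¹ v) = v := g.apply_symm_apply v
theorem inv_app' (g : GV F r) (v : VV F r) : g⁻¹ (g v) = v := g.symm_apply_apply v
theorem one_app (v : VV F r) : (1 : GV F r) v = v := rfl

def IsIso (g : GV F r) : Prop := ∀ u v, hh (g u) (g v) = hh u v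

def SS (F : Type*) [Field F] [StarRing F] (r : ℕ) : Subgroup (GV F r) where
  carrier := {g | (∀ u v, hh (g u) (g v) = hh u v) ∧ LinearEquiv.det g = 1}
  mul_mem' := by
    rintro a b ⟨ha, ha'⟩ ⟨hb, hb'⟩
    refine ⟨fun u v => ?_, by rw [map_mul, ha', hb', one_mul]⟩
    change hh (a (b u)) (a (b v)) = _
    rw [ha, hb]
  one_mem' := ⟨fun u v => rfl, map_one _⟩
  inv_mem' := by
    rintro a ⟨ha, ha'⟩
    refine ⟨fun u v => ?_, by rw [map_inv, ha', inv_one]⟩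
    change hh (a.symm u) (a.symm v) = _
    rw [← ha, LinearEquiv.apply_symm_apply, LinearEquiv.apply_symm_apply]

theorem SS.iso {g : GV F r} (hg : g ∈ SS F r) (u v : VV F r) : hh (g u) (g v) = hh u v := hg.1 u v

theorem SS.mem_of_pow (H : HF F p q) {g : GV F r} (hg : ∀ u v, hh (g u) (g v) = hh u v) {k : ℕ}
    (hk : g ^ (p ^ k) = 1) : g ∈ SS F r := by
  refine ⟨hg, ?_⟩
  have := congrArg LinearEquiv.det hk
  rw [map_pow, map_one] at this
  ext
  apply H.pow_p_eq_one (k := k)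
  have := congrArg Units.val this
  simpa using this

/-! ### root elements -/

def rr (w : Fin r → F) (c : F) : GV F r where
  toFun v := (v.1 + c * v.2.1 - hw w v.2.2, v.2.1, v.2.2 + v.2.1 • w)
  invFun v := (v.1 + (- c - hw w w) * v.2.1 - hw (-w) v.2.2, v.2.1, v.2.2 + v.2.1 • (-w))
  map_add' u v := by
    ext <;> simp [hw_add_right, add_smul] <;> ring
  map_smul' a v := by
    ext <;> simp [hw_smul_right, mul_assoc] <;> ring
  left_inv v := by
    ext <;> simp [hw_add_right, hw_smul_right, hw_neg_left]; ring
  right_inv v := by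
    ext <;> simp [hw_add_right, hw_smul_right, hw_neg_left, hw_neg_right]; ring

theorem rr_app (w : Fin r → F) (c : F) (v : VV F r) :
    rr w c v = (v.1 + c * v.2.1 - hw w v.2.2, v.2.1, v.2.2 + v.2.1 • w) := rfl

theorem rr_mul (w w' : Fin r → F) (c c' : F) :
    rr w c * rr w' c' = rr (w + w') (c + c' - hw w w') := by
  ext1 v
  rw [mul_app]
  simp only [rr_app]
  ext
  · simp [hw_add_right, hw_smul_right, hw_add_left]; ring
  · simp
  · simp; ring

theorem rr_zero : rr (0 : Fin r → F) 0 = 1 := by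
  ext1 v
  rw [one_app]
  ext <;> simp [rr_app, hw_zero_left]

theorem rr_inv (w : Fin r → F) (c : F) : (rr w c)⁻¹ = rr (-w) (-c - hw w w) := by
  rw [inv_eq_iff_mul_eq_one, rr_mul, ← rr_zero]
  congr 1
  · simp
  · simp [hw_neg_right]; ring

theorem rr_ee (w : Fin r → F) (c : F) : rr w c ee = ee := by
  simp [rr_app, ee, hw_zero_right]
theorem rr_ff (w : Fin r → F) (c : F) : rr w c ff = (c, 1, w) := by
  simp [rr_app, ff, hw_zero_right]
theorem rr_ww (w : Fin r → F) (c : F) (z) : rr w c (ww z) = (- hw w z, 0, z) := by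
  simp [rr_app, ww]

theorem rr_inj {w w' : Fin r → F} {c c' : F} (h : rr w c = rr w' c') : w = w' ∧ c = c' := by
  have := congrArg (fun g : GV F r => g ff) h
  simp only [rr_ff, Prod.mk.injEq] at this
  exact ⟨this.2.2, this.1⟩

theorem rr_iso {w : Fin r → F} {c : F} (h : c + star c + hw w w = 0) (u v) :
    hh (rr w c u) (rr w c v) = hh u v := by
  simp only [rr_app, hh, hw_add_left, hw_add_right, hw_smul_left, hw_smul_right]
  simp only [star_sub, star_add, star_mul', star_hw]
  linear_combination (star u.2.1 * v.2.1) * h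

theorem rr_pow (w : Fin r → F) (c : F) (k : ℕ) : ∃ d, (rr w c) ^ k = rr ((k : F) • w) d ∧
    (w = 0 → d = k * c) := by
  induction k with
  | zero => exact ⟨0, by simp [rr_zero], by simp⟩
  | succ k ih =>
    obtain ⟨d, hd, hd'⟩ := ih
    refine ⟨d + c - hw ((k : F) • w) w, ?_, ?_⟩
    · rw [pow_succ, hd, rr_mul]
      push_cast
      rw [add_smul, one_smul]
    · rintro rfl
      rw [hd' rfl]; simp [hw_zero_right]; ring

theorem rr_pow_p (H : HF F p q) (w : Fin r → F) (c : F) : (rr w c) ^ (p ^ 2) = 1 := by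
  have := H.charP
  obtain ⟨d, hd, -⟩ := rr_pow w c p
  rw [pow_two, pow_mul, hd]
  simp only [CharP.cast_eq_zero, zero_smul]
  obtain ⟨d', hd', h2⟩ := rr_pow (0 : Fin r → F) d p
  rw [hd', h2 rfl]
  simp [rr_zero]

theorem rr_mem (H : HF F p q) {w : Fin r → F} {c : F} (h : c + star c + hw w w = 0) :
    rr w c ∈ SS F r := SS.mem_of_pow H (rr_iso h) (rr_pow_p H w c)

/-- elements of SS of this form satisfy the trace condition -/
theorem rr_cond {w : Fin r → F} {c : F} (h : rr w c ∈ SS F r) : c + star c + hw w w = 0 := by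
  have := SS.iso h ff ff
  rw [rr_ff] at this
  simp [hh, ff, hw_zero_left] at this
  linear_combination this

/-- transvections -/
noncomputable def tv (u : VV F r) (c : F) : GV F r :=
  open Classical in
  if h : hh u u = 0 then
  { toFun := fun x => x + (c * hh u x) • u
    invFun := fun x => x + (-c * hh u x) • u
    map_add' := fun x y => by rw [hh_add_right, mul_add, add_smul]; abel
    map_smul' := fun a x => by
      rw [hh_smul_right, smul_add, smul_smul, RingHom.id_apply]; congr 2; ring
    left_inv := fun x => by
      simp only [hh_add_right, hh_smul_right, h, mul_zero, add_zero]
      rw [add_assoc, ← add_smul]; simp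
    right_inv := fun x => by
      simp only [hh_add_right, hh_smul_right, h, mul_zero, add_zero]
      rw [add_assoc, ← add_smul]; simp }
  else 1

theorem tv_app {u : VV F r} (h : hh u u = 0) (c : F) (x : VV F r) :
    tv u c x = x + (c * hh u x) • u := by
  rw [tv, dif_pos h]; rfl

theorem tv_mul {u : VV F r} (h : hh u u = 0) (c d : F) : tv u c * tv u d = tv u (c + d) := by
  ext1 x
  rw [mul_app]
  simp only [tv_app h, hh_add_right, hh_smul_right, h, mul_zero, add_zero]
  rw [add_assoc, ← add_smul]; congr 2; ring

theorem tv_zero {u : VV F r} (h : hh u u = 0) : tv u 0 = 1 := by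
  ext1 x; simp [tv_app h, one_app]

theorem tv_pow {u : VV F r} (h : hh u u = 0) (c : F) (k : ℕ) : tv u c ^ k = tv u (k * c) := by
  induction k with
  | zero => simp [tv_zero h]
  | succ k ih => rw [pow_succ, ih, tv_mul h]; congr 1; push_cast; ring

theorem tv_iso {u : VV F r} (h : hh u u = 0) {c : F} (hc : c + star c = 0) (x y) :
    hh (tv u c x) (tv u c y) = hh x y := by
  simp only [tv_app h, hh_add_right, hh_smul_right, hh_add_left, hh_smul_left, h, star_mul', star_hh]
  linear_combination (hh x u * hh u y) * hc

theorem tv_mem (H : HF F p q) {u : VV F r} (h : hh u u = 0) {c : F} (hc : c + star c = 0) :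
    tv u c ∈ SS F r := by
  refine SS.mem_of_pow H (k := 1) (tv_iso h hc) ?_
  have := H.charP
  rw [tv_pow h, pow_one, CharP.cast_eq_zero, zero_mul, tv_zero h]

theorem tv_conj {u : VV F r} (h : hh u u = 0) (c : F) {g : GV F r}
    (hg : ∀ u v, hh (g u) (g v) = hh u v) : g * tv u c * g⁻¹ = tv (g u) c := by
  have h' : hh (g u) (g u) = 0 := by rw [hg, h]
  ext1 x
  rw [mul_app, mul_app, tv_app h, tv_app h', map_add, inv_app, map_smul]
  rw [← hg, inv_app]

theorem tv_smul {u : VV F r} (h : hh u u = 0) (c a : F) : tv (a • u) c = tv u (a * star a * c) := by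
  have h' : hh (a • u) (a • u) = 0 := by rw [hh_smul_left, hh_smul_right, h]; simp
  ext1 x
  rw [tv_app h, tv_app h', hh_smul_left, smul_smul]; congr 2; ring

theorem hee : hh (ee : VV F r) ee = 0 := by rw [hh_ee]; rfl
theorem hff : hh (ff : VV F r) ff = 0 := by rw [hh_ff]; rfl
theorem hef : hh (ee : VV F r) ff = 1 := by simp [hh_ee, ff]
theorem hfe : hh (ff : VV F r) ee = 1 := by simp [hh_ff, ee]

theorem tv_ee (c : F) : tv (ee : VV F r) c = rr 0 c := by
  ext1 x
  rw [tv_app hee, rr_app, hh_ee]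
  ext <;> simp [ee, hw_zero_left]

theorem tv_ff_app (b : F) (x : VV F r) : tv ff b x = (x.1, x.2.1 + b * x.1, x.2.2) := by
  rw [tv_app hff, hh_ff]
  ext <;> simp [ff]

/-! ### the structure of stabilizers -/

theorem W_of_fix {g : GV F r} (hg : ∀ u v, hh (g u) (g v) = hh u v) {l : F} (he : g ee = l • ee) (z) :
    (g (ww z)).2.1 = 0 := by
  have h0 : l ≠ 0 := by
    rintro rfl
    rw [zero_smul] at he
    exact ee_ne (g.map_eq_zero_iff.1 he)
  have := hg ee (ww z)
  rw [he, hh_smul_left, hh_ee, hh_ee] at this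
  have h1 : star l ≠ 0 := by simpa using h0
  simpa [ww, h0] using this

theorem W_of_fix' {g : GV F r} (hg : ∀ u v, hh (g u) (g v) = hh u v) {l : F} (he : g ff = l • ff) (z) :
    (g (ww z)).1 = 0 := by
  have h0 : l ≠ 0 := by
    rintro rfl
    rw [zero_smul] at he
    exact ff_ne (g.map_eq_zero_iff.1 he)
  have := hg ff (ww z)
  rw [he, hh_smul_left, hh_ff, hh_ff] at this
  simpa [ww, h0] using this

/-- characterization of `R` -/
theorem mem_R {g : GV F r} (hg : ∀ u v, hh (g u) (g v) = hh u v) (he : g ee = ee)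
    (hz : ∀ z, (g (ww z)).2.2 = z) :
    g = rr (g ff).2.2 (g ff).1 := by
  have hy : (g ff).2.1 = 1 := by
    have := hg ee ff
    rwa [he, hh_ee, hef] at this
  have hy0 : ∀ z, (g (ww z)).2.1 = 0 := fun z => by
    have := hg ee (ww z)
    rwa [he, hh_ee, hh_ee] at this
  apply ext_lin
  · rw [he, rr_ee]
  · rw [rr_ff, ← hy]
  · intro z
    rw [rr_ww]
    have h3 := hg ff (ww z)
    rw [hh_ff, hh, hy, hy0, hz, star_one] at h3
    change _ = (0 : F) at h3
    have : (g (ww z)).1 = - hw (g ff).2.2 z := by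
      linear_combination h3
    exact Prod.ext this (Prod.ext (hy0 z) (hz z))

end UV
set_option linter.all false

namespace UV
variable {F : Type*} [Field F] [Fintype F] [StarRing F] {p q r : ℕ}

def IsScal (g : GV F r) : Prop := ∃ z : F, ∀ v, g v = z • v

structure Pr {Q : Type*} [Group Q] (ρ₁ ρ₂ : SS F r →* Q) : Prop where
  s1 : Function.Surjective ρ₁
  s2 : Function.Surjective ρ₂
  k1 : ∀ g : SS F r, ρ₁ g = 1 ↔ IsScal g.1
  k2 : ∀ g : SS F r, ρ₂ g = 1 ↔ IsScal g.1

def Rel {Q : Type*} [Group Q] (ρ₁ ρ₂ : SS F r →* Q) (g g' : GV F r) : Prop :=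
  ∃ (h : g ∈ SS F r) (h' : g' ∈ SS F r), ρ₁ ⟨g, h⟩ = ρ₂ ⟨g', h'⟩

section
variable {Q : Type*} [Group Q] {ρ₁ ρ₂ : SS F r →* Q}

theorem Pr.symm (P : Pr ρ₁ ρ₂) : Pr ρ₂ ρ₁ := ⟨P.s2, P.s1, P.k2, P.k1⟩

theorem Rel.symm {g g' : GV F r} (h : Rel ρ₁ ρ₂ g g') : Rel ρ₂ ρ₁ g' g := by
  obtain ⟨a, b, c⟩ := h; exact ⟨b, a, c.symm⟩

theorem Rel.mul {g g' k k' : GV F r} (h : Rel ρ₁ ρ₂ g g') (h' : Rel ρ₁ ρ₂ k k') :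
    Rel ρ₁ ρ₂ (g * k) (g' * k') := by
  obtain ⟨a, b, c⟩ := h
  obtain ⟨a', b', c'⟩ := h'
  refine ⟨mul_mem a a', mul_mem b b', ?_⟩
  have e1 : (⟨g * k, mul_mem a a'⟩ : SS F r) = ⟨g, a⟩ * ⟨k, a'⟩ := rfl
  have e2 : (⟨g' * k', mul_mem b b'⟩ : SS F r) = ⟨g', b⟩ * ⟨k', b'⟩ := rfl
  rw [e1, e2, map_mul, map_mul, c, c']

theorem Rel.inv {g g' : GV F r} (h : Rel ρ₁ ρ₂ g g') : Rel ρ₁ ρ₂ g⁻¹ g'⁻¹ := by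
  obtain ⟨a, b, c⟩ := h
  refine ⟨inv_mem a, inv_mem b, ?_⟩
  have e1 : (⟨g⁻¹, inv_mem a⟩ : SS F r) = ⟨g, a⟩⁻¹ := rfl
  have e2 : (⟨g'⁻¹, inv_mem b⟩ : SS F r) = ⟨g', b⟩⁻¹ := rfl
  rw [e1, e2, map_inv, map_inv, c]

theorem Rel.conj {g g' k k' : GV F r} (h : Rel ρ₁ ρ₂ g g') (h' : Rel ρ₁ ρ₂ k k') :
    Rel ρ₁ ρ₂ (g * k * g⁻¹) (g' * k' * g'⁻¹) := (h.mul h').mul h.inv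

theorem Rel.one : Rel ρ₁ ρ₂ 1 1 := by
  refine ⟨one_mem _, one_mem _, ?_⟩
  have : (⟨1, one_mem _⟩ : SS F r) = 1 := rfl
  rw [this, map_one, map_one]

theorem Pr.exists_right (P : Pr ρ₁ ρ₂) {g : GV F r} (h : g ∈ SS F r) : ∃ g', Rel ρ₁ ρ₂ g g' := by
  obtain ⟨⟨g', h'⟩, e⟩ := P.s2 (ρ₁ ⟨g, h⟩)
  exact ⟨g', h, h', e.symm⟩

theorem Pr.exists_left (P : Pr ρ₁ ρ₂) {g' : GV F r} (h : g' ∈ SS F r) : ∃ g, Rel ρ₁ ρ₂ g g' := by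
  obtain ⟨g, e⟩ := P.symm.exists_right h
  exact ⟨g, e.symm⟩

theorem Pr.scal_left (P : Pr ρ₁ ρ₂) {g : GV F r} (h : Rel ρ₁ ρ₂ g 1) : IsScal g := by
  obtain ⟨a, b, c⟩ := h
  rw [← P.k1 ⟨g, a⟩, c]
  exact map_one _

theorem Pr.uniq_left (P : Pr ρ₁ ρ₂) {g g' k : GV F r} (h : Rel ρ₁ ρ₂ g k) (h' : Rel ρ₁ ρ₂ g' k) :
    ∃ z : F, ∀ v, g v = z • g' v := by
  have := h.mul h'.inv
  rw [mul_inv_cancel] at this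
  obtain ⟨z, hz⟩ := P.scal_left this
  refine ⟨z, fun v => ?_⟩
  have := hz (g' v)
  rwa [mul_app, inv_app'] at this

theorem Pr.uniq_right (P : Pr ρ₁ ρ₂) {g g' k : GV F r} (h : Rel ρ₁ ρ₂ k g) (h' : Rel ρ₁ ρ₂ k g') :
    ∃ z : F, ∀ v, g v = z • g' v := P.symm.uniq_left h.symm h'.symm

end

/-- N-lemma -/
theorem line_of_tv {a v : VV F r} (ha : hh a a = 0) (hv : hh v v = 0) (ha0 : a ≠ 0)
    {c c' z : F} (hc : c ≠ 0) (h : ∀ x, tv a c x = z • tv v c' x) : ∃ b : F, a = b • v := by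
  by_cases hz : z = 1
  · subst hz
    have : ∃ x, hh a x ≠ 0 := by
      by_contra! hx
      exact ha0 (hh_nondeg _ hx)
    obtain ⟨x, hx⟩ := this
    have h1 := h x
    rw [tv_app ha, tv_app hv, one_smul] at h1
    have h2 := add_left_cancel h1
    refine ⟨(c * hh a x)⁻¹ * (c' * hh v x), ?_⟩
    rw [mul_smul, ← h2, smul_smul, inv_mul_cancel₀ (mul_ne_zero hc hx), one_smul]
  · have h1 := h a
    rw [tv_app ha, tv_app hv, ha, mul_zero, zero_smul, add_zero, smul_add, smul_smul] at h1
    have h2 : (1 - z) • a = (z * (c' * hh v a)) • v := by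
      rw [sub_smul, one_smul]
      nth_rw 1 [h1]
      abel
    refine ⟨(1 - z)⁻¹ * (z * (c' * hh v a)), ?_⟩
    rw [mul_smul, ← h2, smul_smul, inv_mul_cancel₀ (sub_ne_zero.2 (Ne.symm hz)), one_smul]

theorem ne_zero_of_smul {g : GV F r} {u v : VV F r} (hu : u ≠ 0) {a : F} (h : g u = a • v) : a ≠ 0 := by
  rintro rfl
  rw [zero_smul] at h
  exact hu (g.map_eq_zero_iff.1 h)

/-- `ρ₁(T_u) = ρ₂(T_u)` -/
def TT {Q : Type*} [Group Q] (ρ₁ ρ₂ : SS F r →* Q) (u : VV F r) : Prop :=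
  (∀ c : F, c + star c = 0 → ∃ c' : F, c' + star c' = 0 ∧ Rel ρ₁ ρ₂ (tv u c) (tv u c')) ∧
  (∀ c' : F, c' + star c' = 0 → ∃ c : F, c + star c = 0 ∧ Rel ρ₁ ρ₂ (tv u c) (tv u c'))

section
variable {Q : Type*} [Group Q] {ρ₁ ρ₂ : SS F r →* Q}
theorem TT.symm {u : VV F r} (h : TT ρ₁ ρ₂ u) : TT ρ₂ ρ₁ u := by
  refine ⟨fun c hc => ?_, fun c hc => ?_⟩
  · obtain ⟨d, hd, h1⟩ := h.2 c hc; exact ⟨d, hd, h1.symm⟩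
  · obtain ⟨d, hd, h1⟩ := h.1 c hc; exact ⟨d, hd, h1.symm⟩

theorem line_transfer (H : HF F p q) (P : Pr ρ₁ ρ₂) {u v : VV F r} (hu : hh u u = 0) (hu0 : u ≠ 0)
    (hv : hh v v = 0) (Tu : TT ρ₁ ρ₂ u) (Tv : TT ρ₁ ρ₂ v) {g g' : GV F r} (h : Rel ρ₁ ρ₂ g g')
    (hl : ∃ a : F, g u = a • v) : ∃ a : F, g' u = a • v := by
  obtain ⟨a, ha⟩ := hl
  obtain ⟨ε, he0, he⟩ := H.exists_eps
  obtain ⟨c, hc, h1⟩ := Tu.2 ε (by rw [he]; ring)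
  have h2 := h.conj h1
  have hg := h.choose.1
  have hg' := h.choose_spec.choose.1
  rw [tv_conj hu c hg, tv_conj hu ε hg', ha, tv_smul hv] at h2
  obtain ⟨c', -, h3⟩ := Tv.1 (a * star a * c) (by
    simp only [star_mul', star_star]; linear_combination (a * star a) * hc)
  obtain ⟨z, hz⟩ := P.uniq_right h2 h3
  exact line_of_tv (by rw [hg', hu]) hv (fun h0 => hu0 (g'.map_eq_zero_iff.1 h0)) he0 hz

end

/-- an isometry preserving all isotropic lines is scalar -/
theorem scal_of_lines (H : HF F p q) {X : GV F r} (hX : ∀ u v, hh (X u) (X v) = hh u v)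
    (h : ∀ u, hh u u = 0 → ∃ a : F, X u = a • u) : IsScal X := by
  obtain ⟨ε, he0, he⟩ := H.exists_eps
  obtain ⟨a, ha⟩ := h ee hee
  obtain ⟨b, hb⟩ := h ff hff
  obtain ⟨m, hm⟩ := h (ε • ee + ff) (by
    simp [hh_add_left, hh_add_right, hh_smul_left, hh_smul_right, hee, hff, hef, hfe, he])
  have hab : a = b := by
    rw [map_add, map_smul, ha, hb] at hm
    have h1 := congrArg Prod.fst hm
    have h2 := congrArg (fun v => v.2.1) hm
    simp [ee, ff] at h1 h2
    have : ε * (a - m) = 0 := by linear_combination h1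
    rcases mul_eq_zero.1 this with h3 | h3
    · exact absurd h3 he0
    · rw [h2]; linear_combination h3
  subst hab
  have hw' : ∀ z, X (ww z) = a • ww z := by
    intro z
    obtain ⟨c, hc⟩ := H.trace_surj (y := - hw z z) (by rw [star_neg, star_hw])
    obtain ⟨m, hm⟩ := h (c, 1, z) (by simp [hh]; linear_combination hc)
    have e : ((c, 1, z) : VV F r) = c • ee + ff + ww z := by
      rw [decomp (c, 1, z), one_smul]
    have hm2 := hm
    rw [e, map_add, map_add, map_smul, ha, hb] at hm
    have h2 := congrArg (fun v => v.2.1) hm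
    have h3 := W_of_fix hX ha z
    simp [ee, ff, ww] at h2
    change a + (X (ww z)).2.1 = m at h2
    rw [h3, add_zero] at h2
    subst h2
    rw [smul_add, smul_add, smul_comm] at hm
    exact add_left_cancel hm
  refine ⟨a, fun v => ?_⟩
  conv_lhs => rw [decomp v]
  conv_rhs => rw [decomp v]
  rw [map_add, map_add, map_smul, map_smul, ha, hb, hw', smul_add, smul_add, smul_comm a, smul_comm a]

/-! ### semilinear isometries -/
structure SemiIso (σ : F ≃+* F) (s : VV F r ≃+ VV F r) : Prop where
  smul : ∀ (a : F) v, s (a • v) = σ a • s v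
  iso : ∀ u v, hh (s u) (s v) = σ (hh u v)

theorem sig_star (H : HF F p q) (σ : F ≃+* F) (x : F) : σ (star x) = star (σ x) := by
  rw [H.hs, H.hs, map_pow]

theorem SemiIso.smul_symm {σ : F ≃+* F} {s : VV F r ≃+ VV F r} (h : SemiIso σ s) (a : F) (v) :
    s.symm (a • v) = σ.symm a • s.symm v := by
  apply s.injective
  rw [h.smul]; simp

theorem SemiIso.symm {σ : F ≃+* F} {s : VV F r ≃+ VV F r} (h : SemiIso σ s) : SemiIso σ.symm s.symm :=
  ⟨h.smul_symm, fun u v => by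
    apply σ.injective
    rw [← h.iso]; simp⟩

theorem SemiIso.trans {σ τ : F ≃+* F} {s t : VV F r ≃+ VV F r} (h : SemiIso σ s) (h' : SemiIso τ t) :
    SemiIso (σ.trans τ) (s.trans t) :=
  ⟨fun a v => by simp [h.smul, h'.smul], fun u v => by simp [h.iso, h'.iso]⟩

def SemiIso.conj {σ : F ≃+* F} {s : VV F r ≃+ VV F r} (h : SemiIso σ s) (g : GV F r) : GV F r where
  toFun v := s (g (s.symm v))
  invFun v := s (g.symm (s.symm v))
  map_add' u v := by simp
  map_smul' a v := by simp [h.smul_symm, h.smul]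
  left_inv v := by simp
  right_inv v := by simp

theorem SemiIso.conj_app {σ : F ≃+* F} {s : VV F r ≃+ VV F r} (h : SemiIso σ s) (g : GV F r) (v) :
    h.conj g v = s (g (s.symm v)) := rfl

theorem SemiIso.conj_mul {σ : F ≃+* F} {s : VV F r ≃+ VV F r} (h : SemiIso σ s) (g k : GV F r) :
    h.conj (g * k) = h.conj g * h.conj k := by
  ext1 v
  rw [mul_app, conj_app, conj_app, conj_app, s.symm_apply_apply, mul_app]

theorem SemiIso.det_conj {σ : F ≃+* F} {s : VV F r ≃+ VV F r} (h : SemiIso σ s) (g : GV F r) :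
    LinearMap.det (h.conj g : VV F r →ₗ[F] VV F r) = σ (LinearMap.det (g : VV F r →ₗ[F] VV F r)) := by
  classical
  let b := Module.finBasis F (VV F r)
  let e : VV F r ≃ₗ[F] (Fin (Module.finrank F (VV F r)) → F) :=
    { toFun := fun v i => σ (b.equivFun (s.symm v) i)
      invFun := fun x => s (b.equivFun.symm (fun i => σ.symm (x i)))
      map_add' := fun u v => by ext i; simp
      map_smul' := fun a v => by ext i; simp [h.smul_symm]
      left_inv := fun v => by simp
      right_inv := fun v => by
        ext i
        beta_reduce
        rw [s.symm_apply_apply, LinearEquiv.apply_symm_apply, RingEquiv.apply_symm_apply] }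
  let b' := Module.Basis.ofEquivFun e
  have hb' : ∀ i, b' i = s (b i) := by
    intro i
    have : b.equivFun.symm (Pi.single i 1) = b i := by simp
    rw [← this]
    simp only [b', Module.Basis.coe_ofEquivFun]
    change s (b.equivFun.symm (fun j => σ.symm ((Pi.single i 1 : _ → F) j))) = _
    congr 2
    ext j
    by_cases hj : j = i
    · subst hj; simp
    · simp [Pi.single_eq_of_ne hj]
  have hr : ∀ v i, b'.repr v i = σ (b.repr (s.symm v) i) := by
    intro v i
    rw [← Module.Basis.equivFun_apply, Module.Basis.equivFun_ofEquivFun]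
    rfl
  rw [← LinearMap.det_toMatrix b' (h.conj g : VV F r →ₗ[F] VV F r), ← LinearMap.det_toMatrix b (g : VV F r →ₗ[F] VV F r), RingEquiv.map_det]
  congr 1
  ext i j
  rw [LinearMap.toMatrix_apply, hr, hb', RingEquiv.mapMatrix_apply, Matrix.map_apply, LinearMap.toMatrix_apply]
  simp [conj_app]

theorem SemiIso.conj_mem {σ : F ≃+* F} {s : VV F r ≃+ VV F r} (h : SemiIso σ s) {g : GV F r}
    (hg : g ∈ SS F r) : h.conj g ∈ SS F r := by
  refine ⟨fun u v => ?_, ?_⟩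
  · rw [conj_app, conj_app, h.iso, hg.1, ← h.iso]; simp
  · ext
    rw [LinearEquiv.coe_det, h.det_conj, ← LinearEquiv.coe_det, hg.2]
    simp

def SemiIso.conjHom {σ : F ≃+* F} {s : VV F r ≃+ VV F r} (h : SemiIso σ s) : SS F r →* SS F r where
  toFun g := ⟨h.conj g.1, h.conj_mem g.2⟩
  map_one' := by
    ext1; apply LinearEquiv.ext; intro v
    change s (s.symm v) = v
    simp
  map_mul' g k := by ext1; exact h.conj_mul _ _

theorem SemiIso.conj_conj {σ : F ≃+* F} {s : VV F r ≃+ VV F r} (h : SemiIso σ s) (g : GV F r) :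
    h.conj (h.symm.conj g) = g := by
  ext1 v
  rw [conj_app, conj_app]; simp

section
variable {Q : Type*} [Group Q] {ρ₁ ρ₂ : SS F r →* Q}

theorem Pr.conj (P : Pr ρ₁ ρ₂) {σ : F ≃+* F} {s : VV F r ≃+ VV F r} (h : SemiIso σ s) :
    Pr (ρ₁.comp h.conjHom) ρ₂ := by
  refine ⟨fun x => ?_, P.s2, fun g => ?_, P.k2⟩
  · obtain ⟨g, rfl⟩ := P.s1 x
    refine ⟨h.symm.conjHom g, ?_⟩
    rw [MonoidHom.comp_apply]
    congr 1
    ext1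
    exact h.conj_conj g.1
  · rw [MonoidHom.comp_apply, P.k1]
    constructor
    · rintro ⟨z, hz⟩
      refine ⟨σ.symm z, fun v => ?_⟩
      have h1 := hz (s v)
      change s (g.1 (s.symm (s v))) = _ at h1
      rw [s.symm_apply_apply] at h1
      apply s.injective
      rw [h1, h.smul]; simp
    · rintro ⟨z, hz⟩
      refine ⟨σ z, fun v => ?_⟩
      change s (g.1 (s.symm v)) = _
      rw [hz, h.smul]; simp

def Concl (ρ₁ ρ₂ : SS F r →* Q) : Prop :=
  ∃ (σ : F ≃+* F) (s : VV F r ≃+ VV F r), SemiIso σ s ∧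
    ∀ g g' : SS F r, (∀ v, g'.1 (s v) = s (g.1 v)) → ρ₁ g' = ρ₂ g

theorem Concl.of_conj {σ : F ≃+* F} {s : VV F r ≃+ VV F r} (h : SemiIso σ s)
    (hc : Concl (ρ₁.comp h.conjHom) ρ₂) : Concl ρ₁ ρ₂ := by
  obtain ⟨τ, t, ht, hc⟩ := hc
  refine ⟨τ.trans σ, t.trans s, ht.trans h, fun g g' hg => ?_⟩
  have := hc g (h.symm.conjHom g') (fun v => by
    change s.symm (g'.1 (s (t v))) = t (g.1 v)
    rw [AddEquiv.symm_apply_eq]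
    exact hg v)
  rw [← this, MonoidHom.comp_apply]
  congr 1
  ext1
  exact (h.conj_conj g'.1).symm

theorem rel_conj {σ : F ≃+* F} {s : VV F r ≃+ VV F r} (h : SemiIso σ s) {g g' : GV F r}
    (hr : Rel ρ₁ ρ₂ (h.conj g) g') : Rel (ρ₁.comp h.conjHom) ρ₂ g g' := by
  obtain ⟨a, b, c⟩ := hr
  have hm : g ∈ SS F r := by
    have := h.symm.conj_mem a
    have e : h.symm.conj (h.conj g) = g := by
      ext1 v; rw [SemiIso.conj_app, SemiIso.conj_app]; simp
    rwa [e] at this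
  exact ⟨hm, b, c⟩

/-- inner conjugation -/
theorem semi_inner {g : GV F r} (hg : ∀ u v, hh (g u) (g v) = hh u v) :
    SemiIso (RingEquiv.refl F) g.toAddEquiv :=
  ⟨fun a v => by simp, fun u v => hg u v⟩

theorem conj_inner {g : GV F r} (hg : ∀ u v, hh (g u) (g v) = hh u v) (k : GV F r) :
    (semi_inner hg).conj k = g * k * g⁻¹ := rfl
end

end UV
set_option linter.all false

namespace UV
variable {F : Type*} [Field F] [Fintype F] [StarRing F] {p q r : ℕ}
variable {Q : Type*} [Group Q] {ρ₁ ρ₂ : SS F r →* Q}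

theorem cent_R (H : HF F p q) {x : GV F r} (hx : ∀ u v, hh (x u) (x v) = hh u v) (he : x ee = ee)
    (hc : ∀ w c, rr w c ∈ SS F r → x * rr w c = rr w c * x) :
    ∃ c : F, c + star c = 0 ∧ x = rr 0 c := by
  have key : ∀ w : Fin r → F, ∃ c, rr w c ∈ SS F r := fun w => by
    obtain ⟨c, hc⟩ := H.trace_surj (y := - hw w w) (by rw [star_neg, star_hw])
    exact ⟨c, rr_mem H (by linear_combination hc)⟩
  have h1 : ∀ z, (x (ww z)).2.2 = z := by
    intro z
    obtain ⟨c, hcz⟩ := key z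
    have := congrArg (fun g : GV F r => (g ff).2.2) (hc z c hcz)
    simp only [mul_app, rr_ff] at this
    have hy : (x ff).2.1 = 1 := by
      have := hx ee ff
      rwa [he, hh_ee, hef] at this
    have e : ((c, 1, z) : VV F r) = c • ee + ff + ww z := by
      rw [decomp (c, 1, z), one_smul]
    rw [e, map_add, map_add, map_smul, he, rr_app, hy] at this
    simp [ee] at this
    exact this
  have h2 := mem_R hx he h1
  generalize (x ff).1 = a at h2
  generalize (x ff).2.2 = w0 at h2
  have h3 : ∀ w, hw w0 w = hw w w0 := by
    intro w
    obtain ⟨c, hcz⟩ := key w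
    have := hc w c hcz
    rw [h2, rr_mul, rr_mul] at this
    have := (rr_inj this).2
    linear_combination -this
  have h4 : w0 = 0 := by
    apply hw_nondeg
    intro w
    obtain ⟨y, hy⟩ := H.exists_star_ne
    have e1 := h3 w
    have e2 := h3 (y • w)
    rw [hw_smul_left, hw_smul_right, ← e1] at e2
    have : (star y - y) * hw w0 w = 0 := by linear_combination -e2
    rcases mul_eq_zero.1 this with h | h
    · exact absurd (sub_eq_zero.1 h) hy
    · exact h
  subst h4
  refine ⟨a, ?_, h2⟩
  have := hx ff ff
  rw [h2, rr_ff, hff] at this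
  simp [hh, hw_zero_left] at this
  linear_combination this

theorem S1core (H : HF F p q) (P : Pr ρ₁ ρ₂) (U : Subgroup (SS F r))
    (hR : ∀ w c (h : rr w c ∈ SS F r), (⟨rr w c, h⟩ : SS F r) ∈ U)
    (hfix : ∀ g ∈ U, g.1 ee = ee)
    (h12 : ∀ x ∈ U, ∃ x' ∈ U, ρ₁ x = ρ₂ x') (h21 : ∀ x' ∈ U, ∃ x ∈ U, ρ₁ x = ρ₂ x')
    (c : F) (hc : c + star c = 0) : ∃ c' : F, c' + star c' = 0 ∧ Rel ρ₁ ρ₂ (tv ee c) (tv ee c') := by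
  have hm : tv (ee : VV F r) c ∈ SS F r := tv_mem H hee hc
  have hU : (⟨tv ee c, hm⟩ : SS F r) ∈ U := by
    have h : rr 0 c ∈ SS F r := by rw [← tv_ee]; exact hm
    have := hR 0 c h
    convert this using 2
    exact tv_ee c
  obtain ⟨x', hx', e⟩ := h12 _ hU
  have hcomm : ∀ y' ∈ U, x'.1 * y'.1 = y'.1 * x'.1 := by
    intro y' hy'
    obtain ⟨y, hy, e2⟩ := h21 y' hy'
    have e3 : (⟨tv ee c, hm⟩ : SS F r) * y = y * ⟨tv ee c, hm⟩ := by
      ext1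
      change tv ee c * y.1 = y.1 * tv ee c
      have := tv_conj hee c y.2.1
      rw [hfix y hy] at this
      rw [← this, inv_mul_cancel_right, this]
    have e4 : ρ₂ (x' * y' * x'⁻¹ * y'⁻¹) = 1 := by
      simp only [map_mul, map_inv, ← e, ← e2]
      rw [← map_mul, e3, map_mul]
      group
    rw [P.k2] at e4
    obtain ⟨z, hz⟩ := e4
    have hz1 : z = 1 := by
      have h1 := hfix _ (U.mul_mem (U.mul_mem (U.mul_mem hx' hy') (U.inv_mem hx')) (U.inv_mem hy'))
      rw [hz] at h1
      have := congrArg Prod.fst h1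
      simpa [ee] using this
    have : x'.1 * y'.1 * x'.1⁻¹ * y'.1⁻¹ = 1 := by
      ext1 v
      have := hz v
      rw [hz1, one_smul] at this
      exact this
    rw [mul_inv_eq_one, mul_inv_eq_iff_eq_mul] at this
    exact this
  obtain ⟨c', hc', e5⟩ := cent_R H x'.2.1 (hfix x' hx') (fun w c h => hcomm _ (hR w c h))
  refine ⟨c', hc', hm, tv_mem H hee hc', ?_⟩
  rw [e]
  congr 1
  ext1
  rw [e5, ← tv_ee]

theorem exists_U (H : HF F p q) : ∃ U : Sylow p (SS F r), 
    (∀ w c (h : rr w c ∈ SS F r), (⟨rr w c, h⟩ : SS F r) ∈ (U : Subgroup (SS F r))) ∧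
    (∀ g ∈ (U : Subgroup (SS F r)), g.1 ee = ee) := by
  have := Fact.mk H.hp
  let R : Subgroup (SS F r) :=
    { carrier := {g | ∃ w c, g.1 = rr w c}
      mul_mem' := by
        rintro a b ⟨w, c, h⟩ ⟨w', c', h'⟩
        exact ⟨_, _, by rw [Subgroup.coe_mul, h, h', rr_mul]⟩
      one_mem' := ⟨0, 0, rr_zero.symm⟩
      inv_mem' := by
        rintro a ⟨w, c, h⟩
        exact ⟨_, _, by rw [Subgroup.coe_inv, h, rr_inv]⟩ }
  have hRp : IsPGroup p R := by
    rintro ⟨g, w, c, h⟩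
    refine ⟨2, ?_⟩
    ext1; ext1
    change g.1 ^ (p ^ 2) = 1
    rw [h, rr_pow_p H]
  obtain ⟨U, hU⟩ := hRp.exists_le_sylow
  have hR : ∀ w c (h : rr w c ∈ SS F r), (⟨rr w c, h⟩ : SS F r) ∈ (U : Subgroup (SS F r)) :=
    fun w c h => hU ⟨w, c, rfl⟩
  refine ⟨U, hR, ?_⟩
  have hp : p ∣ Nat.card (VV F r) := by
    have := H.charP
    rw [Nat.card_prod, Nat.card_eq_fintype_card, H.hc]
    obtain ⟨m, hm, rfl⟩ := H.ex
    exact Dvd.dvd.mul_right (dvd_pow (dvd_pow_self p hm.ne') two_ne_zero) _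
  obtain ⟨v, hv, hv0⟩ := U.isPGroup'.exists_fixed_point_of_prime_dvd_card_of_fixed_point (VV F r) hp (a := 0)
    (fun g => smul_zero _)
  have hv' : ∀ g ∈ (U : Subgroup (SS F r)), g.1 v = v := fun g hg => hv ⟨g, hg⟩
  have hy : v.2.1 = 0 := by
    obtain ⟨ε, h0, he⟩ := H.exists_eps
    have := hv' _ (hR 0 ε (rr_mem H (by rw [he, hw_zero_left]; ring)))
    have := congrArg Prod.fst this
    simp [rr_app, hw_zero_left, h0] at this
    exact this
  have hz : v.2.2 = 0 := by
    apply hw_nondeg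
    intro w
    obtain ⟨c, hc⟩ := H.trace_surj (y := - hw w w) (by rw [star_neg, star_hw])
    have := hv' _ (hR w c (rr_mem H (by linear_combination hc)))
    have := congrArg Prod.fst this
    simp [rr_app, hy] at this
    rw [← star_hw, this, star_zero]
  have hve : v = v.1 • ee := by
    ext <;> simp [ee, hy, hz]
  have hx : v.1 ≠ 0 := fun h => hv0 (by rw [hve, h, zero_smul])
  intro g hg
  have := hv' g hg
  rw [hve, map_smul] at this
  exact smul_right_injective _ hx this

instance finGV : Finite (GV F r) := DFunLike.finite _

theorem S1 [Finite Q] (H : HF F p q) (P : Pr ρ₁ ρ₂)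
    (K : ∀ ρ₁ : SS F r →* Q, Pr ρ₁ ρ₂ → TT ρ₁ ρ₂ ee → Concl ρ₁ ρ₂) : Concl ρ₁ ρ₂ := by
  have := Fact.mk H.hp
  obtain ⟨U, hR, hfix⟩ := exists_U (r := r) H
  obtain ⟨t, ht⟩ := MulAction.exists_smul_eq Q (U.mapSurjective P.s1) (U.mapSurjective P.s2)
  obtain ⟨g, rfl⟩ := P.s1 t
  have hs := semi_inner g.2.1
  apply Concl.of_conj hs
  have P' := P.conj hs
  have hap : ∀ x, (ρ₁.comp hs.conjHom) x = ρ₁ g * ρ₁ x * (ρ₁ g)⁻¹ := by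
    intro x
    rw [← map_inv, ← map_mul, ← map_mul]; rfl
  have h12 : ∀ x ∈ (U : Subgroup (SS F r)), ∃ x' ∈ (U : Subgroup (SS F r)), (ρ₁.comp hs.conjHom) x = ρ₂ x' := by
    intro x hx
    have : ρ₁ g * ρ₁ x * (ρ₁ g)⁻¹ ∈ ((U.mapSurjective P.s2 : Sylow p Q) : Subgroup Q) := by
      rw [← ht]
      exact Subgroup.smul_mem_pointwise_smul (ρ₁ x) (MulAut.conj (ρ₁ g)) _ ⟨x, hx, rfl⟩
    obtain ⟨x', hx', e⟩ := this
    exact ⟨x', hx', by rw [hap, ← e]⟩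
  have h21 : ∀ x' ∈ (U : Subgroup (SS F r)), ∃ x ∈ (U : Subgroup (SS F r)), (ρ₁.comp hs.conjHom) x = ρ₂ x' := by
    intro x' hx'
    have : ρ₂ x' ∈ ((U.mapSurjective P.s2 : Sylow p Q) : Subgroup Q) := ⟨x', hx', rfl⟩
    rw [← ht] at this
    obtain ⟨_, ⟨x, hx, rfl⟩, e⟩ := this
    exact ⟨x, hx, by rw [hap, ← e]; rfl⟩
  apply K _ P'
  refine ⟨S1core H P' _ hR hfix h12 h21, fun c hc => ?_⟩
  obtain ⟨c', hc', h⟩ := S1core H P'.symm _ hR hfix (fun x hx => by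
    obtain ⟨y, hy, e⟩ := h21 x hx; exact ⟨y, hy, e.symm⟩) (fun x hx => by
    obtain ⟨y, hy, e⟩ := h12 x hx; exact ⟨y, hy, e.symm⟩) c hc
  exact ⟨c', hc', h.symm⟩

theorem exists_j (H : HF F p q) : ∃ j ∈ SS F r, ∃ ε : F, ε ≠ 0 ∧ ε + star ε = 0 ∧ j ee = ε • ff := by
  obtain ⟨ε, h0, he⟩ := H.exists_eps
  have h1 : ε + star ε = 0 := by rw [he]; ring
  have h2 : -ε⁻¹ + star (-ε⁻¹) = 0 := by rw [star_neg, star_inv₀, he, inv_neg]; ring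
  refine ⟨tv ff ε * tv ee (-ε⁻¹) * tv ff ε, mul_mem (mul_mem (tv_mem H hff h1) (tv_mem H hee h2)) 
    (tv_mem H hff h1), ε, h0, h1, ?_⟩
  rw [mul_app, mul_app, tv_ff_app, tv_ee, rr_app, tv_ff_app]
  ext <;> simp [ee, ff, hw_zero_left, h0]

theorem S2 (H : HF F p q) (P : Pr ρ₁ ρ₂) (Te : TT ρ₁ ρ₂ ee)
    (K : ∀ ρ₁ : SS F r →* Q, Pr ρ₁ ρ₂ → TT ρ₁ ρ₂ ee → TT ρ₁ ρ₂ ff → Concl ρ₁ ρ₂) : Concl ρ₁ ρ₂ := by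
  obtain ⟨j, hj, ε, h0, hε, hje⟩ := exists_j (r := r) H
  obtain ⟨g, hg⟩ := P.exists_left hj
  have hgi := hg.choose.1
  have hs0 : star ε ≠ 0 := by simpa using h0
  have hiso : hh (g ee) (g ee) = 0 := by rw [hgi, hee]
  have hrel : ∀ c c', Rel ρ₁ ρ₂ (tv ee c) (tv ee c') → Rel ρ₁ ρ₂ (tv (g ee) c) (tv ff (ε * star ε * c')) := by
    intro c c' h
    have := hg.conj h
    rwa [tv_conj hee c hgi, tv_conj hee c' hj.1, hje, tv_smul hff] at this
  have hb : (g ee).2.1 ≠ 0 := by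
    intro hb
    obtain ⟨c, hc, h1⟩ := Te.2 ε hε
    have h2 := hrel c ε h1
    have h3 := h2.conj h1
    have e1 : tv (g ee) c * tv ee c * (tv (g ee) c)⁻¹ = tv ee c := by
      have hm := tv_iso hiso hc
      rw [tv_conj hee c hm, tv_app hiso, hh_ee', hb]
      simp
    have hx : ε * star ε * ε + star (ε * star ε * ε) = 0 := by
      simp only [star_mul', star_star]; linear_combination (ε * star ε) * hε
    rw [e1, tv_conj hee ε (tv_iso hff hx)] at h3
    obtain ⟨z, hz⟩ := P.uniq_right h3 h1
    obtain ⟨b, hb⟩ := line_of_tv (by rw [tv_iso hff hx, hee]) hee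
      (fun h => ee_ne ((tv ff (ε * star ε * ε)).map_eq_zero_iff.1 h)) h0 hz
    rw [tv_ff_app] at hb
    have := congrArg (fun v => v.2.1) hb
    simp [ee, h0] at this
  set b := (g ee).2.1 with hbdef
  have hsb : star b ≠ 0 := by simpa using hb
  have hk : rr (b⁻¹ • (g ee).2.2) (b⁻¹ * (g ee).1) ∈ SS F r := by
    apply rr_mem H
    rw [hh, ← hbdef] at hiso
    rw [hw_smul_left, hw_smul_right, star_mul', star_inv₀]
    field_simp
    linear_combination hiso
  have hkf : rr (b⁻¹ • (g ee).2.2) (b⁻¹ * (g ee).1) ff = b⁻¹ • g ee := by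
    rw [rr_ff]
    ext
    · simp
    · simp [← hbdef, hb]
    · simp
  have hke := rr_ee (b⁻¹ • (g ee).2.2) (b⁻¹ * (g ee).1)
  generalize rr (b⁻¹ • (g ee).2.2) (b⁻¹ * (g ee).1) = k at hk hkf hke
  have hs := semi_inner hk.1
  apply Concl.of_conj hs
  apply K _ (P.conj hs)
  · refine ⟨fun c hc => ?_, fun c' hc' => ?_⟩
    · obtain ⟨c', hc', h⟩ := Te.1 c hc
      refine ⟨c', hc', rel_conj hs ?_⟩
      rwa [conj_inner hk.1, tv_conj hee c hk.1, hke]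
    · obtain ⟨c, hc, h⟩ := Te.2 c' hc'
      refine ⟨c, hc, rel_conj hs ?_⟩
      rwa [conj_inner hk.1, tv_conj hee c hk.1, hke]
  · refine ⟨fun c hc => ?_, fun c' hc' => ?_⟩
    · have e : b⁻¹ * star b⁻¹ * c + star (b⁻¹ * star b⁻¹ * c) = 0 := by
        simp only [star_mul', star_star]; linear_combination (b⁻¹ * star b⁻¹) * hc
      obtain ⟨c', hc', h⟩ := Te.1 _ e
      refine ⟨ε * star ε * c', ?_, rel_conj hs ?_⟩
      · simp only [star_mul', star_star]; linear_combination (ε * star ε) * hc'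
      · rw [conj_inner hk.1, tv_conj hff c hk.1, hkf, tv_smul hiso]
        exact hrel _ _ h
    · obtain ⟨c, hc, h⟩ := Te.2 ((ε * star ε)⁻¹ * c') (by
        simp only [star_mul', star_star, star_inv₀]; linear_combination (ε * star ε)⁻¹ * hc')
      refine ⟨b * star b * c, ?_, rel_conj hs ?_⟩
      · simp only [star_mul', star_star]; linear_combination (b * star b) * hc
      · rw [conj_inner hk.1, tv_conj hff _ hk.1, hkf, tv_smul hiso]
        have := hrel _ _ h
        rw [mul_inv_cancel_left₀ (mul_ne_zero h0 hs0)] at this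
        convert this using 2
        rw [star_inv₀]
        field_simp

end UV
set_option linter.all false

namespace UV
variable {F : Type*} [Field F] [Fintype F] [StarRing F] {p q r : ℕ}
variable {Q : Type*} [Group Q] {ρ₁ ρ₂ : SS F r →* Q}

def dd (l m : Fˣ) (g : (Fin r → F) ≃ₗ[F] (Fin r → F)) : GV F r :=
  LinearEquiv.prodCongr (LinearEquiv.smulOfUnit l) (LinearEquiv.prodCongr (LinearEquiv.smulOfUnit m) g)

theorem dd_app (l m : Fˣ) (g : (Fin r → F) ≃ₗ[F] (Fin r → F)) (v : VV F r) :
    dd l m g v = ((l : F) * v.1, (m : F) * v.2.1, g v.2.2) := rfl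

theorem dd_mem {l m : Fˣ} {g : (Fin r → F) ≃ₗ[F] (Fin r → F)} (hg : ∀ u v, hw (g u) (g v) = hw u v)
    (hlm : star (l : F) * m = 1) (hd : (l : F) * m * LinearMap.det (g : (Fin r → F) →ₗ[F] (Fin r → F)) = 1) :
    dd l m g ∈ SS F r := by
  have hlm' : star (m : F) * l = 1 := by
    have := congrArg star hlm
    simpa [mul_comm] using this
  refine ⟨fun u v => ?_, ?_⟩
  · simp only [dd_app, hh, hg, star_mul']
    linear_combination (star u.1 * v.2.1) * hlm + (star u.2.1 * v.1) * hlm'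
  · ext
    rw [LinearEquiv.coe_det]
    have : ((dd l m g : GV F r) : VV F r →ₗ[F] VV F r) = LinearMap.prodMap
       ((LinearEquiv.smulOfUnit l : F ≃ₗ[F] F) : F →ₗ[F] F) (LinearMap.prodMap
         ((LinearEquiv.smulOfUnit m : F ≃ₗ[F] F) : F →ₗ[F] F) (g : (Fin r → F) →ₗ[F] (Fin r → F))) := rfl
    rw [this, LinearMap.det_prodMap, LinearMap.det_prodMap, LinearMap.det_ring, LinearMap.det_ring, ← mul_assoc]
    have e1 : ((LinearEquiv.smulOfUnit l : F ≃ₗ[F] F) : F →ₗ[F] F) 1 = l := mul_one _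
    have e2 : ((LinearEquiv.smulOfUnit m : F ≃ₗ[F] F) : F →ₗ[F] F) 1 = m := mul_one _
    rw [e1, e2, hd]; rfl

theorem dd_exists (H : HF F p q) {g : (Fin r → F) ≃ₗ[F] (Fin r → F)} (hg : ∀ u v, hw (g u) (g v) = hw u v)
    (hd : LinearMap.det (g : (Fin r → F) →ₗ[F] (Fin r → F)) *
      star (LinearMap.det (g : (Fin r → F) →ₗ[F] (Fin r → F))) = 1) :
    ∃ l m : Fˣ, dd l m g ∈ SS F r := by
  obtain ⟨l, h0, hl⟩ := H.hilbert90 hd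
  have hs : star l ≠ 0 := by simpa using h0
  refine ⟨Units.mk0 l h0, Units.mk0 (star l)⁻¹ (inv_ne_zero hs), dd_mem hg ?_ ?_⟩
  · simp [hs]
  · rw [Units.val_mk0, Units.val_mk0]
    field_simp
    rw [hl]; ring

def dg (d : Fin r → Fˣ) : (Fin r → F) ≃ₗ[F] (Fin r → F) :=
  LinearEquiv.piCongrRight fun j => LinearEquiv.smulOfUnit (d j)

theorem dg_app (d : Fin r → Fˣ) (z : Fin r → F) (j : Fin r) : dg d z j = (d j : F) * z j := rfl

theorem dg_iso {d : Fin r → Fˣ} (h : ∀ i, (d i : F) * star (d i : F) = 1) (u v) : hw (dg d u) (dg d v) = hw u v := by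
  simp only [hw, dg_app]
  refine Finset.sum_congr rfl fun i _ => ?_
  rw [star_mul']
  linear_combination (star (u i) * v i) * h i

theorem dg_det (d : Fin r → Fˣ) : LinearMap.det (dg d : (Fin r → F) →ₗ[F] (Fin r → F)) = ∏ i, (d i : F) := by
  have : (dg d : (Fin r → F) →ₗ[F] (Fin r → F)) = Matrix.toLin' (Matrix.diagonal fun i => (d i : F)) := by
    ext i j
    simp [dg_app, Matrix.mulVec_diagonal]
  rw [this, LinearMap.det_toLin', Matrix.det_diagonal]

def sw (i j : Fin r) : (Fin r → F) ≃ₗ[F] (Fin r → F) := LinearEquiv.funCongrLeft F F (Equiv.swap i j)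

theorem sw_app (i j : Fin r) (z : Fin r → F) (k) : sw i j z k = z (Equiv.swap i j k) := rfl

theorem sw_iso (i j : Fin r) (u v : Fin r → F) : hw (sw i j u) (sw i j v) = hw u v := by
  simp only [hw, sw_app]
  exact Equiv.sum_comp (Equiv.swap i j) (fun k => star (u k) * v k)

theorem sw_single (i j : Fin r) (a : F) : sw i j (Pi.single i a) = Pi.single j a := by
  ext k
  rw [sw_app, Pi.single_apply, Pi.single_apply]
  congr 1
  rw [Equiv.swap_apply_eq_iff, Equiv.swap_apply_left]

theorem sw_det (i j : Fin r) : LinearMap.det ((sw i j : (Fin r → F) ≃ₗ[F] (Fin r → F)) : (Fin r → F) →ₗ[F] (Fin r → F)) *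
      star (LinearMap.det ((sw i j : (Fin r → F) ≃ₗ[F] (Fin r → F)) : (Fin r → F) →ₗ[F] (Fin r → F))) = 1 := by
  have : LinearMap.det ((sw i j : (Fin r → F) ≃ₗ[F] (Fin r → F)) : (Fin r → F) →ₗ[F] (Fin r → F)) *
      (LinearMap.det ((sw i j : (Fin r → F) ≃ₗ[F] (Fin r → F)) : (Fin r → F) →ₗ[F] (Fin r → F))) = 1 := by
    rw [← map_mul]
    have : (((sw i j : (Fin r → F) ≃ₗ[F] (Fin r → F)) : (Fin r → F) →ₗ[F] (Fin r → F)) * ((sw i j : (Fin r → F) ≃ₗ[F] (Fin r → F)) : (Fin r → F) →ₗ[F] (Fin r → F))) = 1 := by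
      apply LinearMap.ext
      intro z
      ext k
      change sw i j (sw i j z) k = z k
      rw [sw_app, sw_app, Equiv.swap_apply_self]
    rw [this, map_one]
  rcases mul_self_eq_one_iff.1 this with h | h <;> rw [h] <;> simp

/-- stabilizer of the line `ee` -/
def Le (F : Type*) [Field F] [Fintype F] [StarRing F] (r : ℕ) : Subgroup (SS F r) where
  carrier := {g | ∃ a : F, g.1 ee = a • ee}
  mul_mem' := by
    rintro g h ⟨a, ha⟩ ⟨b, hb⟩
    refine ⟨b * a, ?_⟩
    change g.1 (h.1 ee) = _
    rw [hb, map_smul, ha, smul_smul]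
  one_mem' := ⟨1, (one_smul _ _).symm⟩
  inv_mem' := by
    rintro g ⟨a, ha⟩
    have h0 : a ≠ 0 := by
      rintro rfl
      rw [zero_smul] at ha
      exact ee_ne (g.1.map_eq_zero_iff.1 ha)
    refine ⟨a⁻¹, ?_⟩
    change g.1.symm ee = _
    rw [LinearEquiv.symm_apply_eq, map_smul, ha, smul_smul, inv_mul_cancel₀ h0, one_smul]

theorem Le.eq (g : Le F r) : g.1.1 ee = (g.1.1 ee).1 • ee := by
  obtain ⟨a, ha⟩ := g.2
  rw [ha]; simp [ee]

theorem Le.ne (g : Le F r) : (g.1.1 ee).1 ≠ 0 := ne_zero_of_smul ee_ne (Le.eq g)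

theorem Le.mul_ee (g h : Le F r) : ((g * h).1.1 ee).1 = (g.1.1 ee).1 * (h.1.1 ee).1 := by
  change (g.1.1 (h.1.1 ee)).1 = _
  rw [Le.eq h, map_smul]; simp [ee, mul_comm]

theorem Le.ww (g : Le F r) (z) : g.1.1 (ww z) = (g.1.1 (ww z)).1 • ee + UV.ww (g.1.1 (UV.ww z)).2.2 := by
  conv_lhs => rw [decomp (g.1.1 (UV.ww z)), W_of_fix g.1.2.1 (Le.eq g)]
  simp

instance actLe : MulAction (Le F r) (Fin r → F) where
  smul g w := ((g.1.1 ee).1)⁻¹ • (g.1.1 (ww w)).2.2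
  one_smul w := by
    change ((1 : F))⁻¹ • w = w
    simp
  mul_smul g h w := by
    change (((g * h).1.1 ee).1)⁻¹ • (g.1.1 (h.1.1 (ww w))).2.2 =
      ((g.1.1 ee).1)⁻¹ • (g.1.1 (ww (((h.1.1 ee).1)⁻¹ • (h.1.1 (ww w)).2.2))).2.2
    rw [Le.mul_ee]
    have e : ww (((h.1.1 ee).1)⁻¹ • (h.1.1 (ww w)).2.2) = ((h.1.1 ee).1)⁻¹ • ww (F := F) (r := r) (h.1.1 (ww w)).2.2 := by
      simp [ww]
    rw [e, map_smul, Le.ww h w, map_add, map_smul, Le.eq g, mul_inv, mul_smul]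
    simp [ee, ww]

theorem act_def (g : Le F r) (w : Fin r → F) : g • w = ((g.1.1 ee).1)⁻¹ • (g.1.1 (ww w)).2.2 := rfl

theorem act_add (g : Le F r) (w w' : Fin r → F) : g • (w + w') = g • w + g • w' := by
  have : ww (w + w') = ww w + (ww w' : VV F r) := by simp [ww]
  simp [act_def, this]

theorem act_smul (g : Le F r) (a : F) (w : Fin r → F) : g • (a • w) = a • (g • w) := by
  have : ww (a • w) = a • (ww w : VV F r) := by simp [ww]
  simp only [act_def, this, map_smul]
  rw [smul_comm]; rfl

theorem norm_R {g : GV F r} (hg : g ∈ SS F r) {a : F} (ha : g ee = a • ee) {w c} (hr : rr w c ∈ SS F r) :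
    ∃ w' c', g * rr w c * g⁻¹ = rr w' c' := by
  have hm : g * rr w c * g⁻¹ ∈ SS F r := mul_mem (mul_mem hg hr) (inv_mem hg)
  have h0 := ne_zero_of_smul ee_ne ha
  have he' : g⁻¹ ee = a⁻¹ • ee := by
    change g.symm ee = _
    rw [LinearEquiv.symm_apply_eq, map_smul, ha, smul_smul, inv_mul_cancel₀ h0, one_smul]
  refine ⟨_, _, mem_R hm.1 ?_ ?_⟩
  · rw [mul_app, mul_app, he', map_smul, rr_ee, map_smul, ha, smul_smul, inv_mul_cancel₀ h0, one_smul]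
  · intro z
    have h1 := W_of_fix (inv_mem hg).1 he' z
    have h2 : rr w c (g⁻¹ (ww z)) = g⁻¹ (ww z) + (- hw w (g⁻¹ (ww z)).2.2) • ee := by
      rw [rr_app, h1]
      refine Prod.ext ?_ (Prod.ext ?_ ?_)
      · simp [ee, sub_eq_add_neg]
      · simp only [Prod.snd_add, Prod.fst_add, h1]; simp [ee]
      · simp [ee]
    rw [mul_app, mul_app, h2, map_add, inv_app, map_smul, ha]
    simp [ee, ww]

theorem R_left (H : HF F p q) (P : Pr ρ₁ ρ₂) (Te : TT ρ₁ ρ₂ ee) {w : Fin r → F} {c : F}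
    (hr : rr w c ∈ SS F r) : ∃ w' c', Rel ρ₁ ρ₂ (rr w' c') (rr w c) := by
  have := Fact.mk H.hp
  have tl : ∀ {g g'}, Rel ρ₁ ρ₂ g g' → (∃ a : F, g' ee = a • ee) → ∃ a : F, g ee = a • ee :=
    fun h h' => line_transfer H P.symm hee ee_ne hee Te.symm Te.symm h.symm h'
  have tr : ∀ {g g'}, Rel ρ₁ ρ₂ g g' → (∃ a : F, g ee = a • ee) → ∃ a : F, g' ee = a • ee :=
    fun h h' => line_transfer H P hee ee_ne hee Te Te h h'
  let N : Subgroup (Le F r) :=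
    { carrier := {g | ∃ w c, Rel ρ₁ ρ₂ g.1.1 (rr w c)}
      mul_mem' := by
        rintro a b ⟨w, c, h⟩ ⟨w', c', h'⟩
        exact ⟨_, _, by have := h.mul h'; rw [rr_mul] at this; exact this⟩
      one_mem' := ⟨0, 0, by rw [rr_zero]; exact Rel.one⟩
      inv_mem' := by
        rintro a ⟨w, c, h⟩
        exact ⟨_, _, by have := h.inv; rw [rr_inv] at this; exact this⟩ }
  have hN : ∀ n ∈ N, ∀ h : Le F r, h * n * h⁻¹ ∈ N := by
    rintro n ⟨w, c, hn⟩ h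
    obtain ⟨h', e⟩ := P.exists_right h.1.2
    obtain ⟨a, ha⟩ := tr e h.2
    obtain ⟨w', c', e'⟩ := norm_R e.choose_spec.choose ha hn.choose_spec.choose
    exact ⟨w', c', by rw [← e']; exact e.conj hn⟩
  have hpow : ∀ n ∈ N, ∀ z : Fin r → F, (n ^ (p ^ 2)) • z = z := by
    rintro n ⟨w, c, hn⟩ z
    have : ∀ k : ℕ, Rel ρ₁ ρ₂ (n.1.1 ^ k) (rr w c ^ k) := by
      intro k
      induction k with
      | zero => exact Rel.one
      | succ k ih => rw [pow_succ, pow_succ]; exact ih.mul hn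
    have h2 := this (p ^ 2)
    rw [rr_pow_p H] at h2
    obtain ⟨t, ht⟩ := P.scal_left h2
    have e : ∀ v, (n ^ (p ^ 2)).1.1 v = t • v := ht
    have h0 := Le.ne (n ^ (p ^ 2))
    have e1 : (t • (ee : VV F r)).1 = t := by simp [ee]
    rw [e, e1] at h0
    rw [act_def, e, e, e1]
    simp [ww, smul_smul, h0]
  -- fixed vectors
  have hall : ∀ z : Fin r → F, ∀ n ∈ N, n • z = z := by
    rcases Nat.eq_zero_or_pos r with rfl | hrpos
    · intro z n _; exact Subsingleton.elim _ _
    let M : Submodule F (Fin r → F) :=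
      { carrier := {z | ∀ n ∈ N, n • z = z}
        add_mem' := fun {a b} ha hb n hn => by rw [act_add, ha n hn, hb n hn]
        zero_mem' := fun n hn => by have := act_smul n (0 : F) 0; simpa using this
        smul_mem' := fun c z hz n hn => by rw [act_smul, hz n hn] }
    have hM : ∀ z ∈ M, ∀ h : Le F r, h • z ∈ M := by
      intro z hz h n hn
      have := hN n hn h⁻¹
      have h2 := hz _ this
      rw [inv_inv, mul_smul, mul_smul, inv_smul_eq_iff] at h2
      exact h2
    have hMd : ∀ z ∈ M, ∀ l m g, dd l m g ∈ SS F r → g z ∈ M := by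
      intro z hz l m g hd
      have h1 : dd l m g ee = (l : F) • ee := by
        rw [dd_app]; ext <;> simp [ee]
      have := hM z hz ⟨⟨dd l m g, hd⟩, l, h1⟩
      rw [act_def] at this
      change ((dd l m g ee).1)⁻¹ • (dd l m g (ww z)).2.2 ∈ M at this
      rw [dd_app, dd_app] at this
      have h2 := M.smul_mem (l : F) this
      simpa [ee, ww, smul_smul] using h2
    -- a nonzero element
    have hex : ∃ z ∈ M, z ≠ 0 := by
      let φ : N →* Equiv.Perm (Fin r → F) := (MulAction.toPermHom (Le F r) (Fin r → F)).comp N.subtype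
      have hφ : IsPGroup p φ.range := by
        rintro ⟨_, n, rfl⟩
        refine ⟨2, ?_⟩
        ext1
        rw [Subgroup.coe_pow, ← map_pow]
        apply Equiv.ext
        intro z
        exact hpow n.1 n.2 z
      have hp : p ∣ Nat.card (Fin r → F) := by
        rw [Nat.card_fun, Nat.card_eq_fintype_card, Nat.card_eq_fintype_card, Fintype.card_fin, H.hc]
        obtain ⟨m, hm, rfl⟩ := H.ex
        exact dvd_pow (dvd_pow (dvd_pow_self p hm.ne') two_ne_zero) hrpos.ne'
      obtain ⟨v, hv, hv0⟩ := hφ.exists_fixed_point_of_prime_dvd_card_of_fixed_point (Fin r → F) hp (a := 0)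
        (by
          rintro ⟨_, n, rfl⟩
          have := act_smul n.1 (0 : F) 0
          change n.1 • (0 : Fin r → F) = 0
          simpa using this)
      exact ⟨v, fun n hn => hv ⟨_, ⟨n, hn⟩, rfl⟩, hv0.symm⟩
    obtain ⟨z0, hz0, hz1⟩ := hex
    obtain ⟨i, hi⟩ := Function.ne_iff.1 hz1
    have hEi : Pi.single i (1 : F) ∈ M := by
      obtain ⟨c, hc, hc1⟩ := H.exists_norm_one_ne
      have hc0 : c ≠ 0 := by rintro rfl; simp at hc
      let d : Fin r → Fˣ := fun j => if j = i then Units.mk0 c hc0 else 1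
      have hd : ∀ j, (d j : F) * star (d j : F) = 1 := by
        intro j
        by_cases h : j = i <;> simp [d, h, hc]
      obtain ⟨l, m, hlm⟩ := dd_exists H (dg_iso hd) (by
        rw [dg_det, ]
        simp only [star_prod]
        rw [← Finset.prod_mul_distrib]
        exact Finset.prod_eq_one fun j _ => hd j)
      have h1 := M.sub_mem (hMd z0 hz0 _ _ _ hlm) hz0
      have h2 : dg d z0 - z0 = ((c - 1) * z0 i) • Pi.single i (1 : F) := by
        ext j
        by_cases h : j = i
        · subst h; simp [dg_app, d]; ring
        · simp [dg_app, d, h]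
      rw [h2] at h1
      have h3 := M.smul_mem ((c - 1) * z0 i)⁻¹ h1
      rwa [smul_smul, inv_mul_cancel₀ (mul_ne_zero (sub_ne_zero.2 hc1) hi), one_smul] at h3
    have hE : ∀ j, Pi.single j (1 : F) ∈ M := by
      intro j
      obtain ⟨l, m, hlm⟩ := dd_exists H (sw_iso i j) (sw_det i j)
      have := hMd _ hEi _ _ _ hlm
      rwa [sw_single] at this
    intro z
    have : z = ∑ j, z j • Pi.single j (1 : F) := by
      ext k; simp [Finset.sum_apply, Pi.single_apply]
    change z ∈ M
    rw [this]
    exact M.sum_mem fun j _ => M.smul_mem _ (hE j)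
  -- conclusion
  obtain ⟨g, hg⟩ := P.exists_left hr
  have hgS := hg.choose
  obtain ⟨a, ha⟩ := tl hg ⟨1, by rw [rr_ee, one_smul]⟩
  have ha0 := ne_zero_of_smul ee_ne ha
  have hnorm : a * star a = 1 := by
    obtain ⟨ε, h0, he⟩ := H.exists_eps
    obtain ⟨c', hc', h1⟩ := Te.1 ε (by rw [he]; ring)
    have h2 := hg.conj h1
    rw [tv_conj hee _ hgS.1, tv_conj hee _ hr.1, rr_ee, ha, tv_smul hee] at h2
    obtain ⟨z, hz⟩ := P.uniq_left h2 h1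
    have hz1 : z = 1 := by
      have := hz ee
      rw [tv_app hee, tv_app hee, hee] at this
      have := congrArg Prod.fst this
      simp [ee] at this
      exact this.symm
    have := hz ff
    rw [hz1, one_smul, tv_app hee, tv_app hee, hef] at this
    have := congrArg Prod.fst this
    simp [ee] at this
    have h5 : (a * star a - 1) * ε = 0 := by linear_combination this
    exact sub_eq_zero.1 ((mul_eq_zero.1 h5).resolve_right h0)
  have hact : ∀ z, a⁻¹ • (g (ww z)).2.2 = z := by
    intro z
    have := hall z ⟨⟨g, hgS⟩, a, ha⟩ ⟨w, c, hg⟩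
    rw [act_def] at this
    change ((g ee).1)⁻¹ • (g (ww z)).2.2 = _ at this
    rw [ha] at this
    simpa [ee] using this
  let Y : GV F r := (LinearEquiv.smulOfUnit (Units.mk0 a ha0)⁻¹ : GV F r) * g
  have hYa : ∀ v, Y v = a⁻¹ • g v := fun v => rfl
  have hY : ∀ u v, hh (Y u) (Y v) = hh u v := by
    intro u v
    rw [hYa, hYa, hh_smul_left, hh_smul_right, hgS.1, ← mul_assoc, star_inv₀, ← mul_inv, mul_comm (star a), hnorm]
    simp
  have hYe : Y ee = ee := by rw [hYa, ha, smul_smul, inv_mul_cancel₀ ha0, one_smul]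
  have hYr := mem_R hY hYe (fun z => by rw [hYa]; exact hact z)
  have hYS : rr (Y ff).2.2 (Y ff).1 ∈ SS F r := by
    apply rr_mem H
    have := hY ff ff
    rw [hff, hYr, rr_ff] at this
    simp [hh] at this
    linear_combination this
  refine ⟨_, _, hYS, hr, ?_⟩
  obtain ⟨h1, h2, h3⟩ := hg
  rw [← h3, ← mul_inv_eq_one, ← map_inv, ← map_mul, P.k1]
  refine ⟨a⁻¹, fun v => ?_⟩
  change rr (Y ff).2.2 (Y ff).1 (g⁻¹ v) = _
  rw [← hYr, hYa, inv_app]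

end UV
set_option linter.all false

namespace UV
variable {F : Type*} [Field F] [Fintype F] [StarRing F] {p q r : ℕ}
variable {Q : Type*} [Group Q] {ρ₁ ρ₂ : SS F r →* Q}

theorem eq_of_scal_ee {g g' : GV F r} {z : F} (h : ∀ v, g v = z • g' v) (he : g ee = ee) (he' : g' ee = ee) :
    g = g' := by
  have h1 := h ee
  rw [he, he'] at h1
  have := congrArg Prod.fst h1
  simp [ee] at this
  subst this
  ext1 v
  rw [h, one_smul]

theorem rr_uniq_left (P : Pr ρ₁ ρ₂) {w w' : Fin r → F} {c c' : F} {k : GV F r} (h : Rel ρ₁ ρ₂ (rr w c) k)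
    (h' : Rel ρ₁ ρ₂ (rr w' c') k) : w = w' ∧ c = c' := by
  obtain ⟨z, hz⟩ := P.uniq_left h h'
  exact rr_inj (eq_of_scal_ee hz (rr_ee _ _) (rr_ee _ _))

theorem rr_uniq_right (P : Pr ρ₁ ρ₂) {w w' : Fin r → F} {c c' : F} {k : GV F r} (h : Rel ρ₁ ρ₂ k (rr w c))
    (h' : Rel ρ₁ ρ₂ k (rr w' c')) : w = w' ∧ c = c' := rr_uniq_left P.symm h.symm h'.symm

structure Dat (ρ₁ ρ₂ : SS F r →* Q) (A : (Fin r → F) → (Fin r → F)) (B : (Fin r → F) → F → F)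
    (g : F → F) : Prop where
  P : Pr ρ₁ ρ₂
  Te : TT ρ₁ ρ₂ ee
  Tf : TT ρ₁ ρ₂ ff
  relR : ∀ w c, c + star c + hw w w = 0 → Rel ρ₁ ρ₂ (rr (A w) (B w c)) (rr w c)
  relT : ∀ b, b + star b = 0 → g b + star (g b) = 0 ∧ Rel ρ₁ ρ₂ (tv ff (g b)) (tv ff b)

theorem exists_tr (H : HF F p q) (w : Fin r → F) : ∃ c : F, c + star c + hw w w = 0 := by
  obtain ⟨c, hc⟩ := H.trace_surj (y := - hw w w) (by rw [star_neg, star_hw])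
  exact ⟨c, by linear_combination hc⟩

theorem fiber (P : Pr ρ₁ ρ₂) (Te : TT ρ₁ ρ₂ ee) {w w' w'' : Fin r → F} {c c' d d' : F}
    (h1 : Rel ρ₁ ρ₂ (rr w' c') (rr w c)) (h2 : Rel ρ₁ ρ₂ (rr w'' d') (rr w d)) : w' = w'' := by
  have h := h1.mul h2.inv
  rw [rr_inv, rr_inv, rr_mul, rr_mul] at h
  have e : w + -w = 0 := by simp
  have h5 := rr_cond h.choose_spec.choose
  rw [e] at h h5
  obtain ⟨x, hx, h3⟩ := Te.2 (c + (-d - hw w w) - hw w (-w)) (by rw [hw_zero_left, add_zero] at h5; exact h5)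
  rw [tv_ee, tv_ee] at h3
  have := (rr_uniq_left P h h3).1
  rwa [← sub_eq_add_neg, sub_eq_zero] at this

theorem exists_dat (H : HF F p q) (P : Pr ρ₁ ρ₂) (Te : TT ρ₁ ρ₂ ee) (Tf : TT ρ₁ ρ₂ ff) :
    ∃ A B g, Dat ρ₁ ρ₂ A B g := by
  choose cw hcw using fun w => exists_tr (r := r) H w
  have hex : ∀ (w : Fin r → F) (c : F), c + star c + hw w w = 0 → ∃ w' c', Rel ρ₁ ρ₂ (rr w' c') (rr w c) :=
    fun w c h => R_left H P Te (rr_mem H h)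
  choose! W C hWC using hex
  have hg : ∀ b : F, b + star b = 0 → ∃ b', b' + star b' = 0 ∧ Rel ρ₁ ρ₂ (tv ff b') (tv ff b) := Tf.2
  choose! g hg using hg
  refine ⟨fun w => W w (cw w), C, g, P, Te, Tf, fun w c h => ?_, hg⟩
  have h1 := hWC w c h
  have h2 := hWC w _ (hcw w)
  have := fiber P Te h2 h1
  rw [this]
  exact h1

namespace Dat
variable {A : (Fin r → F) → (Fin r → F)} {B : (Fin r → F) → F → F} {g : F → F}

theorem cond (D : Dat ρ₁ ρ₂ A B g) {w c} (h : c + star c + hw w w = 0) :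
    B w c + star (B w c) + hw (A w) (A w) = 0 := rr_cond (D.relR w c h).choose

theorem A_eq (D : Dat ρ₁ ρ₂ A B g) {w w' c c'} (h : Rel ρ₁ ρ₂ (rr w' c') (rr w c)) :
    w' = A w ∧ c' = B w c :=
  rr_uniq_left D.P h (D.relR _ _ (rr_cond h.choose_spec.choose))

theorem mulr (D : Dat ρ₁ ρ₂ A B g) {w w' c c'} (h : c + star c + hw w w = 0) (h' : c' + star c' + hw w' w' = 0) :
    A w + A w' = A (w + w') ∧ B w c + B w' c' - hw (A w) (A w') = B (w + w') (c + c' - hw w w') := by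
  have := (D.relR w c h).mul (D.relR w' c' h')
  rw [rr_mul, rr_mul] at this
  exact D.A_eq this

theorem A_add (H : HF F p q) (D : Dat ρ₁ ρ₂ A B g) (w w') : A (w + w') = A w + A w' := by
  obtain ⟨c, hc⟩ := exists_tr H w
  obtain ⟨c', hc'⟩ := exists_tr H w'
  exact (D.mulr hc hc').1.symm

theorem A_zero (H : HF F p q) (D : Dat ρ₁ ρ₂ A B g) : A 0 = 0 := by
  have := D.A_add H 0 0
  simpa using this

theorem A_inj (H : HF F p q) (D : Dat ρ₁ ρ₂ A B g) : Function.Injective A := by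
  intro w w' h
  obtain ⟨c, hc⟩ := exists_tr H w
  obtain ⟨c', hc'⟩ := exists_tr H w'
  have h1 := (D.relR w c hc).symm
  have h2 := (D.relR w' c' hc').symm
  rw [← h] at h2
  exact fiber D.P.symm D.Te.symm h1 h2

theorem A_ne (H : HF F p q) (D : Dat ρ₁ ρ₂ A B g) {w} (h : w ≠ 0) : A w ≠ 0 := fun h' =>
  h (D.A_inj H (by rw [h', D.A_zero H]))

theorem im {c : F} (h : c + star c = 0) : c + star c + hw (0 : Fin r → F) 0 = 0 := by
  rw [hw_zero_left, add_zero, h]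

theorem f_im (H : HF F p q) (D : Dat ρ₁ ρ₂ A B g) {c : F} (h : c + star c = 0) :
    B 0 c + star (B 0 c) = 0 := by
  have := D.cond (im h)
  rwa [D.A_zero H, hw_zero_left, add_zero] at this

theorem f_add (H : HF F p q) (D : Dat ρ₁ ρ₂ A B g) {c c' : F} (h : c + star c = 0) (h' : c' + star c' = 0) :
    B 0 (c + c') = B 0 c + B 0 c' := by
  have := (D.mulr (im h) (im h')).2
  simp [D.A_zero H, hw_zero_left] at this
  exact this.symm

theorem f_zero (H : HF F p q) (D : Dat ρ₁ ρ₂ A B g) : B 0 0 = 0 := by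
  have := D.f_add H (c := 0) (c' := 0) (by simp) (by simp)
  simpa using this

theorem f_ne (H : HF F p q) (D : Dat ρ₁ ρ₂ A B g) {c : F} (h : c + star c = 0) (h0 : c ≠ 0) : B 0 c ≠ 0 := by
  intro h1
  have h2 := D.relR 0 c (im h)
  have h3 := D.relR 0 0 (im (by simp))
  rw [h1] at h2
  rw [D.f_zero H] at h3
  exact h0 (rr_uniq_right D.P h2 h3).2

theorem B_add (H : HF F p q) (D : Dat ρ₁ ρ₂ A B g) {w c d} (h : c + star c + hw w w = 0) (h' : d + star d = 0) :
    B w (c + d) = B w c + B 0 d := by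
  have := (D.mulr h (im h')).2
  simp [D.A_zero H, hw_zero_right] at this
  exact this.symm

/-- commutator relation -/
theorem f_comm (H : HF F p q) (D : Dat ρ₁ ρ₂ A B g) (w w') :
    B 0 (hw w' w - hw w w') = hw (A w') (A w) - hw (A w) (A w') := by
  obtain ⟨c, hc⟩ := exists_tr H w
  obtain ⟨c', hc'⟩ := exists_tr H w'
  have h1 := (D.mulr hc hc').2
  have h2 := (D.mulr hc' hc).2
  have h3 : (c' + c - hw w' w) + star (c' + c - hw w' w) + hw (w + w') (w + w') = 0 := by
    simp only [star_sub, star_add, star_hw, hw_add_left, hw_add_right]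
    linear_combination hc + hc'
  have h4 : (hw w' w - hw w w') + star (hw w' w - hw w w') = 0 := by
    simp only [star_sub, star_hw]; ring
  have h5 := D.B_add H h3 h4
  have e : c' + c - hw w' w + (hw w' w - hw w w') = c + c' - hw w w' := by ring
  rw [e, ← h1, add_comm w w', ← h2] at h5
  linear_combination -h5

/-- stabilizers of both lines -/
theorem conj_formula {d : GV F r} (hd : d ∈ SS F r) {l m : F} (he : d ee = l • ee) (hf : d ff = m • ff)
    {w c} (hr : rr w c ∈ SS F r) :
    d * rr w c * d⁻¹ = rr (m⁻¹ • (d (ww w)).2.2) (m⁻¹ * (l * c)) := by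
  obtain ⟨w', c', h⟩ := norm_R hd he hr
  have h0 := ne_zero_of_smul ff_ne hf
  have hf' : d⁻¹ ff = m⁻¹ • ff := by
    change d.symm ff = _
    rw [LinearEquiv.symm_apply_eq, map_smul, hf, smul_smul, inv_mul_cancel₀ h0, one_smul]
  have h1 := congrArg (fun k : GV F r => k ff) h
  simp only [mul_app, hf', map_smul, rr_ff] at h1
  have e : ((c, 1, w) : VV F r) = c • ee + ff + ww w := by
    rw [decomp (c, 1, w), one_smul]
  rw [e, map_add, map_add, map_smul, he, hf] at h1
  have h2 := congrArg Prod.fst h1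
  have h3 := congrArg (fun v => v.2.2) h1
  simp [ee, ff, W_of_fix' hd.1 hf] at h2 h3
  rw [h, ← h3, ← h2, mul_comm c l]

theorem conj (H : HF F p q) (D : Dat ρ₁ ρ₂ A B g) {d : GV F r} (hd : d ∈ SS F r) {l m : F} (he : d ee = l • ee)
    (hf : d ff = m • ff) : ∃ (L : (Fin r → F) →ₗ[F] (Fin r → F)) (t : F),
      (∀ w, A (m⁻¹ • (d (ww w)).2.2) = L (A w)) ∧ ∀ c : F, c + star c = 0 → B 0 (m⁻¹ * (l * c)) = t * B 0 c := by
  obtain ⟨d', hr⟩ := D.P.exists_left hd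
  obtain ⟨l', he'⟩ := line_transfer H D.P.symm hee ee_ne hee D.Te.symm D.Te.symm hr.symm ⟨l, he⟩
  obtain ⟨m', hf'⟩ := line_transfer H D.P.symm hff ff_ne hff D.Tf.symm D.Tf.symm hr.symm ⟨m, hf⟩
  let L : (Fin r → F) →ₗ[F] (Fin r → F) := m'⁻¹ • ((LinearMap.snd F F (Fin r → F)) ∘ₗ (LinearMap.snd F F (F × (Fin r → F))) ∘ₗ
    (d' : VV F r →ₗ[F] VV F r) ∘ₗ (LinearMap.inr F F (F × (Fin r → F))) ∘ₗ LinearMap.inr F F (Fin r → F))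
  have hL : ∀ w, L w = m'⁻¹ • (d' (ww w)).2.2 := fun w => rfl
  have key : ∀ w c, c + star c + hw w w = 0 → 
      m'⁻¹ • (d' (ww (A w))).2.2 = A (m⁻¹ • (d (ww w)).2.2) ∧ 
      m'⁻¹ * (l' * B w c) = B (m⁻¹ • (d (ww w)).2.2) (m⁻¹ * (l * c)) := by
    intro w c h
    have h1 := D.relR w c h
    have h2 := hr.conj h1
    rw [conj_formula hd he hf (rr_mem H h), conj_formula hr.choose he' hf' h1.choose] at h2
    exact D.A_eq h2
  refine ⟨L, m'⁻¹ * l', fun w => ?_, fun c hc => ?_⟩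
  · obtain ⟨c, hc⟩ := exists_tr H w
    rw [hL, (key w c hc).1]
  · have := (key 0 c (im hc)).2
    have e : (ww 0 : VV F r) = 0 := rfl
    rw [e, map_zero] at this
    change _ = B (m⁻¹ • (0 : Fin r → F)) _ at this
    rw [smul_zero] at this
    rw [← this, mul_assoc]

theorem conj_dd (H : HF F p q) (D : Dat ρ₁ ρ₂ A B g) {l m : Fˣ} {k : (Fin r → F) ≃ₗ[F] (Fin r → F)}
    (hd : dd l m k ∈ SS F r) : ∃ (L : (Fin r → F) →ₗ[F] (Fin r → F)) (t : F),
      (∀ w, A ((m : F)⁻¹ • k w) = L (A w)) ∧ ∀ c : F, c + star c = 0 → B 0 ((m : F)⁻¹ * (l * c)) = t * B 0 c := by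
  have h1 : dd l m k ee = (l : F) • ee := by rw [dd_app]; ext <;> simp [ee]
  have h2 : dd l m k ff = (m : F) • ff := by rw [dd_app]; ext <;> simp [ff]
  exact D.conj H hd h1 h2

/-- Lemma K -/
theorem K (H : HF F p q) (D : Dat ρ₁ ρ₂ A B g) {w : Fin r → F} {c b : F} (h : c + star c + hw w w = 0) (hb : b + star b = 0)
    (h0 : 1 + b * c ≠ 0) : 1 + g b * B w c ≠ 0 ∧ A w = (1 + g b * B w c) • A ((1 + b * c)⁻¹ • w) := by
  set y := 1 + b * c with hy
  have hs : star y ≠ 0 := by simpa using h0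
  have hsb : star b = -b := by linear_combination hb
  have h' : y⁻¹ * c + star (y⁻¹ * c) + hw (y⁻¹ • w) (y⁻¹ • w) = 0 := by
    rw [hw_smul_left, hw_smul_right, star_mul', star_inv₀]
    have hsy : star y = 1 - b * star c := by rw [hy]; simp [hsb]; ring
    rw [hsy] at hs ⊢
    field_simp
    rw [hy]
    linear_combination h
  have r1 := D.relR _ _ h
  have r2 := D.relR _ _ h'
  have r3 := (D.relT b hb).2
  have r4 := (r2.inv.mul (r3.mul r1))
  obtain ⟨t, ht⟩ := line_transfer H D.P.symm hff ff_ne hff D.Tf.symm D.Tf.symm r4.symm ⟨y, by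
    rw [mul_app, mul_app, rr_ff, tv_ff_app]
    change (rr (y⁻¹ • w) (y⁻¹ * c)).symm _ = _
    rw [LinearEquiv.symm_apply_eq, map_smul, rr_ff]
    ext
    · simp [h0]
    · simp [hy]
    · simp [h0]⟩
  have ht0 := ne_zero_of_smul ff_ne ht
  rw [mul_app, mul_app, rr_ff, tv_ff_app] at ht
  change (rr _ _).symm _ = _ at ht
  rw [LinearEquiv.symm_apply_eq, map_smul, rr_ff] at ht
  simp only [Prod.smul_mk, Prod.mk.injEq, smul_eq_mul, mul_one] at ht
  obtain ⟨-, h2, h3⟩ := ht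
  rw [h2]
  exact ⟨ht0, h3⟩

theorem E (H : HF F p q) (D : Dat ρ₁ ρ₂ A B g) {b : F} (hb : b + star b = 0)
    (h0 : b ≠ 0) : g b * B 0 b⁻¹ = 1 := by
  have hb' : b⁻¹ + star b⁻¹ = 0 := by
    have : star b = -b := by linear_combination hb
    rw [star_inv₀, this, inv_neg]; ring
  have r1 := D.relR 0 _ (im hb')
  have r3 := (D.relT b hb).2
  have r4 := r1.inv.mul r3
  obtain ⟨t, ht⟩ := line_transfer H D.P.symm hee ee_ne hff D.Te.symm D.Tf.symm r4.symm ⟨b, by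
    rw [mul_app, tv_ff_app]
    change (rr _ _).symm _ = _
    rw [LinearEquiv.symm_apply_eq, map_smul, rr_ff]
    ext <;> simp [h0, ee]⟩
  rw [mul_app, tv_ff_app] at ht
  change (rr _ _).symm _ = _ at ht
  rw [LinearEquiv.symm_apply_eq, map_smul, rr_ff] at ht
  simp only [Prod.smul_mk, Prod.mk.injEq, smul_eq_mul, mul_one, ee, zero_add] at ht
  rw [ht.2.1]
  exact ht.1.symm

end Dat
end UV
set_option linter.all false

namespace UV
variable {F : Type*} [Field F] [Fintype F] [StarRing F] {p q r : ℕ}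
variable {Q : Type*} [Group Q] {ρ₁ ρ₂ : SS F r →* Q}

theorem span_k (H : HF F p q) {y : F} (hy : star y ≠ y) (x : F) :
    ∃ a b : F, star a = a ∧ star b = b ∧ x = a + b * y := by
  have h0 : y - star y ≠ 0 := sub_ne_zero.2 (Ne.symm hy)
  have hb : star ((x - star x) / (y - star y)) = (x - star x) / (y - star y) := by
    rw [star_div₀, star_sub, star_sub, star_star, star_star, ← neg_sub x, ← neg_sub y, neg_div_neg_eq]
  refine ⟨x - (x - star x) / (y - star y) * y, (x - star x) / (y - star y), ?_, hb, by ring⟩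
  rw [star_sub, star_mul', hb]
  field_simp
  ring

/-- multiplicativity from a multiplier set (r = 1) -/
theorem mul_of_cube (H : HF F p q) {ψ : F → F} (hadd : ∀ x y, ψ (x + y) = ψ x + ψ y) (h1 : ψ 1 = 1)
    (hinj : Function.Injective ψ)
    (hm : ∀ l : F, l ≠ 0 → ∀ x, ψ (star l * (star l / l) * x) = ψ (star l * (star l / l)) * ψ x) (x y : F) :
    ψ (x * y) = ψ x * ψ y := by
  have h0 : ψ 0 = 0 := by have := hadd 0 0; simpa using this
  by_cases hc : ∃ l : F, l ≠ 0 ∧ star (star l * (star l / l)) ≠ star l * (star l / l)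
  · obtain ⟨l, hl, hs⟩ := hc
    have hk : ∀ a : F, star a = a → ∀ x, ψ (a * x) = ψ a * ψ x := by
      intro a ha x
      by_cases h : a = 0
      · subst h; simp [h0]
      have := hm a h x
      rwa [ha, div_self h, mul_one] at this
    set s := star l * (star l / l) with hs'
    obtain ⟨a, b, ha, hb, rfl⟩ := span_k H hs x
    rw [add_mul, hadd, hadd, hk a ha, mul_assoc, hk b hb, hm l hl, hk b hb]
    ring
  · push Not at hc
    have hq : q = 2 := by
      obtain ⟨g, -, hg⟩ := H.gen
      have h2 := H.two_le
      have := hc g g.ne_zero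
      simp only [star_mul', star_div₀, star_star] at this
      have h3 : star (g : F) ^ 3 = (g : F) ^ 3 := by
        have e1 : (g : F) ≠ 0 := g.ne_zero
        have e2 : star (g : F) ≠ 0 := by simpa using e1
        field_simp at this
        linear_combination -this
      rw [H.hs, ← pow_mul] at h3
      have h4 : g ^ (q * 3) = g ^ 3 := by ext; simpa using h3
      have h5 : g ^ (3 * (q - 1)) = 1 := by
        have e : q * 3 = 3 * (q - 1) + 3 := by omega
        rw [e, pow_add] at h4
        simpa using h4
      have h6 := orderOf_dvd_of_pow_eq_one h5
      rw [hg, mul_comm] at h6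
      have h7 := Nat.dvd_of_mul_dvd_mul_right (by omega) h6
      have := Nat.le_of_dvd (by norm_num) h7
      omega
    subst hq
    obtain ⟨m, hm0, hm⟩ := H.ex
    have hp2 : p = 2 := by
      have : p ∣ 2 := by rw [hm]; exact dvd_pow_self p hm0.ne'
      exact (Nat.prime_dvd_prime_iff_eq H.hp Nat.prime_two).1 this
    subst hp2
    have := H.charP
    have h2 : (2 : F) = 0 := by exact_mod_cast CharP.cast_eq_zero F 2
    have h4 : ∀ x : F, x ≠ 0 → x ≠ 1 → x * x = x + 1 := by
      intro x hx hx1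
      have := FiniteField.pow_card x
      rw [H.hc] at this
      have h5 : x * ((x - 1) * (x * x - (x + 1))) = 0 := by
        linear_combination this + (- x^3+x) * h2
      have := (mul_eq_zero.1 ((mul_eq_zero.1 h5).resolve_left hx)).resolve_left (sub_ne_zero.2 hx1)
      exact sub_eq_zero.1 this
    by_cases x0 : x = 0
    · subst x0; simp [h0]
    by_cases x1 : x = 1
    · subst x1; simp [h1]
    by_cases y0 : y = 0
    · subst y0; simp [h0]
    by_cases y1 : y = 1
    · subst y1; simp [h1]
    have hx := h4 x x0 x1
    have hψ := h4 (ψ x) (fun h => x0 (hinj (by rw [h, h0]))) (fun h => x1 (hinj (by rw [h, h1])))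
    have : (y - x) * (y - (x + 1)) = 0 := by
      linear_combination h4 y y0 y1 + hx + (1+x-x*y)*h2
    rcases mul_eq_zero.1 this with h | h
    · have : y = x := sub_eq_zero.1 h
      subst this
      rw [hx, hψ, hadd, h1]
    · have : y = x + 1 := sub_eq_zero.1 h
      subst this
      have : x * (x + 1) = 1 := by linear_combination hx + x * h2
      rw [this, hadd, h1]
      linear_combination -hψ - ψ x * h2

namespace Dat
variable {A : (Fin r → F) → (Fin r → F)} {B : (Fin r → F) → F → F} {g : F → F}

theorem line1 (H : HF F p q) (D : Dat ρ₁ ρ₂ A B g) {w : Fin r → F} (hw1 : hw w w = 1) (y : F) :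
    ∃ t : F, A (y • w) = t • A w := by
  have h1 : ∀ y : F, star y ≠ y → ∃ t : F, A (y⁻¹ • w) = t • A w := by
    intro y hy
    have hb0 : star y - y ≠ 0 := sub_ne_zero.2 hy
    have hb : (star y - y) + star (star y - y) = 0 := by simp
    have e : 1 + (star y - y) * ((y - 1) / (star y - y)) = y := by field_simp; ring
    have hy0 : y ≠ 0 := by rintro rfl; simp at hy
    obtain ⟨k1, k2⟩ := D.K H (w := w) (c := (y - 1) / (star y - y)) (b := star y - y) (by
      rw [hw1, star_div₀]
      simp only [star_sub, star_star, star_one]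
      have : y - star y ≠ 0 := sub_ne_zero.2 (Ne.symm hy)
      rw [← neg_sub (star y) y, div_neg]
      field_simp
      ring) hb (by rw [e]; exact hy0)
    rw [e] at k2
    refine ⟨(1 + g (star y - y) * B w ((y - 1) / (star y - y)))⁻¹, ?_⟩
    conv_rhs => rw [k2]
    rw [smul_smul, inv_mul_cancel₀ k1, one_smul]
  have h2 : ∀ y : F, star y ≠ y → ∃ t : F, A (y • w) = t • A w := by
    intro y hy
    have := h1 y⁻¹ (by rw [star_inv₀]; intro h; exact hy (inv_injective h))
    rwa [inv_inv] at this
  by_cases hy : star y = y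
  · obtain ⟨z, hz⟩ := H.exists_star_ne
    obtain ⟨t, ht⟩ := h2 (y - z) (by
      rw [star_sub, hy]; intro h; exact hz (by linear_combination -h))
    obtain ⟨t', ht'⟩ := h2 z hz
    refine ⟨t + t', ?_⟩
    rw [add_smul, ← ht, ← ht', ← D.A_add H, ← add_smul]
    congr 2; ring
  · exact h2 y hy

theorem semi (H : HF F p q) (D : Dat ρ₁ ρ₂ A B g) (i₀ : Fin r) :
    ∃ σ : F ≃+* F, ∀ x w, A (x • w) = σ x • A w := by
  have hs : ∀ i (x : F), (Pi.single i x : Fin r → F) = x • Pi.single i 1 := by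
    intro i x; rw [← Pi.single_smul]; simp
  choose ψ hψ using fun (i : Fin r) => line1 H D (w := Pi.single i 1) (by rw [hw_single_left]; simp)
  have hne : ∀ i, A (Pi.single i 1) ≠ 0 := fun i => D.A_ne H (by simp)
  have huniq : ∀ i (a b : F), a • A (Pi.single i 1) = b • A (Pi.single i 1) → a = b := fun i a b h =>
    smul_left_injective F (hne i) h
  have hadd : ∀ i x y, ψ i (x + y) = ψ i x + ψ i y := by
    intro i x y
    apply huniq i
    rw [← hψ, add_smul, D.A_add H, add_smul, hψ, hψ]
  have h1 : ∀ i, ψ i 1 = 1 := by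
    intro i; apply huniq i; rw [← hψ, one_smul, one_smul]
  have h0 : ∀ i, ψ i 0 = 0 := fun i => by have := hadd i 0 0; simpa using this
  have hinj : ∀ i, Function.Injective (ψ i) := by
    intro i x y h
    have := hψ i x
    rw [h, ← hψ] at this
    have := D.A_inj H this
    have := congrFun this i
    simpa using this
  -- multiplicativity
  have hdg : ∀ (l : F) (hl : l ≠ 0) (i j : Fin r) (x : F),
      ψ i (star l * ((if i = j then star l / l else 1) * x)) = ψ i (star l * (if i = j then star l / l else 1)) * ψ i x := by
    intro l hl i j x
    have hsl : star l ≠ 0 := by simpa using hl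
    set lu := Units.mk0 l hl
    set su := Units.mk0 (star l) hsl
    set d : Fin r → Fˣ := fun k => if k = j then su / lu else 1 with hd
    have hdj : ∀ k, ((d k : Fˣ) : F) = if k = j then star l / l else 1 := by
      intro k; simp only [hd]; split_ifs <;> simp [lu, su]
    have hmem : dd lu su⁻¹ (dg d) ∈ SS F r := by
      apply dd_mem
      · apply dg_iso
        intro k
        rw [hdj]; split_ifs
        · rw [star_div₀, star_star]; field_simp
        · simp
      · simp [lu, su, hsl]
      · rw [dg_det, Finset.prod_congr rfl (fun k _ => hdj k), Finset.prod_ite_eq' Finset.univ j]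
        simp [lu, su]
        field_simp
    obtain ⟨L, t, hL, -⟩ := D.conj_dd H hmem
    have key : ∀ x : F, L (A (Pi.single i x)) = ψ i (star l * ((if i = j then star l / l else 1) * x)) • A (Pi.single i 1) := by
      intro x
      rw [← hL, ← hψ]
      congr 1
      ext k
      by_cases hk : k = i
      · subst hk; simp [dg_app, hdj, su]
      · simp [dg_app, Pi.single_eq_of_ne hk]
    apply huniq i
    rw [← key, hs, hψ, map_smul, key, mul_one, smul_smul, mul_comm]
  have hmul : ∀ i x y, ψ i (x * y) = ψ i x * ψ i y := by
    intro i x y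
    by_cases hj : ∃ j, j ≠ i
    · obtain ⟨j, hj⟩ := hj
      by_cases hx : x = 0
      · subst hx; simp [h0]
      have := hdg (star x) (by simpa using hx) i j y
      simpa [hj.symm] using this
    · push Not at hj
      apply mul_of_cube H (hadd i) (h1 i) (hinj i)
      intro l hl x
      have := hdg l hl i i x
      simp only [if_true] at this
      rw [← this, mul_assoc]
  have hsame : ∀ i j x, ψ j x = ψ i x := by
    intro i j x
    obtain ⟨l, m, hlm⟩ := dd_exists H (sw_iso i j) (sw_det i j)
    obtain ⟨L, t, hL, -⟩ := D.conj_dd H hlm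
    have key : ∀ x : F, L (A (Pi.single i x)) = ψ j ((m : F)⁻¹ * x) • A (Pi.single j 1) := by
      intro x
      rw [← hL, sw_single, ← hψ, ← Pi.single_smul, ← Pi.single_smul]; simp
    have : ψ j ((m : F)⁻¹ * x) = ψ i x * ψ j ((m : F)⁻¹) := by
      apply huniq j
      rw [← key, hs, hψ, map_smul, key, mul_one, smul_smul]
    rw [hmul, mul_comm] at this
    exact mul_right_cancel₀ (fun h => by
      have h3 := hinj j (h.trans (h0 j).symm)
      simp at h3) this
  let σ0 : F →+* F := { toFun := ψ i₀, map_one' := h1 _, map_mul' := hmul _, map_zero' := h0 _, map_add' := hadd _ }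
  refine ⟨RingEquiv.ofBijective σ0 (Finite.injective_iff_bijective.1 (hinj i₀)), fun x w => ?_⟩
  change _ = ψ i₀ x • _
  have hsum : ∀ w : Fin r → F, A w = ∑ i, A (Pi.single i (w i)) := by
    intro w
    let A' : (Fin r → F) →+ (Fin r → F) := { toFun := A, map_zero' := D.A_zero H, map_add' := D.A_add H }
    have := map_sum A' (fun i => (Pi.single i (w i) : Fin r → F)) Finset.univ
    rw [Finset.univ_sum_single] at this
    exact this
  rw [hsum, hsum w, Finset.smul_sum]
  refine Finset.sum_congr rfl fun i _ => ?_
  rw [hs, hψ, hs i (w i), hψ, Pi.smul_apply, smul_eq_mul, hmul, hsame i₀ i x, mul_smul]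

end Dat
end UV
set_option linter.all false

theorem frob_hom {K : Type*} [Field K] [Finite K] (p : ℕ) [Fact p.Prime] [CharP K p] (φ : K →+* K) :
    ∃ j : ℕ, ∀ x, φ x = x ^ (p ^ j) := by
  letI := ZMod.algebra K p
  have hcm : ∀ r : ZMod p, φ (algebraMap (ZMod p) K r) = algebraMap (ZMod p) K r := by
    intro r
    have : (φ.comp (algebraMap (ZMod p) K)) = algebraMap (ZMod p) K := Subsingleton.elim _ _
    exact RingHom.congr_fun this r
  let φ' : K →ₐ[ZMod p] K := { φ with commutes' := hcm }
  obtain ⟨n, hn⟩ := (FiniteField.bijective_frobeniusAlgHom_pow (ZMod p) K).2 φ'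
  refine ⟨n.1, fun x => ?_⟩
  change φ' x = _
  rw [← hn]
  have : ∀ k : ℕ, ((FiniteField.frobeniusAlgHom (ZMod p) K) ^ k) x = x ^ (p ^ k) := by
    intro k
    induction k with
    | zero => simp
    | succ k ih =>
      rw [pow_succ', AlgHom.mul_apply, ih, FiniteField.coe_frobeniusAlgHom, ZMod.card]
      beta_reduce
      rw [← pow_mul, pow_succ]
  exact this _

namespace UV
variable {F : Type*} [Field F] [Fintype F] [StarRing F] {p q r : ℕ}
variable {Q : Type*} [Group Q] {ρ₁ ρ₂ : SS F r →* Q}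

def kF (F : Type*) [Field F] [StarRing F] : Subfield F where
  carrier := {x | star x = x}
  mul_mem' := by intro a b ha hb; simp only [Set.mem_setOf_eq] at *; rw [star_mul', ha, hb]
  one_mem' := by simp
  add_mem' := by intro a b ha hb; simp only [Set.mem_setOf_eq] at *; rw [star_add, ha, hb]
  zero_mem' := by simp
  neg_mem' := by intro a ha; simp only [Set.mem_setOf_eq] at *; rw [star_neg, ha]
  inv_mem' := by intro a ha; simp only [Set.mem_setOf_eq] at *; rw [star_inv₀, ha]

theorem ext_k (H : HF F p q) {φ : F → F} (hk : ∀ x, star x = x → star (φ x) = φ x)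
    (hadd : ∀ x y, star x = x → star y = y → φ (x + y) = φ x + φ y) (h1 : φ 1 = 1)
    (hsq : ∀ l x, star l = l → l ≠ 0 → star x = x → φ (l * l * x) = φ (l * l) * φ x) :
    ∃ σ : F ≃+* F, ∀ x, star x = x → φ x = σ x := by
  have h0 : φ 0 = 0 := by have := hadd 0 0 (by simp) (by simp); simpa using this
  have hsq' : ∀ l x, star l = l → star x = x → φ (l * l * x) = φ (l * l) * φ x := by
    intro l x hl hx
    by_cases h : l = 0
    · subst h; simp [h0]
    exact hsq l x hl h hx
  have hneg : ∀ x, star x = x → φ (-x) = - φ x := by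
    intro x hx
    have := hadd x (-x) hx (by rw [star_neg, hx])
    rw [add_neg_cancel, h0] at this
    linear_combination -this
  have hmul : ∀ y x, star y = y → star x = x → φ (y * x) = φ y * φ x := by
    intro y x hy hx
    by_cases hc : (2 : F) = 0
    · have hr : ringChar F = 2 := by
        have := H.charP
        have h2 : p ∣ 2 := (CharP.cast_eq_zero_iff F p 2).1 (by exact_mod_cast hc)
        have := (Nat.prime_dvd_prime_iff_eq H.hp Nat.prime_two).1 h2
        subst this
        exact ringChar.eq F 2
      obtain ⟨s, hs⟩ := FiniteField.isSquare_of_char_two hr y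
      have hss : star s = s := by
        have h3 : star s * star s = s * s := by rw [← star_mul', ← hs, hy]
        have : (star s - s) * (star s - s) = 0 := by linear_combination h3 + (s*s - s * star s) * hc
        exact sub_eq_zero.1 (mul_self_eq_zero.1 this)
      rw [hs]; exact hsq' s x hss hx
    · have s2 : star (2 : F) = 2 := by
        have := star_natCast (R := F) 2
        exact_mod_cast this
      set a := (y + 1) / 2 with ha
      set b := (y - 1) / 2 with hb
      have sa : star a = a := by rw [ha, star_div₀, star_add, star_one, hy, s2]
      have sb : star b = b := by rw [hb, star_div₀, star_sub, star_one, hy, s2]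
      have e : y = a * a + -(b * b) := by rw [ha, hb]; field_simp; ring
      have saa : star (a * a) = a * a := by rw [star_mul', sa]
      have sbb : star (b * b) = b * b := by rw [star_mul', sb]
      have saax : star (a * a * x) = a * a * x := by rw [star_mul', saa, hx]
      have sbbx : star (b * b * x) = b * b * x := by rw [star_mul', sbb, hx]
      have e2 : y * x = a * a * x + -(b * b * x) := by rw [e]; ring
      rw [e2, hadd _ _ saax (by rw [star_neg, sbbx]), hneg _ sbbx, hsq' a x sa hx, hsq' b x sb hx]
      rw [e, hadd _ _ saa (by rw [star_neg, sbb]), hneg _ sbb]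
      ring
  have := Fact.mk H.hp
  have := H.charP
  let φ' : kF F →+* kF F :=
    { toFun := fun x => ⟨φ x.1, hk _ x.2⟩
      map_one' := Subtype.ext h1
      map_zero' := Subtype.ext h0
      map_mul' := fun x y => Subtype.ext (hmul _ _ x.2 y.2)
      map_add' := fun x y => Subtype.ext (hadd _ _ x.2 y.2) }
  have : CharP (kF F) p := inferInstance
  obtain ⟨j, hj⟩ := frob_hom p φ'
  refine ⟨RingEquiv.ofBijective (iterateFrobenius F p j) (Finite.injective_iff_bijective.1 (iterateFrobenius F p j).injective), fun x hx => ?_⟩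
  have := congrArg Subtype.val (hj ⟨x, hx⟩)
  change φ x = _ at this
  rw [this]
  simp [iterateFrobenius_def]

theorem im_iff {c : F} : c + star c = 0 ↔ star c = -c := by
  constructor <;> intro h <;> linear_combination h

theorem im_mul {c y : F} (h : c + star c = 0) (hy : star y = y) : y * c + star (y * c) = 0 := by
  rw [star_mul', hy]; linear_combination y * h

namespace Dat
variable {A : (Fin r → F) → (Fin r → F)} {B : (Fin r → F) → F → F} {g : F → F}

theorem nform (H : HF F p q) (D : Dat ρ₁ ρ₂ A B g) : ∃ (σ : F ≃+* F) (κ : F), star κ = κ ∧ κ ≠ 0 ∧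
    (∀ x w, A (x • w) = σ x • A w) ∧ (∀ c, c + star c = 0 → B 0 c = κ * σ c) ∧
    ∀ w w', hw (A w) (A w') = κ * σ (hw w w') := by
  rcases Nat.eq_zero_or_pos r with hr | hr
  · subst hr
    obtain ⟨ε, h0, hε⟩ := H.exists_eps
    have hε' : ε + star ε = 0 := im_iff.2 hε
    have hf0 := D.f_ne H hε' h0
    have hfi := im_iff.1 (D.f_im H hε')
    have hadd : ∀ x y : F, star x = x → star y = y → B 0 ((x + y) * ε) / B 0 ε = B 0 (x * ε) / B 0 ε + B 0 (y * ε) / B 0 ε := by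
      intro x y hx hy
      rw [add_mul, D.f_add H (im_mul hε' hx) (im_mul hε' hy), add_div]
    obtain ⟨σ, hσ⟩ := ext_k H (φ := fun y => B 0 (y * ε) / B 0 ε) (fun x hx => by
        beta_reduce
        rw [star_div₀, hfi, im_iff.1 (D.f_im H (im_mul hε' hx)), neg_div_neg_eq]) hadd (by
        beta_reduce
        rw [one_mul, div_self hf0]) (fun l x hl hl0 hx => by
        have hm : dd (Units.mk0 l hl0) (Units.mk0 l hl0)⁻¹ (LinearEquiv.refl F (Fin 0 → F)) ∈ SS F 0 := by
          apply dd_mem (fun u v => rfl)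
          · simp [hl, hl0]
          · simp [hl0]
        obtain ⟨L, t, -, ht⟩ := D.conj_dd H hm
        have t1 := ht _ hε'
        have t2 := ht _ (im_mul hε' hx)
        simp only [Units.val_inv_eq_inv_val, Units.val_mk0, inv_inv] at t1 t2
        have e1 : l * l * x * ε = l * (l * (x * ε)) := by ring
        have e2 : l * l * ε = l * (l * ε) := by ring
        beta_reduce
        rw [e1, e2, t1, t2]
        field_simp)
    have hσ0 : σ ε ≠ 0 := by simpa using h0
    have hσs : star (σ ε) = - σ ε := by rw [← sig_star H, hε, map_neg]
    refine ⟨σ, B 0 ε / σ ε, ?_, div_ne_zero hf0 hσ0, fun x w => Subsingleton.elim _ _, fun c hc => ?_, fun w w' => by simp [hw]⟩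
    · rw [star_div₀, hfi, hσs, neg_div_neg_eq]
    · have hk : star (c / ε) = c / ε := by rw [star_div₀, hε, im_iff.1 hc, neg_div_neg_eq]
      have := hσ _ hk
      beta_reduce at this
      rw [div_mul_cancel₀ _ h0, map_div₀] at this
      field_simp at this ⊢
      linear_combination this
  · obtain ⟨σ, hσ⟩ := D.semi H ⟨0, hr⟩
    set E : Fin r → F := Pi.single ⟨0, hr⟩ 1 with hE
    have hEE : hw E E = 1 := by rw [hE, hw_single_left]; simp
    have hf : ∀ c, c + star c = 0 → B 0 c = hw (A E) (A E) * σ c := by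
      intro c hc
      obtain ⟨y, hy⟩ := H.exists_star_ne
      have hy0 : star y - y ≠ 0 := sub_ne_zero.2 hy
      set a := c / (star y - y) with ha
      have hsa : star a = a := by
        rw [ha, star_div₀, im_iff.1 hc, star_sub, star_star, ← neg_sub (star y) y, neg_div_neg_eq]
      have := D.f_comm H E ((a * y) • E)
      rw [hσ, hw_smul_left, hw_smul_right, hw_smul_left, hw_smul_right, hEE, star_mul', hsa] at this
      have e : a * star y * 1 - a * y * 1 = c := by rw [ha]; field_simp
      rw [e] at this
      rw [this, ← sig_star H, ← e, star_mul', hsa, map_sub, mul_one, mul_one]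
      ring
    have hκs : star (hw (A E) (A E)) = hw (A E) (A E) := star_hw _ _
    refine ⟨σ, hw (A E) (A E), hκs, ?_, hσ, hf, fun w w' => ?_⟩
    · obtain ⟨ε, h0, hε⟩ := H.exists_eps
      intro h
      apply D.f_ne H (im_iff.2 hε) h0
      rw [hf _ (im_iff.2 hε), h, zero_mul]
    · set κ := hw (A E) (A E)
      have hT : ∀ w w', hw (A w) (A w') - κ * σ (hw w w') = hw (A w') (A w) - κ * σ (hw w' w) := by
        intro w w'
        have h1 := D.f_comm H w w'
        rw [hf _ (by rw [star_sub, star_hw, star_hw]; ring), map_sub] at h1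
        linear_combination h1
      obtain ⟨y, hy⟩ := H.exists_star_ne
      have h1 := hT w w'
      have h2 := hT w (y • w')
      rw [hσ, hw_smul_right, hw_smul_right, hw_smul_left, hw_smul_left, map_mul, map_mul, sig_star H] at h2
      have h3 : (σ y - star (σ y)) * (hw (A w) (A w') - κ * σ (hw w w')) = 0 := by
        linear_combination h2 - star (σ y) * h1
      have h4 : σ y - star (σ y) ≠ 0 := by
        rw [← sig_star H, ← map_sub]
        intro h
        exact hy (sub_eq_zero.1 ((map_eq_zero σ).1 h)).symm
      exact sub_eq_zero.1 ((mul_eq_zero.1 h3).resolve_left h4)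
end Dat
end UV
set_option linter.all false

namespace UV
variable {F : Type*} [Field F] [Fintype F] [StarRing F] {p q r : ℕ}
variable {Q : Type*} [Group Q] {ρ₁ ρ₂ : SS F r →* Q}

theorem SemiIso.conj_tv {σ : F ≃+* F} {s : VV F r ≃+ VV F r} (h : SemiIso σ s) {u : VV F r} (hu : hh u u = 0) (c : F) :
    h.conj (tv u c) = tv (s u) (σ c) := by
  have hu' : hh (s u) (s u) = 0 := by rw [h.iso, hu, map_zero]
  ext1 v
  rw [h.conj_app, tv_app hu, tv_app hu', map_add, h.smul, s.apply_symm_apply, map_mul, ← h.iso, s.apply_symm_apply]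

theorem TT.conj (H : HF F p q) {σ : F ≃+* F} {s : VV F r ≃+ VV F r} (h : SemiIso σ s) {u : VV F r} (hu : hh u u = 0)
    {a : F} (ha : a ≠ 0) (hs : s u = a • u) (T : TT ρ₁ ρ₂ u) : TT (ρ₁.comp h.conjHom) ρ₂ u := by
  have hsa : star a ≠ 0 := by simpa using ha
  have e : ∀ c, h.conj (tv u c) = tv u (a * star a * σ c) := by
    intro c
    rw [h.conj_tv hu, hs, tv_smul hu]
  constructor
  · intro c hc
    obtain ⟨c', hc', hr⟩ := T.1 (a * star a * σ c) (by
      apply im_mul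
      · rw [← sig_star H, ← map_add, hc, map_zero]
      · rw [star_mul', star_star, mul_comm])
    exact ⟨c', hc', rel_conj h (by rw [e]; exact hr)⟩
  · intro c' hc'
    obtain ⟨c, hc, hr⟩ := T.2 c' hc'
    refine ⟨σ.symm ((a * star a)⁻¹ * c), ?_, rel_conj h (by
      rw [e, RingEquiv.apply_symm_apply, mul_inv_cancel_left₀ (mul_ne_zero ha hsa)]; exact hr)⟩
    rw [← sig_star H, ← map_add, im_mul hc, map_zero]
    rw [star_inv₀, star_mul', star_star, mul_comm]

namespace Dat
variable {A : (Fin r → F) → (Fin r → F)} {B : (Fin r → F) → F → F} {g : F → F}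

theorem S5 (H : HF F p q) (D : Dat ρ₁ ρ₂ A B g)
    (K : ∀ (ρ₁ : SS F r →* Q) B g, Dat ρ₁ ρ₂ id B g → (∀ c, c + star c = 0 → B 0 c = c) → Concl ρ₁ ρ₂) : Concl ρ₁ ρ₂ := by
  obtain ⟨σ, κ, hκ, hκ0, hA, hB, hhA⟩ := D.nform H
  obtain ⟨μ, hμ⟩ := H.norm_surj hκ
  have hμ0 : μ ≠ 0 := by rintro rfl; simp at hμ; exact hκ0 hμ.symm
  have hsμ0 : star μ ≠ 0 := by simpa using hμ0
  have hAbij : Function.Bijective A := Finite.injective_iff_bijective.1 (D.A_inj H)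
  let eA : (Fin r → F) ≃+ (Fin r → F) := AddEquiv.ofBijective (⟨⟨A, D.A_zero H⟩, D.A_add H⟩ : (Fin r → F) →+ (Fin r → F)) hAbij
  have heA : ∀ w, eA w = A w := fun w => rfl
  let s0 : VV F r →+ VV F r :=
    { toFun := fun v => (star μ * σ v.1, μ⁻¹ * σ v.2.1, μ⁻¹ • A v.2.2)
      map_zero' := by simp [D.A_zero H]
      map_add' := fun u v => by ext <;> simp [D.A_add H] <;> ring }
  have hs0 : Function.Injective s0 := by
    rw [injective_iff_map_eq_zero]
    intro v hv
    change (star μ * σ v.1, μ⁻¹ * σ v.2.1, μ⁻¹ • A v.2.2) = 0 at hv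
    simp only [Prod.mk_eq_zero, mul_eq_zero, inv_eq_zero, hμ0, hsμ0, false_or, smul_eq_zero, map_eq_zero] at hv
    obtain ⟨h1, h2, h3⟩ := hv
    have h4 : v.2.2 = 0 := D.A_inj H (by rw [h3, D.A_zero H])
    ext <;> simp [h1, h2, h4]
  let s : VV F r ≃+ VV F r := AddEquiv.ofBijective s0 (Finite.injective_iff_bijective.1 hs0)
  have hs : ∀ v, s v = (star μ * σ v.1, μ⁻¹ * σ v.2.1, μ⁻¹ • A v.2.2) := fun v => rfl
  have h : SemiIso σ s := by
    constructor
    · intro a v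
      rw [hs, hs]
      ext
      · simp; ring
      · simp; ring
      · simp [hA]; ring
    · intro u v
      rw [hs, hs]
      simp only [hh, hw_smul_left, hw_smul_right, hhA, map_add, map_mul, sig_star H, star_mul', star_star, star_inv₀]
      rw [← hμ]
      field_simp
  have hrr : ∀ w c, h.conj (rr w c) = rr (A w) (κ * σ c) := by
    intro w c
    ext1 v
    obtain ⟨v, rfl⟩ := s.surjective v
    rw [h.conj_app, s.symm_apply_apply, rr_app, rr_app, hs, hs]
    ext
    · simp only [map_sub, map_add, map_mul, hw_smul_right, hhA, ← hμ]
      field_simp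
    · rfl
    · simp [D.A_add H, hA]; ring
  have hse : s ee = (star μ) • ee := by rw [hs]; ext <;> simp [ee, D.A_zero H]
  have hsf : s ff = μ⁻¹ • ff := by rw [hs]; ext <;> simp [ff, D.A_zero H]
  refine Concl.of_conj h (K _ (fun w c => σ.symm (κ⁻¹ * B w c)) (fun b => σ.symm (κ * g b)) ⟨D.P.conj h, D.Te.conj H h hee hsμ0 hse, D.Tf.conj H h hff (inv_ne_zero hμ0) hsf, ?_, ?_⟩ ?_)
  · intro w c hc
    apply rel_conj h
    rw [hrr, RingEquiv.apply_symm_apply, mul_inv_cancel_left₀ hκ0]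
    exact D.relR w c hc
  · intro b hb
    obtain ⟨h1, h2⟩ := D.relT b hb
    refine ⟨by rw [← sig_star H, ← map_add, im_mul h1 hκ, map_zero], rel_conj h ?_⟩
    rw [h.conj_tv hff, hsf, tv_smul hff, RingEquiv.apply_symm_apply, star_inv₀, ← mul_inv, hμ, inv_mul_cancel_left₀ hκ0]
    exact h2
  · intro c hc
    beta_reduce
    rw [hB c hc, inv_mul_cancel_left₀ hκ0, RingEquiv.symm_apply_apply]

theorem S6 (H : HF F p q) (D : Dat ρ₁ ρ₂ id B g) (hB : ∀ c, c + star c = 0 → B 0 c = c) :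
    (∀ w c, c + star c + hw w w = 0 → Rel ρ₁ ρ₂ (rr w c) (rr w c)) ∧
    (∀ b, b + star b = 0 → Rel ρ₁ ρ₂ (tv ff b) (tv ff b)) := by
  have hg : ∀ b, b + star b = 0 → g b = b := by
    intro b hb
    by_cases h0 : b = 0
    · subst h0
      obtain ⟨h1, h2⟩ := D.relT 0 (by simp)
      have h3 : Rel ρ₁ ρ₂ (tv ff (0:F)) (tv ff 0) := by rw [tv_zero hff]; exact Rel.one
      obtain ⟨z, hz⟩ := D.P.uniq_left h2 h3
      have h4 := hz ee
      simp only [tv_ff_app] at h4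
      have h5 := congrArg Prod.fst h4
      have h6 := congrArg (fun v => v.2.1) h4
      simp [ee] at h5 h6
      rw [h6]
    · have := D.E H hb h0
      rw [hB _ (by
        rw [star_inv₀, im_iff.1 hb, inv_neg]; ring)] at this
      field_simp at this
      exact this
  refine ⟨?_, fun b hb => by have := (D.relT b hb).2; rwa [hg b hb] at this⟩
  obtain ⟨ε, h0, hε⟩ := H.exists_eps
  have hε' := im_iff.2 hε
  have key : ∀ w c, c + star c + hw w w = 0 → w ≠ 0 → 1 + ε * c ≠ 0 → B w c = c := by
    intro w c hc hw0 h1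
    obtain ⟨k1, k2⟩ := D.K H hc hε' h1
    rw [hg _ hε', id, id, smul_smul] at k2
    have : (1 : F) = (1 + ε * B w c) * (1 + ε * c)⁻¹ := smul_left_injective F hw0 (by beta_reduce; rw [← k2, one_smul])
    field_simp at this
    have : ε * c = ε * B w c := by linear_combination this
    exact (mul_left_cancel₀ h0 this).symm
  have hall : ∀ w c, c + star c + hw w w = 0 → B w c = c := by
    intro w c hc
    by_cases hw0 : w = 0
    · subst hw0
      exact hB c (by rwa [hw_zero_left, add_zero] at hc)
    by_cases h1 : 1 + ε * c = 0
    · have hcc : c = -ε⁻¹ := by field_simp; linear_combination h1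
      have hci : c + star c = 0 := by
        rw [hcc, star_neg, star_inv₀, hε, inv_neg]; ring
      have h2 : hw w w = 0 := by linear_combination hc - hci
      have h3 := D.B_add H (w := w) (c := 0) (d := c) (by simp [h2]) hci
      rw [key w 0 (by simp [h2]) hw0 (by simp), hB c hci] at h3
      simpa using h3
    · exact key w c hc hw0 h1
  intro w c hc
  have := D.relR w c hc
  rwa [hall w c hc] at this
end Dat

theorem S7a (H : HF F p q) (hR : ∀ w c, c + star c + hw w w = 0 → Rel ρ₁ ρ₂ (rr w c) (rr w c))
    (hT : ∀ b, b + star b = 0 → Rel ρ₁ ρ₂ (tv ff b) (tv ff b)) (v : VV F r) (hv : hh v v = 0) :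
    ∀ c, c + star c = 0 → Rel ρ₁ ρ₂ (tv v c) (tv v c) := by
  obtain ⟨ε, h0, hε⟩ := H.exists_eps
  have hε' := im_iff.2 hε
  have back : ∀ (g : GV F r) (v : VV F r), hh v v = 0 → Rel ρ₁ ρ₂ g g → (∀ c, c + star c = 0 → Rel ρ₁ ρ₂ (tv (g v) c) (tv (g v) c)) →
      ∀ c, c + star c = 0 → Rel ρ₁ ρ₂ (tv v c) (tv v c) := by
    intro g v hv hg h c hc
    have h1 := hg.inv.conj (h c hc)
    have e : tv v c = g⁻¹ * tv (g v) c * g⁻¹⁻¹ := by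
      rw [← tv_conj hv c hg.choose.1]; group
    rw [e]; exact h1
  have c1 : ∀ v : VV F r, hh v v = 0 → v.2.1 ≠ 0 → ∀ c, c + star c = 0 → Rel ρ₁ ρ₂ (tv v c) (tv v c) := by
    intro v hv hy c hc
    obtain ⟨x, y, z⟩ := v
    change y ≠ 0 at hy
    have hsy : star y ≠ 0 := by simpa using hy
    simp only [hh] at hv
    have hcond : x / y + star (x / y) + hw (y⁻¹ • z) (y⁻¹ • z) = 0 := by
      rw [hw_smul_left, hw_smul_right, star_div₀, star_inv₀]
      field_simp
      linear_combination hv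
    have e : ((x, y, z) : VV F r) = y • rr (y⁻¹ • z) (x / y) ff := by
      rw [rr_ff]; ext
      · simp; field_simp
      · simp
      · simp [hy]
    have hi := rr_iso hcond
    rw [e, tv_smul (by rw [hi, hff]), ← tv_conj hff _ hi]
    exact (hR _ _ hcond).conj (hT _ (im_mul hc (by rw [star_mul', star_star, mul_comm])))
  have c2 : ∀ v : VV F r, hh v v = 0 → v.1 ≠ 0 → ∀ c, c + star c = 0 → Rel ρ₁ ρ₂ (tv v c) (tv v c) := by
    intro v hv hx
    by_cases hy : v.2.1 = 0
    · refine back (tv ff ε) v hv (hT _ hε') (c1 _ (by rw [tv_iso hff hε', hv]) ?_)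
      rw [tv_ff_app]
      simp [hy, h0, hx]
    · exact c1 v hv hy
  by_cases hx : v.1 = 0
  swap
  · exact c2 v hv hx
  by_cases hy : v.2.1 = 0
  swap
  · exact c1 v hv hy
  by_cases hz : v.2.2 = 0
  · have : v = 0 := by ext <;> simp [hx, hy, hz]
    subst this
    intro c hc
    have : tv (0 : VV F r) c = 1 := by ext1 x; rw [tv_app hv]; simp [one_app]
    rw [this]; exact Rel.one
  · obtain ⟨w, hw0⟩ : ∃ w, hw w v.2.2 ≠ 0 := by
      by_contra! h
      apply hz
      apply hw_nondeg
      intro x; rw [← star_hw, h, star_zero]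
    obtain ⟨c, hc⟩ := exists_tr H w
    refine back (rr w c) v hv (hR w c hc) (c2 _ (by rw [rr_iso hc, hv]) ?_)
    rw [rr_app]
    simp [hx, hy, hw0]

theorem S7 [IsSimpleGroup Q] (H : HF F p q) (P : Pr ρ₁ ρ₂)
    (hT : ∀ v, hh v v = 0 → ∀ c, c + star c = 0 → Rel ρ₁ ρ₂ (tv v c) (tv v c)) : ρ₁ = ρ₂ := by
  let S : Set (SS F r) := {g | ∃ v c, hh v v = 0 ∧ c + star c = 0 ∧ g.1 = tv v c}
  let N : Subgroup (SS F r) := Subgroup.normalClosure S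
  have hS : S ⊆ (MonoidHom.eqLocus ρ₁ ρ₂ : Subgroup (SS F r)) := by
    rintro ⟨g, hg⟩ ⟨v, c, hv, hc, h⟩
    change g = _ at h
    subst h
    exact (hT v hv c hc).choose_spec.choose_spec
  have hconj : Group.conjugatesOfSet S ⊆ S := by
    intro g hg
    rw [Group.mem_conjugatesOfSet_iff] at hg
    obtain ⟨a, ⟨v, c, hv, hc, h⟩, hag⟩ := hg
    obtain ⟨k, rfl⟩ := isConj_iff.1 hag
    refine ⟨k.1 v, c, by rw [k.2.1, hv], hc, ?_⟩
    rw [← tv_conj hv c k.2.1, ← h]; rfl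
  have hN : N ≤ MonoidHom.eqLocus ρ₁ ρ₂ := by
    change Subgroup.closure _ ≤ _
    rw [Subgroup.closure_le]
    exact hconj.trans hS
  have hn : (N.map ρ₂).Normal := Subgroup.Normal.map inferInstance _ P.s2
  have htop : N.map ρ₂ = ⊤ := by
    rcases hn.eq_bot_or_eq_top with h | h
    · exfalso
      obtain ⟨ε, h0, hε⟩ := H.exists_eps
      have hε' := im_iff.2 hε
      have hm : (⟨tv ff ε, tv_mem H hff hε'⟩ : SS F r) ∈ N :=
        Subgroup.subset_normalClosure ⟨ff, ε, hff, hε', rfl⟩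
      have := Subgroup.mem_map_of_mem ρ₂ hm
      rw [h, Subgroup.mem_bot, P.k2] at this
      obtain ⟨z, hz⟩ := this
      have h1 := hz ee
      change tv ff ε ee = _ at h1
      rw [tv_ff_app] at h1
      have := congrArg (fun v => v.2.1) h1
      simp [ee] at this
      exact h0 this
    · exact h
  ext g
  have : ρ₂ g ∈ N.map ρ₂ := by rw [htop]; trivial
  obtain ⟨n, hnN, hn⟩ := this
  have h1 : ρ₁ n = ρ₂ n := hN hnN
  have h2 : ρ₂ (n⁻¹ * g) = 1 := by rw [map_mul, map_inv, hn]; group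
  rw [P.k2, ← P.k1, map_mul, map_inv, inv_mul_eq_one, h1, hn] at h2
  exact h2.symm

theorem main1 [Finite Q] [IsSimpleGroup Q] (H : HF F p q) (P : Pr ρ₁ ρ₂) : Concl ρ₁ ρ₂ := by
  refine S1 H P fun ρ₁ P Te => S2 H P Te fun ρ₁ P Te Tf => ?_
  obtain ⟨A, B, g, D⟩ := exists_dat H P Te Tf
  refine D.S5 H fun ρ₁ B g D hB => ?_
  obtain ⟨h1, h2⟩ := D.S6 H hB
  have := S7 H D.P (S7a H h1 h2)
  subst this
  refine ⟨RingEquiv.refl F, AddEquiv.refl _, ⟨fun a v => rfl, fun u v => rfl⟩, fun g g' h => ?_⟩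
  congr 1
  ext1
  apply LinearEquiv.ext
  exact h

end UV
set_option linter.all false

namespace UV
open Matrix
variable {F : Type*} [Field F] [Fintype F] [StarRing F] {p q r : ℕ}
variable {Q : Type*} [Group Q]

theorem exists_beta (H : HF F p q) (r : ℕ) :
    ∃ β : VV F r ≃ₗ[F] (Fin (r + 2) → F), ∀ u v, hw (β u) (β v) = hh u v := by
  obtain ⟨ζ, hζ⟩ := H.norm_surj (y := -1) (by simp)
  obtain ⟨c, hc, hc1⟩ := H.exists_norm_one_ne
  have h1 : 1 - c ≠ 0 := sub_ne_zero.2 (Ne.symm hc1)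
  set a := (1 - c)⁻¹ with ha
  have ha1 : a * (1 - c) = 1 := inv_mul_cancel₀ h1
  have ha2 : star a * (1 - star c) = 1 := by
    have := congrArg star ha1
    simpa [mul_comm] using this
  let b : VV F r →ₗ[F] (Fin (r + 2) → F) :=
    { toFun := fun v => Fin.cons (v.1 + a * v.2.1) (Fin.cons (ζ * v.1 + a * (c * ζ) * v.2.1) v.2.2)
      map_add' := fun u v => by
        ext i
        refine Fin.cases ?_ (fun i => ?_) i
        · simp; ring
        · refine Fin.cases ?_ (fun i => ?_) i
          · simp; ring
          · simp
      map_smul' := fun x v => by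
        ext i
        refine Fin.cases ?_ (fun i => ?_) i
        · simp; ring
        · refine Fin.cases ?_ (fun i => ?_) i
          · simp; ring
          · simp }
  have hb : ∀ v, b v = Fin.cons (v.1 + a * v.2.1) (Fin.cons (ζ * v.1 + a * (c * ζ) * v.2.1) v.2.2) := fun v => rfl
  have hiso : ∀ u v, hw (b u) (b v) = hh u v := by
    intro u v
    rw [hb, hb, hw, hh, Fin.sum_univ_succ, Fin.sum_univ_succ]
    simp only [Fin.cons_zero, Fin.cons_succ]
    rw [hw, ← add_assoc]
    congr 1
    simp only [star_add, star_mul']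
    linear_combination (star u.1 * v.1 + star u.1 * v.2.1 * a * c + star u.2.1 * v.1 * star a * star c + star u.2.1 * v.2.1 * a * star a * c * star c) * hζ
      + star u.1 * v.2.1 * ha1 + star u.2.1 * v.1 * ha2 + (- star u.2.1 * v.2.1 * a * star a) * hc
  have hinj : Function.Injective b := by
    rw [← LinearMap.ker_eq_bot, LinearMap.ker_eq_bot']
    intro v hv
    apply hh_nondeg
    intro x
    rw [← hiso, hv, hw_zero_left]
  refine ⟨LinearMap.linearEquivOfInjective b hinj (by simp; ring), fun u v => ?_⟩
  exact hiso u v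

theorem conjT_iff {n : ℕ} (M : Matrix (Fin n) (Fin n) F) : Mᴴ * M = 1 ↔ ∀ u v, hw (M *ᵥ u) (M *ᵥ v) = hw u v := by
  have e : ∀ u v : Fin n → F, hw u v = star u ⬝ᵥ v := fun u v => rfl
  have e2 : ∀ u v, hw (M *ᵥ u) (M *ᵥ v) = star u ⬝ᵥ ((Mᴴ * M) *ᵥ v) := by
    intro u v
    rw [e, star_mulVec, ← Matrix.mulVec_mulVec, Matrix.dotProduct_mulVec (star u) Mᴴ]
  constructor
  · intro h u v
    rw [e2, h, one_mulVec]; rfl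
  · intro h
    ext i j
    have := h (Pi.single i 1) (Pi.single j 1)
    rw [e2, e] at this
    have s1 : star (Pi.single i (1:F)) = (Pi.single i 1 : Fin n → F) := by
      ext k; by_cases hk : k = i
      · subst hk; simp
      · simp [Pi.single_eq_of_ne hk]
    rw [s1] at this
    simpa [Matrix.one_apply, Pi.single_apply, eq_comm] using this

variable {SU : Subgroup (SpecialLinearGroup (Fin (r + 2)) F)}

section
variable (hSU : ∀ A : SpecialLinearGroup (Fin (r + 2)) F, A ∈ SU ↔ (A : Matrix (Fin (r + 2)) (Fin (r + 2)) F)ᴴ * A = 1)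
  {β : VV F r ≃ₗ[F] (Fin (r + 2) → F)} (hβ : ∀ u v, hw (β u) (β v) = hh u v)

theorem exists_phi (hSU : ∀ A : SpecialLinearGroup (Fin (r + 2)) F, A ∈ SU ↔ (A : Matrix (Fin (r + 2)) (Fin (r + 2)) F)ᴴ * A = 1)
    (hβ : ∀ u v, hw (β u) (β v) = hh u v) :
    ∃ φ : SS F r →* SU, Function.Bijective φ ∧ ∀ g v, (φ g).1.1 *ᵥ (β v) = β (g.1 v) := by
  let f : GV F r → Matrix (Fin (r + 2)) (Fin (r + 2)) F := fun g => LinearMap.toMatrix' ((β : VV F r →ₗ[F] _) ∘ₗ (g : VV F r →ₗ[F] VV F r) ∘ₗ (β.symm : _ →ₗ[F] VV F r))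
  have hf : ∀ g v, f g *ᵥ v = β (g (β.symm v)) := by
    intro g v
    rw [← Matrix.toLin'_apply, Matrix.toLin'_toMatrix']; rfl
  have hmul : ∀ g h, f (g * h) = f g * f h := by
    intro g h
    simp only [f]
    rw [← LinearMap.toMatrix'_comp]
    congr 1
    apply LinearMap.ext
    intro v
    simp [mul_app]
  have hone : f 1 = 1 := by
    simp only [f]
    rw [← LinearMap.toMatrix'_id]
    congr 1
    apply LinearMap.ext
    intro v
    simp [one_app]
  have hdet : ∀ g : SS F r, (f g.1).det = 1 := by
    intro g
    simp only [f]
    rw [LinearMap.det_toMatrix', LinearMap.det_conj, ← LinearEquiv.coe_det, g.2.2]; rfl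
  have hmem : ∀ g : SS F r, (⟨f g.1, hdet g⟩ : SpecialLinearGroup (Fin (r + 2)) F) ∈ SU := by
    intro g
    refine (hSU _).2 ((conjT_iff _).2 ?_)
    intro u v
    simp only [hf, hβ, g.2.1]
    rw [← hβ]; simp
  let φ : SS F r →* SU :=
    { toFun := fun g => ⟨⟨f g.1, hdet g⟩, hmem g⟩
      map_one' := Subtype.ext (Subtype.ext hone)
      map_mul' := fun g h => Subtype.ext (Subtype.ext (hmul _ _)) }
  have hφ : ∀ g v, (φ g).1.1 *ᵥ (β v) = β (g.1 v) := by
    intro g v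
    change f g.1 *ᵥ _ = _
    rw [hf]; simp
  refine ⟨φ, ⟨?_, ?_⟩, hφ⟩
  · intro g h hgh
    ext1
    apply LinearEquiv.ext
    intro v
    apply β.injective
    rw [← hφ, ← hφ, hgh]
  · intro A
    let a : (Fin (r + 2) → F) ≃ₗ[F] (Fin (r + 2) → F) := SpecialLinearGroup.toLin' A.1
    have haa : ∀ v, a v = A.1.1 *ᵥ v := fun v => rfl
    let g : GV F r := (β.trans a).trans β.symm
    have hg : ∀ v, g v = β.symm (A.1.1 *ᵥ (β v)) := fun v => rfl
    have hgm : g ∈ SS F r := by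
      constructor
      · intro u v
        rw [← hβ, hg, hg, LinearEquiv.apply_symm_apply, LinearEquiv.apply_symm_apply, (conjT_iff _).1 ((hSU A.1).1 A.2), hβ]
      · ext
        rw [LinearEquiv.coe_det]
        have : (g : VV F r →ₗ[F] VV F r) = (β.symm : _ →ₗ[F] VV F r) ∘ₗ (Matrix.toLin' A.1.1) ∘ₗ ((β.symm.symm : VV F r ≃ₗ[F] _) : VV F r →ₗ[F] _) := by
          apply LinearMap.ext; intro v; rfl
        rw [this, LinearMap.det_conj, LinearMap.det_toLin', A.1.2]; rfl
    refine ⟨⟨g, hgm⟩, ?_⟩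
    refine Subtype.ext (Subtype.ext ?_)
    change f g = A.1.1
    apply Matrix.toLin'.injective
    apply LinearMap.ext
    intro v
    rw [Matrix.toLin'_apply, Matrix.toLin'_apply, hf, hg]; simp
end

theorem scal_of_central (H : HF F p q) {g : SS F r} (hg : ∀ h : SS F r, h * g = g * h) : IsScal g.1 := by
  obtain ⟨ε, h0, hε⟩ := H.exists_eps
  have hε' := im_iff.2 hε
  refine scal_of_lines H g.2.1 fun u hu => ?_
  by_cases hu0 : u = 0
  · subst hu0; exact ⟨1, by simp⟩
  have h1 := hg ⟨tv u ε, tv_mem H hu hε'⟩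
  have h2 : tv u ε * g.1 = g.1 * tv u ε := congrArg Subtype.val h1
  have h3 : tv (g.1 u) ε = tv u ε := by
    rw [← tv_conj hu ε g.2.1, ← h2]; group
  have hgu : hh (g.1 u) (g.1 u) = 0 := by rw [g.2.1, hu]
  obtain ⟨x, hx⟩ : ∃ x, hh (g.1 u) x ≠ 0 := by
    by_contra! h
    exact hu0 (g.1.map_eq_zero_iff.1 (hh_nondeg _ h))
  have h4 := LinearEquiv.congr_fun h3 x
  rw [tv_app hgu, tv_app hu] at h4
  have h5 := add_left_cancel h4
  refine ⟨(ε * hh (g.1 u) x)⁻¹ * (ε * hh u x), ?_⟩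
  rw [mul_smul, ← h5, smul_smul, inv_mul_cancel₀ (mul_ne_zero h0 hx), one_smul]

theorem center_iff (H : HF F p q)
    (hSU : ∀ A : SpecialLinearGroup (Fin (r + 2)) F, A ∈ SU ↔ (A : Matrix (Fin (r + 2)) (Fin (r + 2)) F)ᴴ * A = 1)
    (A : SU) : A ∈ Subgroup.center SU ↔ ∃ z : F, A.1.1 = z • (1 : Matrix (Fin (r + 2)) (Fin (r + 2)) F) := by
  obtain ⟨β, hβ⟩ := exists_beta H r
  obtain ⟨φ, hb, hφ⟩ := exists_phi hSU hβ
  rw [Subgroup.mem_center_iff]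
  constructor
  · intro h
    obtain ⟨g, rfl⟩ := hb.2 A
    obtain ⟨z, hz⟩ := scal_of_central H (g := g) (fun k => hb.1 (by rw [map_mul, map_mul]; exact h _))
    refine ⟨z, ?_⟩
    apply Matrix.toLin'.injective
    apply LinearMap.ext
    intro v
    obtain ⟨v, rfl⟩ := β.surjective v
    rw [Matrix.toLin'_apply, Matrix.toLin'_apply, hφ, hz, map_smul, Matrix.smul_mulVec, one_mulVec]
  · rintro ⟨z, hz⟩ g
    refine Subtype.ext (Subtype.ext ?_)
    change g.1.1 * A.1.1 = A.1.1 * g.1.1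
    rw [hz]; simp

theorem transfer [Finite Q] [IsSimpleGroup Q] (H : HF F p q)
    (hSU : ∀ A : SpecialLinearGroup (Fin (r + 2)) F, A ∈ SU ↔ (A : Matrix (Fin (r + 2)) (Fin (r + 2)) F)ᴴ * A = 1)
    (ρ₁ ρ₂ : SU →* Q) (s1 : Function.Surjective ρ₁) (s2 : Function.Surjective ρ₂)
    (k1 : ∀ g, ρ₁ g = 1 ↔ g ∈ Subgroup.center SU) (k2 : ∀ g, ρ₂ g = 1 ↔ g ∈ Subgroup.center SU) :
    ∃ (σ : F ≃+* F) (M : Matrix (Fin (r + 2)) (Fin (r + 2)) F), Mᴴ * M = 1 ∧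
      ∀ A A' : SU, A'.1.1 * M = M * A.1.1.map σ → ρ₁ A' = ρ₂ A := by
  obtain ⟨β, hβ⟩ := exists_beta H r
  obtain ⟨φ, hb, hφ⟩ := exists_phi hSU hβ
  have hk : ∀ g, φ g ∈ Subgroup.center SU ↔ IsScal g.1 := by
    intro g
    rw [Subgroup.mem_center_iff]
    constructor
    · intro h
      exact scal_of_central H (fun k => hb.1 (by rw [map_mul, map_mul]; exact h _))
    · rintro ⟨z, hz⟩ k
      obtain ⟨k, rfl⟩ := hb.2 k
      rw [← map_mul, ← map_mul]
      congr 1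
      ext1
      apply LinearEquiv.ext
      intro v
      change k.1 (g.1 v) = g.1 (k.1 v)
      rw [hz, hz, map_smul]
  have P : Pr (ρ₁.comp φ) (ρ₂.comp φ) :=
    ⟨s1.comp hb.2, s2.comp hb.2, fun g => by rw [MonoidHom.comp_apply, k1, hk],
      fun g => by rw [MonoidHom.comp_apply, k2, hk]⟩
  obtain ⟨σ, s, hs, hc⟩ := main1 H P
  let s' : (Fin (r + 2) → F) → (Fin (r + 2) → F) := fun v => β (s (β.symm v))
  have s'a : ∀ u v, s' (u + v) = s' u + s' v := by intro u v; simp [s']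
  have s'0 : s' 0 = 0 := by simp [s']
  have s's : ∀ a v, s' (a • v) = σ a • s' v := by intro u v; simp [s', hs.smul]
  have s'i : ∀ u v, hw (s' u) (s' v) = σ (hw u v) := by
    intro u v; simp only [s']; rw [hβ, hs.iso, ← hβ]; simp
  let M : Matrix (Fin (r + 2)) (Fin (r + 2)) F := Matrix.of fun i j => s' (Pi.single j 1) i
  have hM : ∀ v : Fin (r + 2) → F, M *ᵥ (fun i => σ (v i)) = s' v := by
    intro v
    let s'' : (Fin (r + 2) → F) →+ (Fin (r + 2) → F) := ⟨⟨s', s'0⟩, s'a⟩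
    have := map_sum s'' (fun i => (Pi.single i (v i) : Fin (r + 2) → F)) Finset.univ
    rw [Finset.univ_sum_single] at this
    change s' v = ∑ i, s' (Pi.single i (v i)) at this
    rw [this]
    ext i
    rw [Finset.sum_apply, Matrix.mulVec, dotProduct]
    refine Finset.sum_congr rfl fun j _ => ?_
    have e : (Pi.single j (v j) : Fin (r + 2) → F) = v j • Pi.single j 1 := by rw [← Pi.single_smul]; simp
    rw [e, s's]
    simp [M, mul_comm]
  refine ⟨σ, M, ?_, fun A A' h => ?_⟩
  · rw [conjT_iff]
    intro u v
    have e : ∀ u : Fin (r + 2) → F, u = fun i => σ (σ.symm (u i)) := by intro u; ext i; simp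
    rw [e u, e v, hM, hM, s'i]
    simp only [hw, map_sum, map_mul, sig_star H]
  · obtain ⟨g, rfl⟩ := hb.2 A
    obtain ⟨g', rfl⟩ := hb.2 A'
    apply hc
    intro v
    apply β.injective
    rw [← hφ]
    have e1 : β (s v) = s' (β v) := by simp [s']
    have e2 : β (s (g.1 v)) = s' (β (g.1 v)) := by simp [s']
    rw [e1, e2, ← hM, ← hM, Matrix.mulVec_mulVec, h, ← Matrix.mulVec_mulVec]
    congr 1
    rw [← hφ]
    ext i
    simp [Matrix.mulVec, dotProduct, map_sum]

end UV
set_option linter.all false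

namespace UV
open Matrix
variable {F : Type*} [Field F] [Fintype F] [StarRing F] {p q r : ℕ}

theorem twist_lines (H : HF F p q) {X : GV F r} (hX : ∀ u v, hh (X u) (X v) = hh u v)
    (h : ∀ g : SS F r, ∃ z : F, ∀ v, X (g.1 v) = z • g.1 (X v)) : IsScal X := by
  obtain ⟨ε, h0, hε⟩ := H.exists_eps
  have hε' := im_iff.2 hε
  refine scal_of_lines H hX fun u hu => ?_
  by_cases hu0 : u = 0
  · subst hu0; exact ⟨1, by simp⟩
  obtain ⟨z, hz⟩ := h ⟨tv u ε, tv_mem H hu hε'⟩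
  simp only [tv_app hu] at hz
  by_cases hz1 : z = 1
  · subst hz1
    have hgu : hh (X u) (X u) = 0 := by rw [hX, hu]
    obtain ⟨x, hx⟩ : ∃ x, hh u x ≠ 0 := by
      by_contra! h
      exact hu0 (hh_nondeg _ h)
    have h4 := hz x
    rw [one_smul, map_add, map_smul] at h4
    have h5 := add_left_cancel h4
    refine ⟨(ε * hh u x)⁻¹ * (ε * hh u (X x)), ?_⟩
    rw [mul_smul, ← h5, smul_smul, inv_mul_cancel₀ (mul_ne_zero h0 hx), one_smul]
  · have h4 := hz u
    rw [hu, mul_zero, zero_smul, add_zero, smul_add, smul_smul] at h4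
    refine ⟨(1 - z)⁻¹ * (z * (ε * hh u (X u))), ?_⟩
    have h1 : 1 - z ≠ 0 := sub_ne_zero.2 (Ne.symm hz1)
    have h5 : (1 - z) • X u = (z * (ε * hh u (X u))) • u := by
      rw [sub_smul, one_smul, sub_eq_iff_eq_add, add_comm]; exact h4
    rw [mul_smul, ← h5, smul_smul, inv_mul_cancel₀ h1, one_smul]

variable {SU : Subgroup (SpecialLinearGroup (Fin (r + 2)) F)}

theorem twist_scal (H : HF F p q)
    (hSU : ∀ A : SpecialLinearGroup (Fin (r + 2)) F, A ∈ SU ↔ (A : Matrix (Fin (r + 2)) (Fin (r + 2)) F)ᴴ * A = 1)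
    {T : Matrix (Fin (r + 2)) (Fin (r + 2)) F} (hT : Tᴴ * T = 1)
    (h : ∀ A : SU, ∃ z : F, T * A.1.1 = z • (A.1.1 * T)) : ∃ z : F, z * star z = 1 ∧ T = z • 1 := by
  obtain ⟨β, hβ⟩ := exists_beta H r
  obtain ⟨φ, hb, hφ⟩ := exists_phi hSU hβ
  let t : (Fin (r + 2) → F) ≃ₗ[F] (Fin (r + 2) → F) := LinearEquiv.ofLinear (Matrix.toLin' T) (Matrix.toLin' Tᴴ)
    (by rw [← Matrix.toLin'_mul, mul_eq_one_comm.1 hT, Matrix.toLin'_one]) (by rw [← Matrix.toLin'_mul, hT, Matrix.toLin'_one])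
  have ht : ∀ v, t v = T *ᵥ v := fun v => Matrix.toLin'_apply T v
  let X : GV F r := (β.trans t).trans β.symm
  have hX : ∀ v, X v = β.symm (T *ᵥ (β v)) := fun v => congrArg β.symm (ht _)
  have hiso : ∀ u v, hh (X u) (X v) = hh u v := by
    intro u v
    rw [← hβ, hX, hX, LinearEquiv.apply_symm_apply, LinearEquiv.apply_symm_apply, (conjT_iff _).1 hT, hβ]
  obtain ⟨z, hz⟩ := twist_lines H hiso (fun g => by
    obtain ⟨z, hz⟩ := h (φ g)
    refine ⟨z, fun v => ?_⟩
    apply β.injective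
    rw [map_smul, ← hφ, hX, hX, LinearEquiv.apply_symm_apply, LinearEquiv.apply_symm_apply, ← hφ,
      Matrix.mulVec_mulVec, Matrix.mulVec_mulVec, hz, Matrix.smul_mulVec])
  have hTz : T = z • 1 := by
    apply Matrix.toLin'.injective
    apply LinearMap.ext
    intro v
    obtain ⟨v, rfl⟩ := β.surjective v
    have := congrArg β (hz v)
    rw [hX, LinearEquiv.apply_symm_apply, map_smul] at this
    rw [Matrix.toLin'_apply, Matrix.toLin'_apply, this, Matrix.smul_mulVec, one_mulVec]
  refine ⟨z, ?_, hTz⟩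
  rw [hTz] at hT
  have := congrFun (congrFun hT 0) 0
  simpa [Matrix.conjTranspose_smul, mul_comm] using this

variable {G : Type*} [Group G]

structure Imp (ι : SU →* G) (g : G) (M : Matrix (Fin (r + 2)) (Fin (r + 2)) F) (σ : F ≃+* F) : Prop where
  u : Mᴴ * M = 1
  im : ∀ A A' : SU, A'.1.1 * M = M * A.1.1.map σ → g * ι A * g⁻¹ = ι A'

theorem map_conjT (H : HF F p q) {n : ℕ} (M : Matrix (Fin n) (Fin n) F) (σ : F ≃+* F) : (M.map σ)ᴴ = (Mᴴ).map σ := by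
  ext i j
  simp [sig_star H]

theorem map_u (H : HF F p q) {n : ℕ} {M : Matrix (Fin n) (Fin n) F} (hM : Mᴴ * M = 1) (σ : F ≃+* F) : (M.map σ)ᴴ * M.map σ = 1 := by
  rw [map_conjT H, ← Matrix.map_mul, hM]
  simp [Matrix.map_one]

theorem mul_u {n : ℕ} {M N : Matrix (Fin n) (Fin n) F} (hM : Mᴴ * M = 1) (hN : Nᴴ * N = 1) : (M * N)ᴴ * (M * N) = 1 := by
  rw [conjTranspose_mul, Matrix.mul_assoc, ← Matrix.mul_assoc Mᴴ, hM, Matrix.one_mul, hN]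

theorem conjT_u {n : ℕ} {M : Matrix (Fin n) (Fin n) F} (hM : Mᴴ * M = 1) : (Mᴴ)ᴴ * Mᴴ = 1 := by
  rw [conjTranspose_conjTranspose]; exact mul_eq_one_comm.1 hM

theorem det_u {n : ℕ} {M : Matrix (Fin n) (Fin n) F} (hM : Mᴴ * M = 1) : M.det * star M.det = 1 := by
  have := congrArg det hM
  rw [det_mul, det_conjTranspose, det_one] at this
  rw [mul_comm]; exact this

theorem det_map' {n : ℕ} (M : Matrix (Fin n) (Fin n) F) (σ : F ≃+* F) : (M.map σ).det = σ M.det :=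
  (RingEquiv.map_det σ M).symm

variable {ι : SU →* G}

theorem mkSU (H : HF F p q)
    (hSU : ∀ A : SpecialLinearGroup (Fin (r + 2)) F, A ∈ SU ↔ (A : Matrix (Fin (r + 2)) (Fin (r + 2)) F)ᴴ * A = 1)
    {M : Matrix (Fin (r + 2)) (Fin (r + 2)) F} (hM : Mᴴ * M = 1) (hd : M.det = 1) : ∃ A : SU, A.1.1 = M :=
  ⟨⟨⟨M, hd⟩, (hSU _).2 hM⟩, rfl⟩

theorem exA (H : HF F p q)
    (hSU : ∀ A : SpecialLinearGroup (Fin (r + 2)) F, A ∈ SU ↔ (A : Matrix (Fin (r + 2)) (Fin (r + 2)) F)ᴴ * A = 1)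
    {M : Matrix (Fin (r + 2)) (Fin (r + 2)) F} (hM : Mᴴ * M = 1) (σ : F ≃+* F) (A : SU) :
    ∃ A' : SU, A'.1.1 = M * A.1.1.map σ * Mᴴ := by
  have hA := (hSU A.1).1 A.2
  refine mkSU H hSU (mul_u (mul_u hM (map_u H hA σ)) (conjT_u hM)) ?_
  rw [det_mul, det_mul, det_conjTranspose, det_map', A.1.2, map_one, mul_one, det_u hM]

theorem exA1 (H : HF F p q)
    (hSU : ∀ A : SpecialLinearGroup (Fin (r + 2)) F, A ∈ SU ↔ (A : Matrix (Fin (r + 2)) (Fin (r + 2)) F)ᴴ * A = 1)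
    {M : Matrix (Fin (r + 2)) (Fin (r + 2)) F} (hM : Mᴴ * M = 1) (σ : F ≃+* F) (A : SU) :
    ∃ A' : SU, A'.1.1 * M = M * A.1.1.map σ := by
  obtain ⟨A', h⟩ := exA H hSU hM σ A
  exact ⟨A', by rw [h, Matrix.mul_assoc, hM, Matrix.mul_one]⟩

theorem Imp.mul (H : HF F p q)
    (hSU : ∀ A : SpecialLinearGroup (Fin (r + 2)) F, A ∈ SU ↔ (A : Matrix (Fin (r + 2)) (Fin (r + 2)) F)ᴴ * A = 1)
    {g g' : G} {M M' : Matrix (Fin (r + 2)) (Fin (r + 2)) F} {σ σ' : F ≃+* F}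
    (h : Imp ι g M σ) (h' : Imp ι g' M' σ') : Imp ι (g * g') (M * M'.map σ) (σ'.trans σ) := by
  refine ⟨mul_u h.u (map_u H h'.u σ), fun A A'' hA => ?_⟩
  obtain ⟨A', hA'⟩ := exA1 H hSU h'.u σ' A
  have e : (A.1.1.map (σ'.trans σ)) = (A.1.1.map σ').map σ := by ext; rfl
  rw [e] at hA
  have h1 : A''.1.1 * M = M * A'.1.1.map σ := by
    have h2 := map_u H h'.u σ
    have h3 := mul_eq_one_comm.1 h2
    have h4 : A''.1.1 * M * M'.map σ = M * A'.1.1.map σ * M'.map σ := by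
      rw [Matrix.mul_assoc, hA, Matrix.mul_assoc, Matrix.mul_assoc, ← Matrix.map_mul, ← Matrix.map_mul, hA']
    have h5 := congrArg (· * (M'.map σ)ᴴ) h4
    simpa only [Matrix.mul_assoc, h3, Matrix.mul_one] using h5
  rw [← h.im A' A'' h1, ← h'.im A A' hA']
  group

theorem Imp.inv (H : HF F p q)
    (hSU : ∀ A : SpecialLinearGroup (Fin (r + 2)) F, A ∈ SU ↔ (A : Matrix (Fin (r + 2)) (Fin (r + 2)) F)ᴴ * A = 1)
    {g : G} {M : Matrix (Fin (r + 2)) (Fin (r + 2)) F} {σ : F ≃+* F}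
    (h : Imp ι g M σ) : Imp ι g⁻¹ ((Mᴴ).map σ.symm) σ.symm := by
  refine ⟨map_u H (conjT_u h.u) _, fun A' A hA => ?_⟩
  have h1 : A'.1.1 * M = M * A.1.1.map σ := by
    have := congrArg (fun N => N.map σ) hA
    have e : ∀ N : Matrix (Fin (r + 2)) (Fin (r + 2)) F, (N.map σ.symm).map σ = N := by intro N; ext; simp
    simp only [Matrix.map_mul, e] at this
    have h3 := mul_eq_one_comm.1 h.u
    calc A'.1.1 * M = M * (Mᴴ * A'.1.1) * M := by rw [← Matrix.mul_assoc M, h3, Matrix.one_mul]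
      _ = M * A.1.1.map σ := by rw [← this, Matrix.mul_assoc, Matrix.mul_assoc, h.u, Matrix.mul_one]
  rw [← h.im A A' h1]
  group

theorem Imp.iota (H : HF F p q)
    (hSU : ∀ A : SpecialLinearGroup (Fin (r + 2)) F, A ∈ SU ↔ (A : Matrix (Fin (r + 2)) (Fin (r + 2)) F)ᴴ * A = 1)
    (B : SU) : Imp ι (ι B) B.1.1 (RingEquiv.refl F) := by
  refine ⟨(hSU _).1 B.2, fun A A' hA => ?_⟩
  have : A' * B = B * A := by
    refine Subtype.ext (Subtype.ext ?_)
    simpa using hA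
  rw [← map_mul, ← this, map_mul]; group

theorem Imp.one (H : HF F p q)
    (hSU : ∀ A : SpecialLinearGroup (Fin (r + 2)) F, A ∈ SU ↔ (A : Matrix (Fin (r + 2)) (Fin (r + 2)) F)ᴴ * A = 1)
    : Imp ι 1 1 (RingEquiv.refl F) := by
  have := Imp.iota H hSU (ι := ι) 1
  simpa using this

theorem Imp.smul (H : HF F p q)
    (hSU : ∀ A : SpecialLinearGroup (Fin (r + 2)) F, A ∈ SU ↔ (A : Matrix (Fin (r + 2)) (Fin (r + 2)) F)ᴴ * A = 1)
    {g : G} {M : Matrix (Fin (r + 2)) (Fin (r + 2)) F} {σ : F ≃+* F}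
    (h : Imp ι g M σ) {c : F} (hc : c * star c = 1) : Imp ι g (c • M) σ := by
  refine ⟨?_, fun A A' hA => h.im A A' ?_⟩
  · rw [conjTranspose_smul, smul_mul_smul_comm, h.u, mul_comm, hc, one_smul]
  · have h0 : c ≠ 0 := by rintro rfl; simp at hc
    rw [Matrix.mul_smul, Matrix.smul_mul] at hA
    exact smul_right_injective _ h0 hA

theorem Imp.uniq (H : HF F p q)
    (hSU : ∀ A : SpecialLinearGroup (Fin (r + 2)) F, A ∈ SU ↔ (A : Matrix (Fin (r + 2)) (Fin (r + 2)) F)ᴴ * A = 1)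
    {g g' : G} {M : Matrix (Fin (r + 2)) (Fin (r + 2)) F} {σ : F ≃+* F}
    (hcent : ∀ g : G, (∀ A, g * ι A = ι A * g) → g = 1)
    (h : Imp ι g M σ) (h' : Imp ι g' M σ) : g = g' := by
  have : g'⁻¹ * g = 1 := by
    apply hcent
    intro A
    obtain ⟨A', hA⟩ := exA1 H hSU h.u σ A
    have e := (h.im A A' hA).trans (h'.im A A' hA).symm
    calc g'⁻¹ * g * ι A = g'⁻¹ * (g * ι A * g⁻¹) * g := by group
      _ = _ := by rw [e]; group
  rw [inv_mul_eq_one] at this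
  exact this.symm

theorem Imp.adj (H : HF F p q)
    (hSU : ∀ A : SpecialLinearGroup (Fin (r + 2)) F, A ∈ SU ↔ (A : Matrix (Fin (r + 2)) (Fin (r + 2)) F)ᴴ * A = 1)
    {g : G} {M M' : Matrix (Fin (r + 2)) (Fin (r + 2)) F} {σ : F ≃+* F}
    (h : Imp ι g M σ) (hM : M'ᴴ * M' = 1) (hd : M'.det = M.det) : ∃ g', Imp ι g' M' σ := by
  obtain ⟨B, hB⟩ := mkSU H hSU (mul_u hM (conjT_u h.u)) (by rw [det_mul, hd, det_conjTranspose, det_u h.u])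
  refine ⟨ι B * g, ?_⟩
  have := (Imp.iota H hSU (ι := ι) B).mul H hSU h
  have e : B.1.1 * M.map (RingEquiv.refl F) = M' := by
    rw [hB]
    change M' * Mᴴ * M = M'
    rw [Matrix.mul_assoc, h.u, Matrix.mul_one]
  rw [e] at this
  exact this

theorem Imp.scal (H : HF F p q)
    (hSU : ∀ A : SpecialLinearGroup (Fin (r + 2)) F, A ∈ SU ↔ (A : Matrix (Fin (r + 2)) (Fin (r + 2)) F)ᴴ * A = 1)
    (hk : ∀ A, ι A = 1 → A ∈ Subgroup.center SU) {g : G} {M M' : Matrix (Fin (r + 2)) (Fin (r + 2)) F} {σ : F ≃+* F}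
    (h : Imp ι g M σ) (h' : Imp ι g M' σ) : ∃ z : F, z * star z = 1 ∧ M' = z • M := by
  obtain ⟨z, hz, hT⟩ := twist_scal H hSU (mul_u (conjT_u h.u) h'.u) (fun B => by
    obtain ⟨A, hA⟩ := exA H hSU (M := 1) (by simp) σ.symm B
    have hAB : A.1.1.map σ = B.1.1 := by rw [hA]; ext; simp
    obtain ⟨A1, hA1⟩ := exA1 H hSU h.u σ A
    obtain ⟨A2, hA2⟩ := exA1 H hSU h'.u σ A
    have e := (h.im A A1 hA1).symm.trans (h'.im A A2 hA2)
    have e2 := hk (A1⁻¹ * A2) (by rw [map_mul, map_inv, e]; group)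
    obtain ⟨z, hz⟩ := (center_iff H hSU _).1 e2
    have e3 : A2.1.1 = z • A1.1.1 := by
      have : A2 = A1 * (A1⁻¹ * A2) := by group
      rw [this]
      change A1.1.1 * (A1⁻¹ * A2).1.1 = _
      rw [hz]; simp
    refine ⟨z, ?_⟩
    rw [hAB] at hA1 hA2
    have h3 := mul_eq_one_comm.1 h.u
    calc Mᴴ * M' * B.1.1 = Mᴴ * (A2.1.1 * M') := by rw [hA2, Matrix.mul_assoc]
      _ = z • (Mᴴ * (A1.1.1 * (M * Mᴴ) * M')) := by rw [e3, h3]; simp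
      _ = z • (Mᴴ * (A1.1.1 * M) * Mᴴ * M') := by simp only [Matrix.mul_assoc]
      _ = z • ((Mᴴ * M) * B.1.1 * Mᴴ * M') := by rw [hA1]; simp only [Matrix.mul_assoc]
      _ = _ := by rw [h.u, Matrix.one_mul, Matrix.mul_assoc])
  refine ⟨z, hz, ?_⟩
  have h3 := mul_eq_one_comm.1 h.u
  have := congrArg (M * ·) hT
  simpa only [← Matrix.mul_assoc, h3, Matrix.one_mul, Matrix.mul_smul, Matrix.mul_one] using this

end UV
set_option linter.all false

namespace UV
open Matrix

section detsurj
open Polynomial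

theorem det_aeval_closed {E : Type*} [Field E] [IsAlgClosed E] {m : Type*} [Fintype m] [DecidableEq m]
    (M : Matrix m m E) (f : E[X]) :
    (aeval M f).det = (M.charpoly.roots.map (fun t => f.eval t)).prod := by
  have hsp := (IsAlgClosed.splits M.charpoly)
  have hcard : Multiset.card M.charpoly.roots = Fintype.card m := by
    rw [← hsp.natDegree_eq_card_roots, Matrix.charpoly_natDegree_eq_dim]
  let φ : E[X] →* E := (Matrix.detMonoidHom).comp ((aeval M : E[X] →ₐ[E] Matrix m m E) : E[X] →* Matrix m m E)
  let ψ : E[X] →* E :=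
    { toFun := fun f => (M.charpoly.roots.map (fun t => f.eval t)).prod
      map_one' := by simp
      map_mul' := fun f g => by simp [Multiset.prod_map_mul] }
  change φ f = ψ f
  have hC : ∀ c : E, φ (C c) = ψ (C c) := by
    intro c
    change (aeval M (C c)).det = (M.charpoly.roots.map (fun t => (C c).eval t)).prod
    simp [hcard, Algebra.algebraMap_eq_smul_one, Matrix.det_smul]
  have hX : ∀ c : E, φ (X - C c) = ψ (X - C c) := by
    intro c
    change (aeval M (X - C c)).det = (M.charpoly.roots.map (fun t => (X - C c).eval t)).prod
    have h1 : aeval M (X - C c) = -(Matrix.scalar m c - M) := by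
      simp [Algebra.algebraMap_eq_smul_one, ← Matrix.smul_one_eq_diagonal]
    rw [h1, Matrix.det_neg, ← Matrix.eval_charpoly]
    conv_lhs => rw [hsp.eq_prod_roots]
    rw [Matrix.charpoly_monic M |>.leadingCoeff, ← hcard, C_1, one_mul, eval_multiset_prod, Multiset.map_map]
    have := Multiset.prod_map_neg (M.charpoly.roots.map (fun t => c - t))
    rw [Multiset.card_map, Multiset.map_map] at this
    simpa [Function.comp_def] using this.symm
  rw [(IsAlgClosed.splits f).eq_prod_roots, map_mul, map_mul, hC, map_multiset_prod, map_multiset_prod,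
    Multiset.map_map, Multiset.map_map]
  congr 3
  ext c
  exact hX c

theorem det_aeval {K : Type*} [Field K] (E : Type*) [Field E] [IsAlgClosed E] [Algebra K E] {m : Type*} [Fintype m] [DecidableEq m]
    (M : Matrix m m K) (f : K[X]) :
    algebraMap K E (aeval M f).det = ((M.charpoly.map (algebraMap K E)).roots.map (fun t => aeval t f)).prod := by
  have h := det_aeval_closed (M.map (algebraMap K E)) (f.map (algebraMap K E))
  rw [Matrix.charpoly_map] at h
  simp only [eval_map_algebraMap] at h
  rw [← h, RingHom.map_det]
  congr 1
  refine Polynomial.map_aeval_eq_aeval_map (φ := algebraMap K E) (ψ := (algebraMap K E).mapMatrix) ?_ f M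
  ext c i j
  by_cases hij : i = j
  · subst hij; simp [Matrix.algebraMap_eq_diagonal]
  · simp [Matrix.algebraMap_eq_diagonal, hij]

theorem norm_irred {K : Type*} [Field K] [Finite K] (E : Type*) [Field E] [IsAlgClosed E] [Algebra K E] {g : K[X]}
    (hg : g.Monic) (hi : Irreducible g) (y : K) :
    ∃ u : K[X], algebraMap K E y = ((g.map (algebraMap K E)).roots.map (fun t => aeval t u)).prod := by
  have := Fact.mk hi
  let pb := AdjoinRoot.powerBasis hg.ne_zero
  have : Module.Finite K (AdjoinRoot g) := pb.finite
  have : Finite (AdjoinRoot g) := Module.finite_of_finite K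
  obtain ⟨z, hz⟩ := FiniteField.norm_surjective K (AdjoinRoot g) y
  obtain ⟨u, rfl⟩ := AdjoinRoot.mk_surjective z
  refine ⟨u, ?_⟩
  have h1 := det_aeval E (Algebra.leftMulMatrix pb.basis pb.gen) u
  rw [charpoly_leftMulMatrix, AdjoinRoot.minpoly_powerBasis_gen_of_monic hg] at h1
  rw [← h1, ← hz, Algebra.norm_eq_matrix_det pb.basis]
  congr 2
  rw [Polynomial.aeval_algHom_apply]
  congr 1
  rw [AdjoinRoot.powerBasis_gen, AdjoinRoot.aeval_eq]

theorem det_surj {K : Type*} [Field K] [Finite K] {p n : ℕ} [Fact p.Prime] [CharP K p] (hn : n ≠ 0)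
    (x : Matrix (Fin n) (Fin n) K) {a : K} (ha : a ≠ 0) (hx : x.charpoly = X ^ n - C a) (y : K) :
    ∃ f : K[X], (aeval x f).det = y := by
  obtain ⟨e, n', hn', rfl⟩ := Nat.exists_eq_pow_mul_and_not_dvd hn p (Fact.out : p.Prime).ne_one
  have hsurj : ∀ b : K, ∃ b' : K, b' ^ (p ^ e) = b := by
    intro b
    have : Function.Injective (fun b : K => b ^ (p ^ e)) := fun b c h => iterateFrobenius_inj K p e h
    exact (Finite.surjective_of_injective this) b
  obtain ⟨a', rfl⟩ := hsurj a
  obtain ⟨y', rfl⟩ := hsurj y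
  have hn0 : n' ≠ 0 := by rintro rfl; simp at hn'
  have ha0 : a' ≠ 0 := by rintro rfl; apply ha; simp [(Fact.out : p.Prime).ne_zero]
  have hsep : (X ^ n' - C a').Separable := separable_X_pow_sub_C a' (by rwa [Ne, CharP.cast_eq_zero_iff K p]) ha0
  obtain ⟨g, hg, hi, h, hh⟩ := exists_monic_irreducible_factor (X ^ n' - C a') (by
    intro hu
    have := natDegree_eq_zero_of_isUnit hu
    rw [natDegree_X_pow_sub_C] at this
    exact hn0 this)
  have hQ : (X ^ n' - C a').Monic := monic_X_pow_sub_C a' hn0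
  obtain ⟨s, t, hst⟩ := (hh ▸ hsep).isCoprime
  obtain ⟨u, hu⟩ := norm_irred (AlgebraicClosure K) hg hi y'
  refine ⟨u * (t * h) + s * g, ?_⟩
  apply (algebraMap K (AlgebraicClosure K)).injective
  have e1 : x.charpoly = (g * h) ^ (p ^ e) := by
    rw [hx, ← hh, sub_pow_char_pow, ← pow_mul, mul_comm n', C_pow]
  have hst' : ∀ θ : AlgebraicClosure K, aeval θ s * aeval θ g + aeval θ t * aeval θ h = 1 := by
    intro θ
    have := congrArg (aeval θ) hst
    simpa using this
  have hgh : g * h ≠ 0 := hh ▸ hQ.ne_zero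
  rw [det_aeval (AlgebraicClosure K), e1, Polynomial.map_pow, roots_pow, Multiset.map_nsmul, Multiset.prod_nsmul,
    Polynomial.map_mul, roots_mul (by rw [← Polynomial.map_mul]; exact (Polynomial.map_ne_zero_iff (algebraMap K _).injective).2 hgh),
    Multiset.map_add, Multiset.prod_add, map_pow, hu]
  congr 1
  have e2 : (Multiset.map (fun θ => aeval θ (u * (t * h) + s * g)) (h.map (algebraMap K (AlgebraicClosure K))).roots).prod = 1 := by
    apply Multiset.prod_eq_one
    intro z hz
    rw [Multiset.mem_map] at hz
    obtain ⟨θ, hθ, rfl⟩ := hz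
    have h0 : aeval θ h = 0 := by
      have := (mem_roots'.1 hθ).2
      rwa [IsRoot.def, eval_map_algebraMap] at this
    have := hst' θ
    rw [h0] at this
    simpa [h0] using this
  rw [e2, mul_one]
  congr 1
  apply Multiset.map_congr rfl
  intro θ hθ
  have h0 : aeval θ g = 0 := by
    have := (mem_roots'.1 hθ).2
    rwa [IsRoot.def, eval_map_algebraMap] at this
  have := hst' θ
  rw [h0, mul_zero, zero_add] at this
  simp [h0, this]

end detsurj
end UV
set_option linter.all false

namespace UV
open Matrix
variable {F : Type*} [Field F] [Fintype F] [StarRing F] {p q r : ℕ}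

def xw (r : ℕ) (a : F) (i : Fin (r + 2)) : F := if i = 0 then a else 1

def xm (r : ℕ) (a : F) : Matrix (Fin (r + 2)) (Fin (r + 2)) F :=
  Matrix.of fun i j => if i = j + 1 then xw r a i else 0

theorem xm_apply (a : F) (i j : Fin (r + 2)) : xm r a i j = if i = j + 1 then xw r a i else 0 := rfl

theorem xm_u {a : F} (ha : a * star a = 1) : (xm r a)ᴴ * xm r a = 1 := by
  have hw : ∀ i, star (xw r a i) * xw r a i = 1 := by
    intro i
    unfold xw
    split_ifs
    · rw [mul_comm, ha]
    · simp
  ext j k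
  rw [Matrix.mul_apply]
  simp only [conjTranspose_apply, xm_apply]
  rw [Finset.sum_eq_single (j + 1)]
  · by_cases h : j = k
    · subst h; simp [hw]
    · have : ¬ (j + 1 = k + 1) := fun h' => h (add_right_cancel h')
      simp [h]
  · intro i _ hi
    simp [hi]
  · simp

theorem xm_mulVec (a : F) (j : Fin (r + 2)) : xm r a *ᵥ Pi.single j 1 = Pi.single (j + 1) (xw r a (j + 1)) := by
  ext i
  rw [Matrix.mulVec_single_one]
  change xm r a i j = _
  rw [xm_apply]
  by_cases h : i = j + 1
  · subst h; simp
  · simp [h]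

theorem xm_pow (a : F) (k : ℕ) (hk : k < r + 2) : (xm r a ^ k) *ᵥ Pi.single 0 1 = Pi.single ⟨k, hk⟩ 1 := by
  induction k with
  | zero => rw [pow_zero, one_mulVec]; rfl
  | succ k ih =>
    rw [pow_succ', ← Matrix.mulVec_mulVec, ih (by omega), xm_mulVec]
    have e : (⟨k, by omega⟩ : Fin (r + 2)) + 1 = ⟨k + 1, hk⟩ := by
      apply Fin.ext
      rw [Fin.val_add]
      simp [Nat.mod_eq_of_lt hk]
    have e2 : xw r a ⟨k + 1, hk⟩ = 1 := by
      unfold xw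
      rw [if_neg]
      intro h
      have := congrArg Fin.val h
      simp at this
    rw [e, e2]

open Polynomial in
theorem xm_pow_last (a : F) : (xm r a ^ (r + 2)) *ᵥ Pi.single 0 1 = a • (Pi.single 0 1) := by
  rw [pow_succ', ← Matrix.mulVec_mulVec, xm_pow a (r + 1) (by omega), xm_mulVec]
  have e : (⟨r + 1, by omega⟩ : Fin (r + 2)) + 1 = 0 := by
    apply Fin.ext
    rw [Fin.val_add]
    simp
  rw [e, ← Pi.single_smul]
  simp [xw]

open Polynomial in
theorem xm_charpoly (a : F) : (xm r a).charpoly = X ^ (r + 2) - C a := by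
  set P := (xm r a).charpoly with hP
  have h0 : aeval (xm r a) P = 0 := Matrix.aeval_self_charpoly _
  have hm : P.Monic := Matrix.charpoly_monic _
  have hd : P.natDegree = r + 2 := by rw [hP, Matrix.charpoly_natDegree_eq_dim]; simp
  have hm' : (X ^ (r + 2) - C a : F[X]).Monic := monic_X_pow_sub_C a (by omega)
  set D := P - (X ^ (r + 2) - C a) with hD
  have hdeg : D.degree < (r + 2 : ℕ) := by
    have h1 := degree_sub_lt (p := P) (q := X ^ (r + 2) - C a) (by
      rw [degree_eq_natDegree hm.ne_zero, hd, degree_X_pow_sub_C (by omega)]) hm.ne_zero (by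
      rw [hm.leadingCoeff, hm'.leadingCoeff])
    rw [degree_eq_natDegree hm.ne_zero, hd] at h1
    exact h1
  have hv : (aeval (xm r a) D) *ᵥ Pi.single 0 1 = 0 := by
    rw [hD, map_sub, h0, map_sub, map_pow, aeval_X, aeval_C, Algebra.algebraMap_eq_smul_one, zero_sub,
      Matrix.neg_mulVec, Matrix.sub_mulVec, xm_pow_last, Matrix.smul_mulVec, one_mulVec, sub_self, neg_zero]
  have hnd : D.natDegree < r + 2 := by
    by_cases h : D = 0
    · rw [h]; simp
    · exact (natDegree_lt_iff_degree_lt h).2 hdeg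
  rw [aeval_eq_sum_range' hnd, Matrix.sum_mulVec] at hv
  have hD0 : D = 0 := by
    ext k
    rw [coeff_zero]
    by_cases hk : k < r + 2
    · have := congrFun hv ⟨k, hk⟩
      rw [Finset.sum_apply, Finset.sum_eq_single k] at this
      · rw [Matrix.smul_mulVec, xm_pow a k hk] at this
        simpa using this
      · intro j hj hjk
        rw [Matrix.smul_mulVec, xm_pow a j (Finset.mem_range.1 hj)]
        have : (⟨k, hk⟩ : Fin (r + 2)) ≠ ⟨j, Finset.mem_range.1 hj⟩ := fun h => hjk (congrArg Fin.val h).symm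
        simp [Pi.single_eq_of_ne this]
      · intro h; exact absurd (Finset.mem_range.2 hk) h
    · exact coeff_eq_zero_of_natDegree_lt (by omega)
  exact sub_eq_zero.1 hD0

theorem xm_det (a : F) : (xm r a).det = (-1) ^ (r + 1) * a := by
  rw [Matrix.det_eq_sign_charpoly_coeff, xm_charpoly]
  simp [Polynomial.coeff_X_pow]
  ring

open Polynomial in
theorem exists_c (H : HF F p q) {x : Matrix (Fin (r + 2)) (Fin (r + 2)) F} (hx : xᴴ * x = 1) {a : F} (ha : a ≠ 0)
    (hc : x.charpoly = X ^ (r + 2) - C a) {d : F} (hd : d * star d = 1) :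
    ∃ c : Matrix (Fin (r + 2)) (Fin (r + 2)) F, cᴴ * c = 1 ∧ c.det = d ∧ c * x = x * c := by
  have := H.charP
  have := Fact.mk H.hp
  obtain ⟨l, l0, hl⟩ := H.hilbert90 (d := star d) (by rw [star_star, mul_comm]; exact hd)
  obtain ⟨f, hf⟩ := det_surj (p := p) (n := r + 2) (by omega) x ha hc l
  set N := aeval x f with hN
  have hx' := mul_eq_one_comm.1 hx
  have com : ∀ y, Commute y x → Commute y N := by
    intro y hy
    rw [hN, aeval_eq_sum_range]
    exact Commute.sum_right _ _ _ fun i _ => (hy.pow_right i).smul_right _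
  have c1 : Commute x N := com x (Commute.refl x)
  have c2 : Commute Nᴴ x := by
    have h1 : Nᴴ * xᴴ = xᴴ * Nᴴ := by
      rw [← conjTranspose_mul, ← conjTranspose_mul, c1.eq]
    change Nᴴ * x = x * Nᴴ
    calc Nᴴ * x = x * (xᴴ * Nᴴ) * x := by rw [← Matrix.mul_assoc, hx', Matrix.one_mul]
      _ = x * Nᴴ := by rw [← h1, Matrix.mul_assoc, Matrix.mul_assoc, hx, Matrix.mul_one]
  have c3 : Nᴴ * N = N * Nᴴ := com _ c2
  have hu : IsUnit Nᴴ.det := by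
    rw [det_conjTranspose, hf]
    exact (star_ne_zero.2 l0).isUnit
  have hu' : IsUnit N.det := by
    rw [hf]; exact l0.isUnit
  have i1 : Nᴴ * (Nᴴ)⁻¹ = 1 := mul_nonsing_inv _ hu
  have i2 : (Nᴴ)⁻¹ * Nᴴ = 1 := nonsing_inv_mul _ hu
  have i3 : N⁻¹ * N = 1 := nonsing_inv_mul _ hu'
  refine ⟨N * (Nᴴ)⁻¹, ?_, ?_, ?_⟩
  · rw [conjTranspose_mul, conjTranspose_nonsing_inv, conjTranspose_conjTranspose, Matrix.mul_assoc,
      ← Matrix.mul_assoc Nᴴ, c3, Matrix.mul_assoc N, i1, Matrix.mul_one, i3]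
  · rw [det_mul, hf]
    have : (Nᴴ)⁻¹.det * star l = 1 := by
      rw [← hf, ← det_conjTranspose, ← det_mul, i2, det_one]
    have h0 : star l ≠ 0 := star_ne_zero.2 l0
    apply mul_right_cancel₀ h0
    rw [mul_assoc, this, mul_one, hl, ← mul_assoc, hd, one_mul]
  · have c4 : (Nᴴ)⁻¹ * x = x * (Nᴴ)⁻¹ := by
      calc (Nᴴ)⁻¹ * x = (Nᴴ)⁻¹ * (x * Nᴴ) * (Nᴴ)⁻¹ := by rw [Matrix.mul_assoc, Matrix.mul_assoc, i1, Matrix.mul_one]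
        _ = x * (Nᴴ)⁻¹ := by rw [← c2.eq, ← Matrix.mul_assoc, i2, Matrix.one_mul]
    rw [Matrix.mul_assoc, c4, ← Matrix.mul_assoc, ← c1.eq, Matrix.mul_assoc]

theorem exists_mats (H : HF F p q) (r : ℕ) {a l d : F} (σ : F ≃+* F) (ha : a * star a = 1) (hl : l * star l = 1)
    (hd : d * star d = 1) (hs : σ a = a * l ^ (r + 2)) :
    ∃ x Y : Matrix (Fin (r + 2)) (Fin (r + 2)) F, xᴴ * x = 1 ∧ Yᴴ * Y = 1 ∧ x.det = a ∧ Y.det = d ∧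
      Y * x.map σ = l • (x * Y) := by
  set b := (-1) ^ (r + 1) * a with hb
  have hs1 : ((-1) ^ (r + 1) * (-1) ^ (r + 1) : F) = 1 := by rw [← mul_pow]; simp
  have hb1 : b * star b = 1 := by
    rw [hb, star_mul', star_pow, star_neg, star_one]
    linear_combination (a * star a) * hs1 + ha
  have hb0 : b ≠ 0 := by intro h; rw [h] at hb1; simp at hb1
  have hbs : σ b = b * l ^ (r + 2) := by
    rw [hb, map_mul, hs]; simp; ring
  set x := xm r b with hx
  have hxu : xᴴ * x = 1 := xm_u hb1
  set D : Matrix (Fin (r + 2)) (Fin (r + 2)) F := Matrix.diagonal (fun i => l ^ (i : ℕ)) with hD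
  have hDu : Dᴴ * D = 1 := by
    rw [hD, diagonal_conjTranspose, diagonal_mul_diagonal, ← diagonal_one]
    congr 1
    ext i
    rw [Pi.star_apply, star_pow, ← mul_pow, mul_comm, hl, one_pow]
  have hD1 := det_u hDu
  obtain ⟨c, hcu, hcd, hcx⟩ := exists_c H hxu hb0 (xm_charpoly b) (d := d * star D.det) (by
    rw [star_mul', star_star]; linear_combination (d * star d) * hD1 + hd)
  refine ⟨x, c * D, hxu, mul_u hcu hDu, ?_, ?_, ?_⟩
  · rw [hx, xm_det, hb, ← mul_assoc, hs1, one_mul]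
  · rw [det_mul, hcd]; linear_combination d * hD1
  · have key : D * x.map σ = l • (x * D) := by
      ext i j
      rw [hD, Matrix.diagonal_mul, Matrix.smul_apply, Matrix.mul_diagonal, Matrix.map_apply, hx, xm_apply]
      by_cases hij : i = j + 1
      · rw [if_pos hij]
        by_cases hj : j = Fin.last (r + 1)
        · have hi : i = 0 := by rw [hij, hj]; simp
          subst hi
          simp [xw, hbs, hj]
          ring
        · have hi : (i : ℕ) = j + 1 := by
            rw [hij, Fin.val_add_one, if_neg hj]
          have hi0 : i ≠ 0 := by intro h; rw [h] at hi; simp at hi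
          simp [xw, hi0, hi, pow_succ]
          ring
      · rw [if_neg hij]; simp
    rw [Matrix.mul_assoc, key, Matrix.mul_smul, ← Matrix.mul_assoc, hcx, Matrix.mul_assoc]

end UV
set_option linter.all false

namespace UV
open Matrix
variable {F : Type*} [Field F] [Fintype F] [StarRing F] {p q r : ℕ}

theorem ringAut_cyclic (H : HF F p q) : IsCyclic (RingAut F) := by
  have := H.charP
  have := Fact.mk H.hp
  let fr : RingAut F := frobeniusEquiv F p
  have hfr : ∀ (j : ℕ) (x : F), (fr ^ j) x = x ^ (p ^ j) := by
    intro j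
    induction j with
    | zero => intro x; simp
    | succ j ih =>
      intro x
      rw [pow_succ, RingAut.mul_apply, ih]
      change (frobeniusEquiv F p x) ^ p ^ j = _
      rw [frobeniusEquiv_apply, frobenius_def, ← pow_mul, pow_succ']
  refine ⟨fr, fun σ => ?_⟩
  obtain ⟨j, hj⟩ := frob_hom p (σ : F →+* F)
  refine ⟨j, ?_⟩
  apply RingEquiv.ext
  intro x
  have h1 : (fr ^ (j : ℤ)) x = (fr ^ j) x := by rw [zpow_natCast]
  exact h1.trans ((hfr j x).trans (hj x).symm)

variable {SU : Subgroup (SpecialLinearGroup (Fin (r + 2)) F)} {G : Type*} [Group G]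

def W (H : HF F p q)
    (hSU : ∀ A : SpecialLinearGroup (Fin (r + 2)) F, A ∈ SU ↔ (A : Matrix (Fin (r + 2)) (Fin (r + 2)) F)ᴴ * A = 1)
    (ι : SU →* G) : Subgroup (G × RingAut F) where
  carrier := {w | ∃ M, Imp ι w.1 M w.2}
  one_mem' := ⟨1, Imp.one H hSU⟩
  mul_mem' := fun ⟨_, ha⟩ ⟨_, hb⟩ => ⟨_, ha.mul H hSU hb⟩
  inv_mem' := fun ⟨_, ha⟩ => ⟨_, ha.inv H hSU⟩

def W2 (H : HF F p q)
    (hSU : ∀ A : SpecialLinearGroup (Fin (r + 2)) F, A ∈ SU ↔ (A : Matrix (Fin (r + 2)) (Fin (r + 2)) F)ᴴ * A = 1)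
    (ι : SU →* G) : Subgroup (G × Fˣ) where
  carrier := {w | ∃ M, Imp ι w.1 M (RingEquiv.refl F) ∧ M.det = w.2}
  one_mem' := ⟨1, Imp.one H hSU, by simp⟩
  mul_mem' := fun ⟨_, ha, ha'⟩ ⟨_, hb, hb'⟩ => ⟨_, ha.mul H hSU hb, by
    rw [det_mul, det_map', ha', hb']; simp⟩
  inv_mem' := fun {w} ⟨M, ha, ha'⟩ => ⟨_, ha.inv H hSU, by
    rw [det_map', det_conjTranspose, ha']
    have := det_u ha.u
    rw [ha'] at this
    change star (w.2 : F) = ((w.2)⁻¹ : Fˣ)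
    rw [Units.val_inv_eq_inv_val]
    exact (eq_inv_of_mul_eq_one_right this)⟩

theorem final (H : HF F p q)
    (hSU : ∀ A : SpecialLinearGroup (Fin (r + 2)) F, A ∈ SU ↔ (A : Matrix (Fin (r + 2)) (Fin (r + 2)) F)ᴴ * A = 1)
    (ι : SU →* G) (hcent : ∀ g : G, (∀ A, g * ι A = ι A * g) → g = 1)
    (hk : ∀ A, ι A = 1 → A ∈ Subgroup.center SU)
    (hall : ∀ g : G, ∃ M σ, Imp ι g M σ)
    (hab : ∀ g h : G, ∃ B, g * h = ι B * (h * g)) :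
    ∃ A : Subgroup G, (∀ x y : A, (x : G) * y = (y : G) * x) ∧ A ⊔ ι.range = ⊤ := by
  have := ringAut_cyclic H
  obtain ⟨⟨σ₀, hσ₀⟩, hJ⟩ := IsCyclic.exists_generator (α := (W H hSU ι).map (MonoidHom.snd G (RingAut F)))
  obtain ⟨⟨a₀, ha₀⟩, hI⟩ := IsCyclic.exists_generator (α := (W2 H hSU ι).map (MonoidHom.snd G Fˣ))
  obtain ⟨⟨g0, σ'⟩, ⟨M0, hM0⟩, rfl⟩ := id hσ₀
  obtain ⟨⟨g1, a'⟩, ⟨M1, hM1, hd1⟩, rfl⟩ := id ha₀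
  simp only [MonoidHom.coe_snd] at *
  obtain ⟨B, hB⟩ := hab g0 g1
  have I1 := hM0.mul H hSU hM1
  have I2 := (Imp.iota H hSU (ι := ι) B).mul H hSU (hM1.mul H hSU hM0)
  rw [← hB] at I2
  obtain ⟨l, hl, hle⟩ := Imp.scal H hSU hk (σ := σ') I2 I1
  have hs : σ' (a' : F) = a' * l ^ (r + 2) := by
    have h1 := congrArg det hle
    have hn0 : M0.det ≠ 0 := by
      intro h; have := det_u hM0.u; rw [h] at this; simp at this
    rw [det_smul, det_mul, det_mul, det_map', det_map', det_mul, det_map', hd1, B.1.2] at h1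
    simp only [RingEquiv.refl_apply, Fintype.card_fin] at h1
    apply mul_left_cancel₀ hn0
    linear_combination h1
  have ha1 : (a' : F) * star (a' : F) = 1 := by rw [← hd1]; exact det_u hM1.u
  obtain ⟨x, Y, hxu, hYu, hxd, hYd, hxY⟩ := exists_mats H r σ' ha1 hl (det_u hM0.u) hs
  obtain ⟨gx, hgx⟩ := hM1.adj H hSU hxu (by rw [hxd, hd1])
  obtain ⟨gy, hgy⟩ := hM0.adj H hSU hYu hYd
  have hcomm : gx * gy = gy * gx := by
    have J1 := (hgx.mul H hSU hgy).smul H hSU hl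
    have J2 := hgy.mul H hSU hgx
    rw [hxY] at J2
    exact Imp.uniq H hSU (σ := σ') hcent J1 J2
  refine ⟨Subgroup.closure {gx, gy}, ?_, ?_⟩
  · have hc : ∀ x ∈ ({gx, gy} : Set G), ∀ y ∈ ({gx, gy} : Set G), x * y = y * x := by
      rintro x (rfl | rfl) y (rfl | rfl)
      · rfl
      · exact hcomm
      · exact hcomm.symm
      · rfl
    letI := Subgroup.closureCommGroupOfComm hc
    intro x y
    exact congrArg Subtype.val (mul_comm x y)
  · rw [eq_top_iff]
    intro g _
    have mx : gx ∈ Subgroup.closure {gx, gy} := Subgroup.subset_closure (by simp)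
    have my : gy ∈ Subgroup.closure {gx, gy} := Subgroup.subset_closure (by simp)
    obtain ⟨M, σ, hM⟩ := hall g
    have w1 : ((g, σ) : G × RingAut F) ∈ W H hSU ι := ⟨M, hM⟩
    have w2 : ((gy, σ') : G × RingAut F) ∈ W H hSU ι := ⟨Y, hgy⟩
    obtain ⟨k, hk'⟩ := hJ ⟨σ, ⟨(g, σ), w1, rfl⟩⟩
    have hk2 : σ' ^ k = σ := congrArg Subtype.val hk'
    have w3 := (W H hSU ι).mul_mem w1 ((W H hSU ι).inv_mem ((W H hSU ι).zpow_mem w2 k))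
    have e3 : ((g, σ) : G × RingAut F) * ((gy, σ') ^ k)⁻¹ = (g * (gy ^ k)⁻¹, 1) := by
      refine Prod.ext rfl ?_
      change σ * (σ' ^ k)⁻¹ = 1
      rw [hk2, mul_inv_cancel]
    rw [e3] at w3
    obtain ⟨M', hM'⟩ := w3
    have hu' := det_u hM'.u
    have w4 : ((g * (gy ^ k)⁻¹, Units.mk0 M'.det (left_ne_zero_of_mul_eq_one hu')) : G × Fˣ) ∈ W2 H hSU ι := ⟨M', hM', rfl⟩
    have w5 : ((gx, a') : G × Fˣ) ∈ W2 H hSU ι := ⟨x, hgx, hxd⟩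
    obtain ⟨t, ht⟩ := hI ⟨_, ⟨_, w4, rfl⟩⟩
    have ht2 : a' ^ t = Units.mk0 M'.det (left_ne_zero_of_mul_eq_one hu') := congrArg Subtype.val ht
    have w6 := (W2 H hSU ι).mul_mem w4 ((W2 H hSU ι).inv_mem ((W2 H hSU ι).zpow_mem w5 t))
    obtain ⟨N, hN, hNd⟩ := w6
    have hNd1 : N.det = 1 := by
      rw [hNd]
      change ((Units.mk0 M'.det (left_ne_zero_of_mul_eq_one hu') * (a' ^ t)⁻¹ : Fˣ) : F) = 1
      rw [ht2]; simp
    obtain ⟨B', hB'⟩ := mkSU H hSU hN.u hNd1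
    have hio := Imp.iota H hSU (ι := ι) B'
    rw [hB'] at hio
    have hfin : g * (gy ^ k)⁻¹ * (gx ^ t)⁻¹ = ι B' := Imp.uniq H hSU hcent hN hio
    have : g = ι B' * gx ^ t * gy ^ k := by rw [← hfin]; group
    rw [this]
    refine Subgroup.mul_mem _ (Subgroup.mul_mem _ ?_ ?_) ?_
    · exact Subgroup.mem_sup_right ⟨B', rfl⟩
    · exact Subgroup.mem_sup_left (Subgroup.zpow_mem _ mx t)
    · exact Subgroup.mem_sup_left (Subgroup.zpow_mem _ my k)
end UV
set_option linter.all false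

namespace UV
open Matrix

/-- The conclusion in terms of a star ring structure on the field. -/
theorem supplement {F : Type*} [Field F] [Fintype F] [StarRing F] {p q r : ℕ} (H : HF F p q)
    {SU : Subgroup (SpecialLinearGroup (Fin (r + 2)) F)}
    (hSU : ∀ A : SpecialLinearGroup (Fin (r + 2)) F, A ∈ SU ↔ (A : Matrix (Fin (r + 2)) (Fin (r + 2)) F)ᴴ * A = 1)
    {G : Type*} [Group G] [Finite G] (G₀ : Subgroup G) [G₀.Normal]
    (hsimple : IsSimpleGroup G₀)
    (hcent : Subgroup.centralizer (G₀ : Set G) = ⊥)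
    (e : G₀ ≃* (SU ⧸ Subgroup.center SU))
    (hab : ∀ x y : G ⧸ G₀, x * y = y * x) :
    ∃ A : Subgroup G, (∀ x y : A, (x : G) * y = (y : G) * x) ∧ A ⊔ G₀ = ⊤ := by
  let ρ : SU →* G₀ := (e.symm : (SU ⧸ Subgroup.center SU) →* G₀).comp (QuotientGroup.mk' (Subgroup.center SU))
  have hρs : Function.Surjective ρ := e.symm.surjective.comp (QuotientGroup.mk'_surjective _)
  have hρk : ∀ A, ρ A = 1 ↔ A ∈ Subgroup.center SU := by
    intro A
    change e.symm (QuotientGroup.mk' _ A) = 1 ↔ _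
    rw [EmbeddingLike.map_eq_one_iff]
    exact QuotientGroup.eq_one_iff A
  let ι : SU →* G := G₀.subtype.comp ρ
  have hι : ∀ A, ι A = (ρ A : G) := fun A => rfl
  have hr : ι.range = G₀ := by
    ext g
    constructor
    · rintro ⟨A, rfl⟩; exact (ρ A).2
    · intro hg
      obtain ⟨A, hA⟩ := hρs ⟨g, hg⟩
      exact ⟨A, by rw [hι, hA]⟩
  have := final H hSU ι (by
    intro g hg
    have : g ∈ Subgroup.centralizer (G₀ : Set G) := by
      rw [Subgroup.mem_centralizer_iff]
      intro h hh
      obtain ⟨A, rfl⟩ : h ∈ ι.range := by rw [hr]; exact hh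
      exact (hg A).symm
    rw [hcent] at this
    exact this) (by
    intro A hA
    rw [← hρk]
    exact Subtype.ext hA) (by
    intro g
    obtain ⟨σ, M, hM, h⟩ := transfer H hSU ρ (((MulAut.conjNormal g : MulAut G₀) : G₀ →* G₀).comp ρ) hρs
      ((MulAut.conjNormal g : MulAut G₀).surjective.comp hρs) hρk (fun A => by
        rw [← hρk, MonoidHom.comp_apply]
        exact EmbeddingLike.map_eq_one_iff (f := (MulAut.conjNormal g : MulAut G₀)))
    refine ⟨M, σ, hM, fun A A' hA => ?_⟩
    have := congrArg Subtype.val (h A A' hA)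
    rw [hι, hι, this]
    exact (MulAut.conjNormal_apply g (ρ A)).symm) (by
    intro g h
    have h1 := hab g h
    rw [← QuotientGroup.mk_mul, ← QuotientGroup.mk_mul, eq_comm] at h1
    have h2 := QuotientGroup.eq.1 h1
    have h3 : g * h * (h * g)⁻¹ ∈ G₀ := by
      have := Subgroup.Normal.conj_mem (inferInstance : G₀.Normal) _ h2 (h * g)
      convert this using 1
      group
    rw [← hr] at h3
    obtain ⟨B, hB⟩ := h3
    exact ⟨B, by rw [hB]; group⟩)
  rw [hr] at this
  exact this

end UV

open Matrix

/-- A finite almost simple group whose socle is isomorphic to `PSU(n,q)` (the quotient by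
its center of the group `SU(n,q)` of matrices `A ∈ SL(n, F_{q²})` with `(A^{[q]})ᵀ·A = 1`),
assumed nonabelian simple, with abelian quotient over the socle, has an abelian supplement
to its socle. -/
theorem abelian_supplements_stmt_14
    (n p m q : ℕ) (hn : 2 ≤ n) (hp : p.Prime) (hm : 0 < m) (hq : q = p ^ m)
    (F : Type*) [Field F] [Fintype F] (hcard : Fintype.card F = q ^ 2)
    (SU : Subgroup (Matrix.SpecialLinearGroup (Fin n) F))
    (hSU : ∀ A : Matrix.SpecialLinearGroup (Fin n) F, A ∈ SU ↔
      ((A : Matrix (Fin n) (Fin n) F).map fun x => x ^ q)ᵀ *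
        (A : Matrix (Fin n) (Fin n) F) = 1)
    (G : Type*) [Group G] [Finite G] (G₀ : Subgroup G) [G₀.Normal]
    (hsimple : IsSimpleGroup G₀) (hnonab : ∃ x y : G₀, x * y ≠ y * x)
    (hcent : Subgroup.centralizer (G₀ : Set G) = ⊥)
    (hiso : Nonempty (G₀ ≃* (SU ⧸ Subgroup.center SU)))
    (hab : ∀ x y : G ⧸ G₀, x * y = y * x) :
    ∃ A : Subgroup G, (∀ x y : A, (x : G) * y = (y : G) * x) ∧ A ⊔ G₀ = ⊤ := by
  obtain ⟨r, rfl⟩ : ∃ r, n = r + 2 := ⟨n - 2, by omega⟩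
  have hpf := Fact.mk hp
  have hch : CharP F p := by
    refine charP_of_card_eq_prime_pow (f := m * 2) ?_
    rw [hcard, hq, ← pow_mul]
  letI : StarRing F :=
    { star := fun x => x ^ q
      star_involutive := fun x => by
        change (x ^ q) ^ q = x
        rw [← pow_mul, ← sq, ← hcard, FiniteField.pow_card]
      star_mul := fun x y => by
        change (x * y) ^ q = y ^ q * x ^ q
        rw [mul_pow, mul_comm]
      star_add := fun x y => by
        change (x + y) ^ q = x ^ q + y ^ q
        rw [hq, add_pow_char_pow] }
  have H : HF F p q := ⟨hp, ⟨m, hm, hq⟩, fun _ => rfl, hcard⟩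
  obtain ⟨e⟩ := hiso
  exact UV.supplement H (fun A => hSU A) G₀ hsimple hcent e hab
end

section
/- Let n and m be positive integers and let d = gcd(n, m). Then there exists an odd integer y such that y·n ≡ d (mod m). -/
/-- For positive integers `n`, `m` with `d = gcd(n,m)` there exists an odd integer `y`
such that `y·n ≡ d (mod m)`. -/
theorem abelian_supplements_stmt_15
    (n m : ℕ) (hn : 0 < n) (hm : 0 < m) (d : ℕ) (hd : d = Nat.gcd n m) :
    ∃ y : ℤ, Odd y ∧ (m : ℤ) ∣ y * n - d := by
  have hb : (d : ℤ) = n * Nat.gcdA n m + m * Nat.gcdB n m := by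
    rw [hd]; exact Nat.gcd_eq_gcd_ab n m
  generalize Nat.gcdA n m = a at hb
  generalize Nat.gcdB n m = b at hb
  have hd0 : (d : ℤ) ≠ 0 := by
    have := Nat.gcd_pos_of_pos_left m hn
    omega
  obtain ⟨n', hn'⟩ : d ∣ n := hd ▸ Nat.gcd_dvd_left n m
  obtain ⟨m', hm'⟩ : d ∣ m := hd ▸ Nat.gcd_dvd_right n m
  have hnz : (n : ℤ) = d * n' := by exact_mod_cast hn'
  have hmz : (m : ℤ) = d * m' := by exact_mod_cast hm'
  have h1 : (n' : ℤ) * a + m' * b = 1 := by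
    apply mul_left_cancel₀ hd0
    rw [hnz, hmz] at hb
    linear_combination -hb
  rcases Int.even_or_odd a with ha | ha
  · have ho : Odd ((m' : ℤ) * b) := by
      have h2 : (m' : ℤ) * b = 1 - n' * a := by linear_combination h1
      rw [h2]
      exact odd_one.sub_even (ha.mul_left _)
    refine ⟨a + m', ha.add_odd (Int.odd_mul.mp ho).1, n' - b, ?_⟩
    rw [hnz, hmz]
    linear_combination (d : ℤ) * h1
  · refine ⟨a, ha, -b, ?_⟩
    linear_combination -hb
end
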